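/- arXiv:2212.14023 — 2 statements merged into one kernel-verified Lean document; each statement's English description precedes it below -/
import Mathlib

section
/- (Gaussian correlation inequality, Royen) Let μ be a centered Gaussian measure on a finite-dimensional real vector space X. Then for any two symmetric convex Borel sets K₁, K₂ ⊆ X, one has μ(K₁)·μ(K₂) ≤ μ(K₁ ∩ K₂). -/
open MeasureTheory ProbabilityTheory
open scoped NNReal ENNReal

noncomputable section

/-- A centered Gaussian measure on `ℝⁿ` (any finite-dimensional real vector space, up to
isomorphism): a Borel probability measure all of whose one-dimensional pushforwards under
linear functionals are centered Gaussian (possibly degenerate).  In finite dimension every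
linear functional is continuous, so we quantify over continuous linear functionals. -/
def IsCenteredGaussian {n : ℕ} (μ : Measure (EuclideanSpace ℝ (Fin n))) : Prop :=
  IsProbabilityMeasure μ ∧
    ∀ L : EuclideanSpace ℝ (Fin n) →L[ℝ] ℝ, ∃ v : ℝ≥0, μ.map L = gaussianReal 0 v

section

open Set Filter Topology
open scoped Pointwise

/-- A one-dimensional Brunn–Minkowski inequality for compact sets. -/
lemma volume_add_volume_le_of_isCompact {A B S : Set ℝ} (hA : IsCompact A) (hB : IsCompact B)
    (hA' : A.Nonempty) (hB' : B.Nonempty) (hS : ∀ a ∈ A, ∀ b ∈ B, (a + b) / 2 ∈ S) :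
    volume A + volume B ≤ 2 * volume S := by
  obtain ⟨a, ha, hamax⟩ := hA.exists_isGreatest hA'
  obtain ⟨b, hb, hbmin⟩ := hB.exists_isLeast hB'
  have hsub : ((· + b) '' A) ∪ ((a + ·) '' B) ⊆ (2 : ℝ) • S := by
    rintro _ (⟨x, hx, rfl⟩ | ⟨x, hx, rfl⟩)
    · exact ⟨_, hS x hx b hb, by simp; ring⟩
    · exact ⟨_, hS a ha x hx, by simp; ring⟩
  have hinter : ((· + b) '' A) ∩ ((a + ·) '' B) ⊆ {a + b} := by
    rintro _ ⟨⟨x, hx, rfl⟩, ⟨y, hy, h⟩⟩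
    have h1 := hamax hx
    have h2 := hbmin hy
    simp only [mem_singleton_iff] at *
    linarith
  have hmeas : MeasurableSet ((a + ·) '' B) := (hB.image (by fun_prop)).measurableSet
  have hunion : volume A + volume B = volume (((· + b) '' A) ∪ ((a + ·) '' B)) := by
    have := measure_union_add_inter (μ := volume) ((· + b) '' A) hmeas
    rw [measure_mono_null hinter (by simp), add_zero] at this
    rw [this]
    simp [measure_preimage_add_right]
  rw [hunion]
  refine (measure_mono hsub).trans_eq ?_
  rw [Measure.addHaar_smul]
  simp

/-- A one-dimensional Brunn–Minkowski inequality for measurable sets. -/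
lemma volume_add_volume_le {A B S : Set ℝ} (hA : MeasurableSet A) (hB : MeasurableSet B)
    (hA' : A.Nonempty) (hB' : B.Nonempty) (hS : ∀ a ∈ A, ∀ b ∈ B, (a + b) / 2 ∈ S) :
    volume A + volume B ≤ 2 * volume S := by
  obtain ⟨a₀, ha₀⟩ := hA'
  obtain ⟨b₀, hb₀⟩ := hB'
  rw [hA.measure_eq_iSup_isCompact, hB.measure_eq_iSup_isCompact]
  simp only [iSup_and']
  refine ENNReal.biSup_add_biSup_le' ⟨∅, by simp⟩ ⟨∅, by simp⟩ fun K hK L hL => ?_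
  have h1 : volume K ≤ volume (insert a₀ K) := measure_mono (subset_insert _ _)
  have h2 : volume L ≤ volume (insert b₀ L) := measure_mono (subset_insert _ _)
  refine (add_le_add h1 h2).trans (volume_add_volume_le_of_isCompact (hK.2.insert _)
    (hL.2.insert _) (insert_nonempty _ _) (insert_nonempty _ _) fun a ha b hb => hS a ?_ b ?_)
  · exact insert_subset ha₀ hK.1 ha
  · exact insert_subset hb₀ hL.1 hb

/-- The additive form of the one-dimensional Prékopa–Leindler inequality for functions whose
supremum is one. -/
lemma lintegral_add_lintegral_le {F G H : ℝ → ℝ} (hF : Measurable F) (hG : Measurable G)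
    (hH : Measurable H) (hF0 : ∀ x, 0 ≤ F x) (hG0 : ∀ x, 0 ≤ G x) (hH0 : ∀ x, 0 ≤ H x)
    (hF1 : ∀ x, F x ≤ 1) (hG1 : ∀ x, G x ≤ 1)
    (hF1' : ∀ t < 1, ∃ x, t < F x) (hG1' : ∀ t < 1, ∃ x, t < G x)
    (h : ∀ a b, F a * G b ≤ H ((a + b) / 2) ^ 2) :
    (∫⁻ x, ENNReal.ofReal (F x)) + ∫⁻ x, ENNReal.ofReal (G x)
      ≤ 2 * ∫⁻ x, ENNReal.ofReal (H x) := by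
  have key {f : ℝ → ℝ} (hf : Measurable f) (h0 : ∀ x, 0 ≤ f x) (h1 : ∀ x, f x ≤ 1) :
      ∫⁻ x, ENNReal.ofReal (f x) = ∫⁻ t in Ioo 0 1, volume {x | t < f x} := by
    rw [lintegral_eq_lintegral_meas_lt _ (ae_of_all _ h0) hf.aemeasurable,
      ← lintegral_indicator measurableSet_Ioi, ← lintegral_indicator measurableSet_Ioo]
    congr with t
    by_cases ht : t < 1
    · simp [indicator, ht]
    · have : {x | t < f x} = ∅ := by
        ext x
        have := h1 x
        simp only [mem_ofPred_eq, mem_empty_iff_false, iff_false]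
        linarith
      simp [indicator, this]
  rw [key hF hF0 hF1, key hG hG0 hG1,
    lintegral_eq_lintegral_meas_lt _ (ae_of_all _ hH0) hH.aemeasurable,
    ← lintegral_const_mul' _ _ (by simp),
    ← lintegral_add_left']
  · refine (setLIntegral_mono_ae' measurableSet_Ioo (ae_of_all _ fun t ht => ?_)).trans
      (lintegral_mono_set Ioo_subset_Ioi_self)
    refine volume_add_volume_le (measurableSet_lt measurable_const hF)
      (measurableSet_lt measurable_const hG) (hF1' t ht.2) (hG1' t ht.2) fun a ha b hb => ?_
    have h1 := h a b
    have h2 : t ^ 2 < H ((a + b) / 2) ^ 2 := by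
      have := mul_lt_mul'' (show t < F a from ha) (show t < G b from hb) ht.1.le ht.1.le
      nlinarith
    exact lt_of_pow_lt_pow_left₀ 2 (hH0 _) h2
  · refine Antitone.measurable ?_ |>.aemeasurable
    intro s t hst
    exact measure_mono fun x (hx : t < F x) => hst.trans_lt hx

/-- The midpoint Prékopa–Leindler property of a measure on an additive group. -/
def PrekopaLeindler {V : Type*} [AddGroup V] [MeasurableSpace V] (μ : Measure V) : Prop :=
  ∀ ⦃F G H : V → ℝ≥0⦄, Measurable F → Measurable G → Measurable H →
    BddAbove (range F) → BddAbove (range G) → BddAbove (range H) →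
    (∀ x h, F (x + h) * G (x - h) ≤ H x ^ 2) →
    (∫⁻ x, F x ∂μ) * ∫⁻ x, G x ∂μ ≤ (∫⁻ x, H x ∂μ) ^ 2

namespace PrekopaLeindler

lemma volume_real : PrekopaLeindler (volume : Measure ℝ) := by
  intro F G H hF hG hH bF bG bH h
  by_cases hF0 : ∀ x, F x = 0
  · simp [hF0]
  by_cases hG0 : ∀ x, G x = 0
  · simp [hG0]
  push Not at hF0 hG0
  have hsup {f : ℝ → ℝ≥0} (hf : BddAbove (range f)) (h0 : ∃ x, f x ≠ 0) :
      ∃ a : ℝ≥0, 0 < a ∧ (∀ x, f x ≤ a) ∧ ∀ t < a, ∃ x, t < f x := by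
    obtain ⟨x, hx⟩ := h0
    exact ⟨⨆ x, f x, (pos_iff_ne_zero.2 hx).trans_le (le_ciSup hf x), le_ciSup hf,
      fun t ht => exists_lt_of_lt_ciSup ht⟩
  obtain ⟨a, ha, ha1, ha2⟩ := hsup bF hF0
  obtain ⟨b, hb, hb1, hb2⟩ := hsup bG hG0
  set c := NNReal.sqrt (a * b) with hc
  have hc0 : 0 < c := by simp [hc, ha, hb]
  have hc2 : c ^ 2 = a * b := by simp [hc]
  have hdiv {f : ℝ → ℝ≥0} {a : ℝ≥0} (ha : 0 < a) (hf : Measurable f) :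
      ∫⁻ x, f x = a * ∫⁻ x, ENNReal.ofReal ((f x / a : ℝ≥0) : ℝ) := by
    rw [← lintegral_const_mul' _ _ (by simp)]
    congr with x
    rw [ENNReal.ofReal_coe_nnreal, ← ENNReal.coe_mul, mul_div_cancel₀ _ ha.ne']
  have hlt {f : ℝ → ℝ≥0} {a : ℝ≥0} (ha : 0 < a) (hf : ∀ t < a, ∃ x, t < f x) (t : ℝ) (ht : t < 1) :
      ∃ x, t < ((f x / a : ℝ≥0) : ℝ) := by
    obtain ⟨x, hx⟩ := hf (a * t.toNNReal) (by
      have : t.toNNReal < 1 := by simpa using ht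
      simpa using mul_lt_mul_of_pos_left this ha)
    refine ⟨x, (Real.le_coe_toNNReal t).trans_lt ?_⟩
    rw [NNReal.coe_lt_coe, lt_div_iff₀ ha, mul_comm]
    exact hx
  have key := lintegral_add_lintegral_le (F := fun x => ((F x / a : ℝ≥0) : ℝ))
    (G := fun x => ((G x / b : ℝ≥0) : ℝ)) (H := fun x => ((H x / c : ℝ≥0) : ℝ))
    (by fun_prop) (by fun_prop) (by fun_prop) (fun _ => NNReal.coe_nonneg _)
    (fun _ => NNReal.coe_nonneg _) (fun _ => NNReal.coe_nonneg _)
    (fun x => by exact_mod_cast div_le_one_of_le₀ (ha1 x) zero_le)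
    (fun x => by exact_mod_cast div_le_one_of_le₀ (hb1 x) zero_le)
    (hlt ha ha2) (hlt hb hb2) (fun u v => by
      have := h ((u + v) / 2) ((u - v) / 2)
      rw [show (u + v) / 2 + (u - v) / 2 = u by ring,
        show (u + v) / 2 - (u - v) / 2 = v by ring] at this
      norm_cast
      rw [div_mul_div_comm, div_pow, hc2]
      gcongr)
  rw [hdiv ha hF, hdiv hb hG, hdiv hc0 hH]
  set I := ∫⁻ x, ENNReal.ofReal ((F x / a : ℝ≥0) : ℝ)
  set J := ∫⁻ x, ENNReal.ofReal ((G x / b : ℝ≥0) : ℝ)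
  set K := ∫⁻ x, ENNReal.ofReal ((H x / c : ℝ≥0) : ℝ)
  have h4 : 4 * (I * J) ≤ 4 * K ^ 2 := by
    calc 4 * (I * J) ≤ (I + J) ^ 2 := by
          rcases le_total I J with hIJ | hIJ <;> obtain ⟨d, hd⟩ := exists_add_of_le hIJ <;>
            rw [hd]
          · exact (le_self_add (b := d ^ 2)).trans_eq (by ring)
          · exact (le_self_add (b := d ^ 2)).trans_eq (by ring)
      _ ≤ (2 * K) ^ 2 := by gcongr
      _ = 4 * K ^ 2 := by ring
  have h5 : I * J ≤ K ^ 2 := (ENNReal.mul_le_mul_iff_right (by simp) (by simp)).1 h4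
  calc a * I * (b * J) = ((a * b : ℝ≥0) : ℝ≥0∞) * (I * J) := by push_cast; ring
    _ = (c : ℝ≥0∞) ^ 2 * (I * J) := by rw [← hc2]; push_cast; rfl
    _ ≤ c ^ 2 * K ^ 2 := by gcongr
    _ = (c * K) ^ 2 := by ring

variable {V W : Type*} [AddGroup V] [MeasurableSpace V] [AddGroup W] [MeasurableSpace W]

lemma map {μ : Measure V} (hμ : PrekopaLeindler μ) (L : V →+ W) (hL : Measurable L) :
    PrekopaLeindler (μ.map L) := by
  intro F G H hF hG hH bF bG bH h
  rw [lintegral_map (by fun_prop) hL, lintegral_map (by fun_prop) hL,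
    lintegral_map (by fun_prop) hL]
  refine hμ (hF.comp hL) (hG.comp hL) (hH.comp hL) (bF.mono (range_comp_subset_range _ _))
    (bG.mono (range_comp_subset_range _ _)) (bH.mono (range_comp_subset_range _ _)) fun x y => ?_
  simpa using h (L x) (L y)

lemma withDensity {μ : Measure V} (hμ : PrekopaLeindler μ) {ρ : V → ℝ≥0} (hρ : Measurable ρ)
    (bρ : BddAbove (range ρ)) (h : ∀ x h, ρ (x + h) * ρ (x - h) ≤ ρ x ^ 2) :
    PrekopaLeindler (μ.withDensity fun x => ρ x) := by
  intro F G H hF hG hH bF bG bH h'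
  simp only [lintegral_withDensity_eq_lintegral_mul _ hρ.coe_nnreal_ennreal
    hF.coe_nnreal_ennreal, lintegral_withDensity_eq_lintegral_mul _ hρ.coe_nnreal_ennreal
    hG.coe_nnreal_ennreal, lintegral_withDensity_eq_lintegral_mul _ hρ.coe_nnreal_ennreal
    hH.coe_nnreal_ennreal, Pi.mul_apply, ← ENNReal.coe_mul]
  have hb {f : V → ℝ≥0} (hf : BddAbove (range f)) : BddAbove (range fun x => ρ x * f x) := by
    obtain ⟨C, hC⟩ := hf
    obtain ⟨D, hD⟩ := bρ
    refine ⟨D * C, ?_⟩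
    rintro _ ⟨x, rfl⟩
    exact mul_le_mul' (hD ⟨x, rfl⟩) (hC ⟨x, rfl⟩)
  refine hμ (by fun_prop) (by fun_prop) (by fun_prop) (hb bF) (hb bG) (hb bH) fun x y => ?_
  calc ρ (x + y) * F (x + y) * (ρ (x - y) * G (x - y))
      = (ρ (x + y) * ρ (x - y)) * (F (x + y) * G (x - y)) := by ring
    _ ≤ ρ x ^ 2 * H x ^ 2 := mul_le_mul' (h _ _) (h' _ _)
    _ = _ := by ring

lemma prod {μ : Measure V} {ν : Measure W} [SFinite μ] [IsFiniteMeasure ν]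
    (hμ : PrekopaLeindler μ) (hν : PrekopaLeindler ν) : PrekopaLeindler (μ.prod ν) := by
  intro F G H hF hG hH bF bG bH h
  rw [lintegral_prod _ (by fun_prop), lintegral_prod _ (by fun_prop),
    lintegral_prod _ (by fun_prop)]
  have hfin {f : V × W → ℝ≥0} (hf : BddAbove (range f)) :
      ∃ C : ℝ≥0, ∀ x, ∫⁻ y, f (x, y) ∂ν ≤ C := by
    obtain ⟨C, hC⟩ := hf
    refine ⟨C * (ν univ).toNNReal, fun x => ?_⟩
    calc ∫⁻ y, f (x, y) ∂ν ≤ ∫⁻ _, C ∂ν :=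
          lintegral_mono fun y => ENNReal.coe_le_coe.2 (hC ⟨(x, y), rfl⟩)
      _ = _ := by simp [ENNReal.coe_toNNReal (measure_ne_top ν univ)]
  have hcoe {f : V × W → ℝ≥0} (hf : BddAbove (range f)) (x : V) :
      ∫⁻ y, f (x, y) ∂ν = ((∫⁻ y, f (x, y) ∂ν).toNNReal : ℝ≥0∞) := by
    obtain ⟨C, hC⟩ := hfin hf
    exact (ENNReal.coe_toNNReal ((hC x).trans_lt ENNReal.coe_lt_top).ne).symm
  have hbdd {f : V × W → ℝ≥0} (hf : BddAbove (range f)) :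
      BddAbove (range fun x => (∫⁻ y, f (x, y) ∂ν).toNNReal) := by
    obtain ⟨C, hC⟩ := hfin hf
    refine ⟨C, ?_⟩
    rintro _ ⟨x, rfl⟩
    exact ENNReal.toNNReal_mono ENNReal.coe_ne_top (hC x)
  have hmeas {f : V × W → ℝ≥0} (hf : Measurable f) :
      Measurable fun x => (∫⁻ y, f (x, y) ∂ν).toNNReal :=
    (Measurable.lintegral_prod_right' hf.coe_nnreal_ennreal).ennreal_toNNReal
  rw [lintegral_congr (hcoe bF), lintegral_congr (hcoe bG), lintegral_congr (hcoe bH)]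
  refine hμ (hmeas hF) (hmeas hG) (hmeas hH) (hbdd bF) (hbdd bG) (hbdd bH) fun x u => ?_
  rw [← ENNReal.coe_le_coe, ENNReal.coe_mul, ENNReal.coe_pow, ← hcoe bF, ← hcoe bG, ← hcoe bH]
  have hsec {f : V × W → ℝ≥0} (hf : BddAbove (range f)) (x : V) :
      BddAbove (range fun y => f (x, y)) :=
    hf.mono (range_comp_subset_range (fun y => (x, y)) f)
  exact hν (by fun_prop) (by fun_prop) (by fun_prop) (hsec bF _) (hsec bG _) (hsec bH _)
    fun y v => h (x, y) (u, v)

lemma dirac_zero : PrekopaLeindler (Measure.dirac (0 : V)) := by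
  intro F G H hF hG hH _ _ _ h
  rw [lintegral_dirac' _ (by fun_prop), lintegral_dirac' _ (by fun_prop),
    lintegral_dirac' _ (by fun_prop)]
  exact_mod_cast (by simpa using h 0 0)

lemma gaussianReal_zero_one : PrekopaLeindler (gaussianReal 0 1) := by
  rw [gaussianReal_of_var_ne_zero _ one_ne_zero]
  refine volume_real.withDensity (ρ := fun x => (gaussianPDFReal 0 1 x).toNNReal)
    (measurable_gaussianPDFReal 0 1).real_toNNReal ?_ fun x h => ?_
  · refine ⟨(√(2 * Real.pi * (1 : ℝ≥0)))⁻¹.toNNReal, ?_⟩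
    rintro _ ⟨x, rfl⟩
    refine Real.toNNReal_le_toNNReal ?_
    rw [gaussianPDFReal]
    refine mul_le_of_le_one_right (by positivity) (Real.exp_le_one_iff.2 ?_)
    rw [neg_div, neg_nonpos]
    positivity
  · rw [← Real.toNNReal_mul (gaussianPDFReal_nonneg _ _ _),
      ← Real.toNNReal_pow (gaussianPDFReal_nonneg _ _ _)]
    refine Real.toNNReal_le_toNNReal ?_
    simp only [gaussianPDFReal]
    rw [mul_mul_mul_comm, mul_pow, ← sq, ← Real.exp_add, ← Real.exp_nat_mul]
    gcongr
    simp
    nlinarith [sq_nonneg h]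

lemma pi_gaussianReal (n : ℕ) :
    PrekopaLeindler (Measure.pi fun _ : Fin n => gaussianReal 0 1) := by
  induction n with
  | zero =>
    rw [Measure.pi_of_empty _ 0]
    exact dirac_zero
  | succ n ih =>
    have h := (measurePreserving_piFinSuccAbove (fun _ : Fin (n + 1) => gaussianReal 0 1) 0).symm
    rw [← h.map_eq]
    exact (gaussianReal_zero_one.prod ih).map
      { toFun := (MeasurableEquiv.piFinSuccAbove (fun _ => ℝ) 0).symm
        map_zero' := by
          ext i; refine Fin.cases ?_ (fun j => ?_) i <;> simp [MeasurableEquiv.piFinSuccAbove]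
        map_add' := fun x y => by
          ext i; refine Fin.cases ?_ (fun j => ?_) i <;> simp [MeasurableEquiv.piFinSuccAbove] }
      (MeasurableEquiv.measurable _)

lemma stdGaussian (V : Type*) [NormedAddCommGroup V] [InnerProductSpace ℝ V]
    [FiniteDimensional ℝ V] [MeasurableSpace V] [BorelSpace V] :
    PrekopaLeindler (stdGaussian V) :=
  (pi_gaussianReal _).map
    (Fintype.linearCombination ℝ (stdOrthonormalBasis ℝ V)).toAddMonoidHom
    (show Measurable fun x : Fin (Module.finrank ℝ V) → ℝ => ∑ i, x i • stdOrthonormalBasis ℝ V i by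
      fun_prop)

lemma integral_mul_integral_le {μ : Measure V} [IsFiniteMeasure μ] (hμ : PrekopaLeindler μ)
    {F G H : V → ℝ} (hF : Measurable F) (hG : Measurable G) (hH : Measurable H)
    (hF0 : ∀ x, 0 ≤ F x) (hG0 : ∀ x, 0 ≤ G x) (hH0 : ∀ x, 0 ≤ H x) {C : ℝ}
    (bF : ∀ x, F x ≤ C) (bG : ∀ x, G x ≤ C) (bH : ∀ x, H x ≤ C)
    (h : ∀ x h, F (x + h) * G (x - h) ≤ H x ^ 2) :
    (∫ x, F x ∂μ) * ∫ x, G x ∂μ ≤ (∫ x, H x ∂μ) ^ 2 := by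
  have hb {f : V → ℝ} (hf : ∀ x, f x ≤ C) : BddAbove (range fun x => (f x).toNNReal) := by
    refine ⟨C.toNNReal, ?_⟩
    rintro _ ⟨x, rfl⟩
    exact Real.toNNReal_le_toNNReal (hf x)
  have key := hμ hF.real_toNNReal hG.real_toNNReal hH.real_toNNReal (hb bF) (hb bG) (hb bH)
    fun x y => by
      rw [← Real.toNNReal_mul (hF0 _), ← Real.toNNReal_pow (hH0 _)]
      exact Real.toNNReal_le_toNNReal (h x y)
  have hint {f : V → ℝ} (hf : Measurable f) (h0 : ∀ x, 0 ≤ f x) :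
      ∫ x, f x ∂μ = (∫⁻ x, (f x).toNNReal ∂μ).toReal :=
    integral_eq_lintegral_of_nonneg_ae (ae_of_all _ h0) hf.aestronglyMeasurable
  rw [hint hF hF0, hint hG hG0, hint hH hH0, ← ENNReal.toReal_mul, ← ENNReal.toReal_pow]
  refine ENNReal.toReal_mono (ENNReal.pow_ne_top (ne_of_lt ?_)) key
  calc ∫⁻ x, (H x).toNNReal ∂μ ≤ ∫⁻ _, (C.toNNReal : ℝ≥0∞) ∂μ :=
        lintegral_mono fun x => ENNReal.coe_le_coe.2 (Real.toNNReal_le_toNNReal (bH x))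
    _ < ⊤ := by simpa using ENNReal.mul_lt_top ENNReal.coe_lt_top (measure_lt_top μ univ)

end PrekopaLeindler

/-- Even log-concave functions, not identically zero, whose logarithm is bounded below to second
order: `-log f` is convex with second differences at most those of `Λ‖x‖²/2`. -/
structure TamedLogConcave {V : Type*} [NormedAddCommGroup V] (Λ : ℝ) (f : V → ℝ) : Prop where
  even : ∀ x, f (-x) = f x
  zero_pos : 0 < f 0
  nonneg : ∀ x, 0 ≤ f x
  mul_le_sq : ∀ x h, f (x + h) * f (x - h) ≤ f x ^ 2
  sq_le_mul : ∀ x h, f x ^ 2 ≤ f (x + h) * f (x - h) * Real.exp (Λ * ‖h‖ ^ 2)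

/-- The product of the values of `f` at the images of `(x, y)` under a rotation by `π / 4`. -/
def rotProd {V : Type*} [NormedAddCommGroup V] [InnerProductSpace ℝ V] (f : V → ℝ) (x y : V) : ℝ :=
  f ((√2 / 2) • x - (√2 / 2) • y) * f ((√2 / 2) • x + (√2 / 2) • y)

lemma sq_integral_le_of_sq_le_mul {Ω : Type*} [MeasurableSpace Ω] {μ : Measure Ω} {a b d : Ω → ℝ}
    {K : ℝ} (hK : 0 ≤ K) (ha : Integrable a μ) (hb : Integrable b μ) (hd : Integrable d μ)
    (ha0 : ∀ x, 0 ≤ a x) (hb0 : ∀ x, 0 ≤ b x) (hd0 : ∀ x, 0 ≤ d x)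
    (hA : 0 < ∫ x, a x ∂μ) (h : ∀ x, d x ^ 2 ≤ a x * b x * K) :
    (∫ x, d x ∂μ) ^ 2 ≤ (∫ x, a x ∂μ) * (∫ x, b x ∂μ) * K := by
  set A := ∫ x, a x ∂μ
  set B := ∫ x, b x ∂μ
  set D := ∫ x, d x ∂μ
  have hD : 0 ≤ D := integral_nonneg hd0
  have key (t : ℝ) (ht : 0 < t) : 2 * t * D ≤ t ^ 2 * A + K * B := by
    have : ∫ x, 2 * t * d x ∂μ ≤ ∫ x, (t ^ 2 * a x + K * b x) ∂μ := by
      refine integral_mono (hd.const_mul _) ((ha.const_mul _).add (hb.const_mul _)) fun x => ?_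
      have h1 := h x
      have h2 := ha0 x
      have h3 := hb0 x
      have h4 := hd0 x
      refine (pow_le_pow_iff_left₀ (by positivity) (by positivity) two_ne_zero).1 ?_
      nlinarith [sq_nonneg (t ^ 2 * a x - K * b x), mul_le_mul_of_nonneg_left h1 (sq_nonneg t)]
    rwa [integral_add (ha.const_mul _) (hb.const_mul _), integral_const_mul, integral_const_mul,
      integral_const_mul] at this
  rcases hD.eq_or_lt with h0 | h0
  · rw [← h0]
    have : 0 ≤ B := integral_nonneg hb0
    simp only [ne_eq, OfNat.ofNat_ne_zero, not_false_eq_true, zero_pow]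
    positivity
  · have := key (D / A) (by positivity)
    field_simp at this
    nlinarith

namespace TamedLogConcave

section Basic

variable {V : Type*} [NormedAddCommGroup V] {Λ : ℝ} {f g : V → ℝ}

lemma le_zero (hf : TamedLogConcave Λ f) (x : V) : f x ≤ f 0 := by
  have := hf.mul_le_sq 0 x
  rw [zero_add, zero_sub, hf.even, ← sq] at this
  exact (pow_le_pow_iff_left₀ (hf.nonneg x) hf.zero_pos.le two_ne_zero).1 this

lemma sq_zero_le (hf : TamedLogConcave Λ f) (x : V) :
    f 0 ^ 2 ≤ f x ^ 2 * Real.exp (Λ * ‖x‖ ^ 2) := by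
  have := hf.sq_le_mul 0 x
  rwa [zero_add, zero_sub, hf.even, ← sq] at this

lemma pos (hf : TamedLogConcave Λ f) (x : V) : 0 < f x := by
  refine (hf.nonneg x).lt_of_ne' fun h => ?_
  have := hf.sq_zero_le x
  have := hf.zero_pos
  simp [h] at *
  linarith

lemma const_mul (hf : TamedLogConcave Λ f) {c : ℝ} (hc : 0 < c) :
    TamedLogConcave Λ (fun x => c * f x) where
  even x := by rw [hf.even]
  zero_pos := mul_pos hc hf.zero_pos
  nonneg x := mul_nonneg hc.le (hf.nonneg x)
  mul_le_sq x h := by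
    have := mul_le_mul_of_nonneg_left (hf.mul_le_sq x h) (sq_nonneg c)
    linarith
  sq_le_mul x h := by
    have := mul_le_mul_of_nonneg_left (hf.sq_le_mul x h) (sq_nonneg c)
    linarith

lemma exp_neg_mul_le [NormedSpace ℝ V] (hf : TamedLogConcave Λ f) (x h : V) {N : ℕ} (hN : N ≠ 0) :
    f x * Real.exp (-(Λ * ‖x + N • h‖ ^ 2 / (2 * N))) ≤ f (x + h) := by
  have hpos := hf.pos
  set a : ℕ → ℝ := fun k => Real.log (f (x + k • h)) with ha
  have hconc (k : ℕ) : a (k + 2) - a (k + 1) ≤ a (k + 1) - a k := by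
    have h1 := hf.mul_le_sq (x + (k + 1) • h) h
    rw [show x + (k + 1) • h + h = x + (k + 2) • h by module,
      show x + (k + 1) • h - h = x + k • h by module] at h1
    have h2 := Real.log_le_log (mul_pos (hpos _) (hpos _)) h1
    rw [Real.log_mul (hpos _).ne' (hpos _).ne', Real.log_pow] at h2
    simp only [ha]
    push_cast at h2
    linarith
  have hincr (k : ℕ) : a (k + 1) - a k ≤ a 1 - a 0 := by
    induction k with
    | zero => simp
    | succ k ih => exact (hconc k).trans ih
  have hsum (k : ℕ) : a k - a 0 ≤ k * (a 1 - a 0) := by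
    induction k with
    | zero => simp
    | succ k ih =>
      have := hincr k
      push_cast
      linarith
  have hlow : a 0 - Λ * ‖x + N • h‖ ^ 2 / 2 ≤ a N := by
    have h1 := Real.log_le_log (pow_pos hf.zero_pos 2) (hf.sq_zero_le (x + N • h))
    rw [Real.log_mul (pow_pos (hpos _) 2).ne' (Real.exp_pos _).ne', Real.log_exp, Real.log_pow,
      Real.log_pow] at h1
    have h2 := Real.log_le_log (hpos _) (hf.le_zero x)
    simp only [ha, zero_smul, add_zero]
    push_cast at h1
    linarith
  have hN' : (0 : ℝ) < N := by positivity
  have hfin : a 0 - Λ * ‖x + N • h‖ ^ 2 / (2 * N) ≤ a 1 := by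
    have := hsum N
    have h3 : -(Λ * ‖x + N • h‖ ^ 2 / 2) ≤ N * (a 1 - a 0) := by linarith
    have h4 : Λ * ‖x + N • h‖ ^ 2 / (2 * N) * N = Λ * ‖x + N • h‖ ^ 2 / 2 := by
      field_simp
    nlinarith
  have := Real.exp_le_exp.2 hfin
  simp only [ha, zero_smul, add_zero, one_smul] at this
  rwa [sub_eq_add_neg, Real.exp_add, Real.exp_log (hpos _), Real.exp_log (hpos _)] at this

lemma continuous [NormedSpace ℝ V] (hΛ : 0 ≤ Λ) (hf : TamedLogConcave Λ f) : Continuous f := by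
  have hdiff (x h : V) {N : ℕ} (hN : N ≠ 0) {R : ℝ} (hR : ‖x + N • h‖ ≤ R) :
      f x - f (x + h) ≤ f 0 * (Λ * R ^ 2 / (2 * N)) := by
    have h1 := hf.exp_neg_mul_le x h hN
    have h2 := Real.one_sub_le_exp_neg (Λ * ‖x + N • h‖ ^ 2 / (2 * N))
    have h3 : Λ * ‖x + N • h‖ ^ 2 / (2 * N) ≤ Λ * R ^ 2 / (2 * N) := by gcongr
    have h4 := mul_le_mul_of_nonneg_left h2 (hf.nonneg x)
    have h5 : f x * (Λ * ‖x + N • h‖ ^ 2 / (2 * N)) ≤ f 0 * (Λ * R ^ 2 / (2 * N)) :=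
      mul_le_mul (hf.le_zero x) h3 (by positivity) hf.zero_pos.le
    linarith
  refine Metric.continuous_iff.2 fun x ε hε => ?_
  have hlim : Tendsto (fun N : ℕ => f 0 * (Λ * (‖x‖ + 2) ^ 2 / (2 * N))) atTop (𝓝 0) := by
    have := (tendsto_const_div_atTop_nhds_zero_nat (f 0 * (Λ * (‖x‖ + 2) ^ 2 / 2)))
    refine this.congr fun N => ?_
    by_cases hN : (N : ℝ) = 0
    · simp [hN]
    · field_simp
  obtain ⟨N, hNε, hN⟩ := ((hlim.eventually (gt_mem_nhds hε)).and (eventually_ne_atTop 0)).exists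
  have hN' : (1 : ℝ) ≤ N := by exact_mod_cast Nat.one_le_iff_ne_zero.2 hN
  refine ⟨1 / N, by positivity, fun y hy => ?_⟩
  rw [dist_eq_norm, lt_div_iff₀ (by positivity)] at hy
  have hy1 : ‖y - x‖ ≤ 1 := by nlinarith [norm_nonneg (y - x)]
  have hyx : ‖y‖ ≤ ‖x‖ + 1 := by
    have := norm_add_le x (y - x)
    rw [add_sub_cancel] at this
    linarith
  have hbound (z h : V) (hz : ‖z‖ ≤ ‖x‖ + 1) (hh : ‖h‖ * N < 1) : ‖z + N • h‖ ≤ ‖x‖ + 2 := by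
    have := norm_add_le z (N • h)
    have h2 : ‖N • h‖ ≤ N * ‖h‖ := norm_nsmul_le
    linarith
  have h1 := hdiff x (y - x) hN (hbound _ _ (by linarith) hy)
  have h2 := hdiff y (x - y) hN (hbound _ _ hyx (by rwa [norm_sub_rev]))
  rw [add_sub_cancel] at h1 h2
  rw [Real.dist_eq, abs_lt]
  constructor <;> linarith

end Basic

section Inner

variable {V : Type*} [NormedAddCommGroup V] [InnerProductSpace ℝ V] {Λ : ℝ} {f g : V → ℝ}

lemma rotProd_mul_le_sq (hf : TamedLogConcave Λ f) (x y h k : V) :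
    rotProd f (x + h) (y + k) * rotProd f (x - h) (y - k) ≤ rotProd f x y ^ 2 := by
  unfold rotProd
  set c := √2 / 2
  have h1 := hf.mul_le_sq (c • x - c • y) (c • h - c • k)
  have h2 := hf.mul_le_sq (c • x + c • y) (c • h + c • k)
  rw [show c • x - c • y + (c • h - c • k) = c • (x + h) - c • (y + k) by module,
    show c • x - c • y - (c • h - c • k) = c • (x - h) - c • (y - k) by module] at h1
  rw [show c • x + c • y + (c • h + c • k) = c • (x + h) + c • (y + k) by module,
    show c • x + c • y - (c • h + c • k) = c • (x - h) + c • (y - k) by module] at h2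
  have := mul_le_mul h1 h2 (mul_nonneg (hf.nonneg _) (hf.nonneg _)) (sq_nonneg _)
  linarith

lemma sq_le_rotProd_mul (hf : TamedLogConcave Λ f) (x y h k : V) :
    rotProd f x y ^ 2 ≤ rotProd f (x + h) (y + k) * rotProd f (x - h) (y - k) *
      Real.exp (Λ * (‖h‖ ^ 2 + ‖k‖ ^ 2)) := by
  unfold rotProd
  set c := √2 / 2 with hc
  have hc2 : c ^ 2 = 1 / 2 := by rw [hc, div_pow, Real.sq_sqrt (by norm_num)]; norm_num
  have h1 := hf.sq_le_mul (c • x - c • y) (c • h - c • k)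
  have h2 := hf.sq_le_mul (c • x + c • y) (c • h + c • k)
  rw [show c • x - c • y + (c • h - c • k) = c • (x + h) - c • (y + k) by module,
    show c • x - c • y - (c • h - c • k) = c • (x - h) - c • (y - k) by module] at h1
  rw [show c • x + c • y + (c • h + c • k) = c • (x + h) + c • (y + k) by module,
    show c • x + c • y - (c • h + c • k) = c • (x - h) + c • (y - k) by module] at h2
  have h3 := mul_le_mul h1 h2 (sq_nonneg _) ((sq_nonneg _).trans h1)
  have h4 : ‖h‖ ^ 2 + ‖k‖ ^ 2 = ‖c • h - c • k‖ ^ 2 + ‖c • h + c • k‖ ^ 2 := by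
    have := parallelogram_law_with_norm ℝ (c • h) (c • k)
    simp only [norm_smul] at this
    have h5 : ‖c‖ ^ 2 = 1 / 2 := by rw [Real.norm_eq_abs, sq_abs, hc2]
    rw [mul_pow, mul_pow, h5] at this
    linarith
  rw [h4, mul_add, Real.exp_add]
  calc _ = _ := by rw [mul_pow]
    _ ≤ _ := h3
    _ = _ := by ring

lemma rotProd_left (hf : TamedLogConcave Λ f) (y : V) :
    TamedLogConcave Λ (fun x => rotProd f x y) where
  even x := by
    simp only [rotProd]
    rw [mul_comm, ← hf.even, ← hf.even (_ + _)]
    congr 2 <;> module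
  zero_pos := mul_pos (hf.pos _) (hf.pos _)
  nonneg x := mul_nonneg (hf.nonneg _) (hf.nonneg _)
  mul_le_sq x h := by simpa using hf.rotProd_mul_le_sq x y h 0
  sq_le_mul x h := by simpa using hf.sq_le_rotProd_mul x y h 0

lemma rotProd_le (hf : TamedLogConcave Λ f) (x y : V) : rotProd f x y ≤ f 0 ^ 2 := by
  rw [sq]
  exact mul_le_mul (hf.le_zero _) (hf.le_zero _) (hf.nonneg _) hf.zero_pos.le

lemma rotProd_neg_right (f : V → ℝ) (x y : V) : rotProd f x (-y) = rotProd f x y := by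
  rw [rotProd, rotProd, mul_comm]
  congr 2 <;> module

variable [MeasurableSpace V] [BorelSpace V] {μ : Measure V} [IsProbabilityMeasure μ]

lemma integrable (hΛ : 0 ≤ Λ) (hf : TamedLogConcave Λ f) : Integrable f μ :=
  .of_bound (C := f 0) (hf.continuous hΛ).measurable.aestronglyMeasurable <| ae_of_all _ fun x => by
    rw [Real.norm_of_nonneg (hf.nonneg x)]
    exact hf.le_zero x

lemma integral_pos (hΛ : 0 ≤ Λ) (hf : TamedLogConcave Λ f) : 0 < ∫ x, f x ∂μ := by
  rw [integral_pos_iff_support_of_nonneg hf.nonneg (hf.integrable hΛ),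
    show Function.support f = univ from eq_univ_of_forall fun x => (hf.pos x).ne']
  simp

/-- The class of tamed log-concave functions is stable under the doubling operator. -/
lemma integral_rotProd (hμ : PrekopaLeindler μ) (hΛ : 0 ≤ Λ) (hf : TamedLogConcave Λ f) :
    TamedLogConcave Λ (fun y => ∫ x, rotProd f x y ∂μ) where
  even y := by simp only [rotProd_neg_right]
  zero_pos := (hf.rotProd_left 0).integral_pos hΛ
  nonneg y := integral_nonneg (hf.rotProd_left y).nonneg
  mul_le_sq y k :=
    hμ.integral_mul_integral_le ((hf.rotProd_left _).continuous hΛ).measurable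
      ((hf.rotProd_left _).continuous hΛ).measurable ((hf.rotProd_left _).continuous hΛ).measurable
      (hf.rotProd_left _).nonneg (hf.rotProd_left _).nonneg (hf.rotProd_left _).nonneg
      (hf.rotProd_le · _) (hf.rotProd_le · _) (hf.rotProd_le · _)
      fun x h => hf.rotProd_mul_le_sq x y h k
  sq_le_mul y k := by
    refine sq_integral_le_of_sq_le_mul (Real.exp_pos _).le ((hf.rotProd_left _).integrable hΛ)
      ((hf.rotProd_left _).integrable hΛ) ((hf.rotProd_left _).integrable hΛ)
      (hf.rotProd_left _).nonneg (hf.rotProd_left _).nonneg (hf.rotProd_left _).nonneg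
      ((hf.rotProd_left _).integral_pos hΛ) fun x => ?_
    simpa using hf.sq_le_rotProd_mul x y 0 k

end Inner

end TamedLogConcave

section Rotation

variable {V : Type*} [NormedAddCommGroup V] [InnerProductSpace ℝ V] [FiniteDimensional ℝ V]
  [MeasurableSpace V] [BorelSpace V]

lemma integral_integral_mul_rot {𝕜 : Type*} [RCLike 𝕜] {F G : V → 𝕜}
    (hF : Integrable F (stdGaussian V)) (hG : Integrable G (stdGaussian V)) :
    ∫ y, ∫ x, F ((√2 / 2 : ℝ) • x - (√2 / 2 : ℝ) • y) * G ((√2 / 2 : ℝ) • x + (√2 / 2 : ℝ) • y)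
        ∂(stdGaussian V) ∂(stdGaussian V)
      = (∫ x, F x ∂(stdGaussian V)) * ∫ x, G x ∂(stdGaussian V) := by
  have hmap : ((stdGaussian V).prod (stdGaussian V)).map
      (ContinuousLinearMap.rotation (-(Real.pi / 4))) = (stdGaussian V).prod (stdGaussian V) :=
    IsGaussian.map_rotation_eq_self (by simp) _
  have hrot (p : V × V) : ContinuousLinearMap.rotation (-(Real.pi / 4)) p =
      ((√2 / 2 : ℝ) • p.1 - (√2 / 2 : ℝ) • p.2, (√2 / 2 : ℝ) • p.1 + (√2 / 2 : ℝ) • p.2) := by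
    simp [ContinuousLinearMap.rotation_apply, sub_eq_add_neg]
  have hint := hF.mul_prod hG
  have hint' := hint
  rw [← hmap, integrable_map_measure (by rw [hmap]; exact hint.aestronglyMeasurable)
    (by fun_prop)] at hint'
  rw [← integral_prod_mul, ← hmap, integral_map (by fun_prop)
    (by rw [hmap]; exact hint.aestronglyMeasurable)]
  refine Eq.trans ?_ (integral_prod_symm _ hint').symm
  simp only [hrot, Function.comp_apply]

end Rotation

/-- Tamed log-concave functions taking the value one at the origin. -/
abbrev NormalizedTamed (V : Type*) [NormedAddCommGroup V] (Λ : ℝ≥0) : Type _ :=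
  {f : V → ℝ // TamedLogConcave Λ f ∧ f 0 = 1}

namespace NormalizedTamed

section Compactness

variable {V : Type*} [NormedAddCommGroup V] {Λ : ℝ≥0}

lemma le_one (f : NormalizedTamed V Λ) (x : V) : f.1 x ≤ 1 := (f.2.1.le_zero x).trans_eq f.2.2

/-- The normalization of a tamed log-concave function. -/
def normalize {f : V → ℝ} (hf : TamedLogConcave Λ f) : NormalizedTamed V Λ :=
  ⟨fun x => (f 0)⁻¹ * f x, hf.const_mul (inv_pos.2 hf.zero_pos), inv_mul_cancel₀ hf.zero_pos.ne'⟩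

instance : CompactSpace (NormalizedTamed V Λ) := by
  refine isCompact_iff_compactSpace.1 ?_
  have h1 : IsCompact (univ.pi fun _ : V => Icc (0 : ℝ) 1) :=
    isCompact_univ_pi fun _ => isCompact_Icc
  refine h1.of_isClosed_subset ?_ fun f hf x _ => ⟨hf.1.nonneg x, (hf.1.le_zero x).trans_eq hf.2⟩
  have : {f : V → ℝ | TamedLogConcave Λ f ∧ f 0 = 1} =
      {f | (∀ x, f (-x) = f x) ∧ (∀ x, 0 ≤ f x) ∧ (∀ x h, f (x + h) * f (x - h) ≤ f x ^ 2) ∧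
        (∀ x h, f x ^ 2 ≤ f (x + h) * f (x - h) * Real.exp (Λ * ‖h‖ ^ 2)) ∧ f 0 = 1} := by
    ext f
    exact ⟨fun h => ⟨h.1.even, h.1.nonneg, h.1.mul_le_sq, h.1.sq_le_mul, h.2⟩,
      fun h => ⟨⟨h.1, h.2.2.2.2 ▸ one_pos, h.2.1, h.2.2.1, h.2.2.2.1⟩, h.2.2.2.2⟩⟩
  change IsClosed {f : V → ℝ | TamedLogConcave Λ f ∧ f 0 = 1}
  rw [this]
  simp only [ofPred_and, ofPred_forall]
  refine IsClosed.inter (isClosed_iInter fun x => isClosed_eq (by fun_prop) (by fun_prop)) <|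
    IsClosed.inter (isClosed_iInter fun x => isClosed_le (by fun_prop) (by fun_prop)) <|
    IsClosed.inter (isClosed_iInter fun x => isClosed_iInter fun h =>
      isClosed_le (by fun_prop) (by fun_prop)) <|
    IsClosed.inter (isClosed_iInter fun x => isClosed_iInter fun h =>
      isClosed_le (by fun_prop) (by fun_prop)) <| isClosed_eq (by fun_prop) (by fun_prop)

instance : Nonempty (NormalizedTamed V Λ) :=
  ⟨⟨fun _ => 1, ⟨fun _ => rfl, one_pos, fun _ => zero_le_one, fun _ _ => by simp, fun x h => by
    have : 0 ≤ (Λ : ℝ) * ‖h‖ ^ 2 := by positivity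
    simpa using this⟩, rfl⟩⟩

lemma continuous_coe [NormedSpace ℝ V] (f : NormalizedTamed V Λ) : Continuous f.1 :=
  f.2.1.continuous Λ.2

instance [NormedSpace ℝ V] [TopologicalSpace.SeparableSpace V] :
    FirstCountableTopology (NormalizedTamed V Λ) := by
  let r : NormalizedTamed V Λ → ℕ → ℝ := fun f k => f.1 (TopologicalSpace.denseSeq V k)
  have hr : Continuous r :=
    continuous_pi fun k => (continuous_apply _).comp continuous_subtype_val
  refine (hr.isClosedEmbedding fun f g hfg => ?_).isInducing.firstCountableTopology
  refine Subtype.ext (Continuous.ext_on (TopologicalSpace.denseRange_denseSeq V)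
    f.continuous_coe g.continuous_coe ?_)
  rintro _ ⟨k, rfl⟩
  exact congrFun hfg k

end Compactness

variable {V : Type*} [NormedAddCommGroup V] [InnerProductSpace ℝ V] [FiniteDimensional ℝ V]
  [MeasurableSpace V] [BorelSpace V] {Λ : ℝ≥0}

lemma continuous_integral_mul {𝕜 : Type*} [RCLike 𝕜] {μ : Measure V} [IsFiniteMeasure μ]
    {e : V → 𝕜} (he : Continuous e) {C : ℝ} (hC : ∀ x, ‖e x‖ ≤ C) :
    Continuous fun f : NormalizedTamed V Λ => ∫ x, (f.1 x : 𝕜) * e x ∂μ := by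
  refine continuous_of_dominated (bound := fun _ => C) (fun f => ?_)
    (fun f => ae_of_all _ fun x => ?_) (integrable_const _) (ae_of_all _ fun x => ?_)
  · have := f.continuous_coe
    exact ((RCLike.continuous_ofReal.comp this).mul he).aestronglyMeasurable
  · rw [norm_mul, RCLike.norm_ofReal, abs_of_nonneg (f.2.1.nonneg x)]
    exact (mul_le_of_le_one_left (norm_nonneg _) (f.le_one x)).trans (hC x)
  · exact (RCLike.continuous_ofReal.comp ((continuous_apply x).comp continuous_subtype_val)).mul
      continuous_const

lemma continuous_integral {μ : Measure V} [IsFiniteMeasure μ] :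
    Continuous fun f : NormalizedTamed V Λ => ∫ x, f.1 x ∂μ := by
  simpa using continuous_integral_mul (𝕜 := ℝ) (μ := μ) (Λ := Λ) (e := fun _ => 1) (C := 1)
    continuous_const (by simp)

lemma continuous_integral_mul_mul {μ : Measure V} [IsFiniteMeasure μ] :
    Continuous fun p : NormalizedTamed V Λ × NormalizedTamed V Λ => ∫ x, p.1.1 x * p.2.1 x ∂μ := by
  refine continuous_of_dominated (bound := fun _ => 1) (fun p => ?_)
    (fun p => ae_of_all _ fun x => ?_) (integrable_const _) (ae_of_all _ fun x => ?_)
  · exact (p.1.continuous_coe.mul p.2.continuous_coe).aestronglyMeasurable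
  · rw [Real.norm_of_nonneg (mul_nonneg (p.1.2.1.nonneg x) (p.2.2.1.nonneg x))]
    exact mul_le_one₀ (p.1.le_one x) (p.2.2.1.nonneg x) (p.2.le_one x)
  · have h : Continuous fun f : NormalizedTamed V Λ => f.1 x :=
      (continuous_apply x).comp continuous_subtype_val
    exact (h.comp continuous_fst).mul (h.comp continuous_snd)

end NormalizedTamed

namespace TamedLogConcave

lemma mul {V : Type*} [NormedAddCommGroup V] {Λ : ℝ} {f g : V → ℝ} (hf : TamedLogConcave Λ f)
    (hg : TamedLogConcave Λ g) :
    TamedLogConcave (2 * Λ) (fun x => f x * g x) where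
  even x := by rw [hf.even, hg.even]
  zero_pos := mul_pos hf.zero_pos hg.zero_pos
  nonneg x := mul_nonneg (hf.nonneg x) (hg.nonneg x)
  mul_le_sq x h := by
    have := mul_le_mul (hf.mul_le_sq x h) (hg.mul_le_sq x h)
      (mul_nonneg (hg.nonneg _) (hg.nonneg _)) (sq_nonneg _)
    linarith
  sq_le_mul x h := by
    have := mul_le_mul (hf.sq_le_mul x h) (hg.sq_le_mul x h) (sq_nonneg _)
      ((sq_nonneg _).trans (hf.sq_le_mul x h))
    rw [show 2 * Λ * ‖h‖ ^ 2 = Λ * ‖h‖ ^ 2 + Λ * ‖h‖ ^ 2 by ring, Real.exp_add]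
    linarith

variable {V : Type*} [NormedAddCommGroup V] [InnerProductSpace ℝ V] [FiniteDimensional ℝ V]
  [MeasurableSpace V] [BorelSpace V] {Λ : ℝ≥0} {f g : V → ℝ}

lemma integrable_mul (hf : TamedLogConcave Λ f) (hg : TamedLogConcave Λ g) :
    Integrable (fun x => f x * g x) (stdGaussian V) :=
  (hf.mul hg).integrable (by positivity)

lemma integral_integral_rotProd (hf : TamedLogConcave Λ f) :
    ∫ y, ∫ x, rotProd f x y ∂(stdGaussian V) ∂(stdGaussian V)
      = (∫ x, f x ∂(stdGaussian V)) ^ 2 := by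
  rw [sq]
  exact integral_integral_mul_rot (hf.integrable Λ.2) (hf.integrable Λ.2)

lemma integral_integral_rotProd_mul (hf : TamedLogConcave Λ f) (hg : TamedLogConcave Λ g) :
    ∫ y, ∫ x, rotProd f x y * rotProd g x y ∂(stdGaussian V) ∂(stdGaussian V)
      = (∫ x, f x * g x ∂(stdGaussian V)) ^ 2 := by
  rw [sq, ← integral_integral_mul_rot (hf.integrable_mul hg) (hf.integrable_mul hg)]
  refine integral_congr_ae (ae_of_all _ fun y => integral_congr_ae (ae_of_all _ fun x => ?_))
  simp only [rotProd]
  ring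

/-- If the correlation of tamed log-concave functions is bounded below by `m`, then the square of
the correlation is at least `m` times the correlation of the doubled functions. -/
lemma le_sq_integral_mul {m : ℝ}
    (hm : ∀ f g : V → ℝ, TamedLogConcave Λ f → TamedLogConcave Λ g →
      m * ((∫ x, f x ∂(stdGaussian V)) * ∫ x, g x ∂(stdGaussian V))
        ≤ ∫ x, f x * g x ∂(stdGaussian V))
    (hf : TamedLogConcave Λ f) (hg : TamedLogConcave Λ g) :
    m * ∫ y, (∫ x, rotProd f x y ∂(stdGaussian V)) * (∫ x, rotProd g x y ∂(stdGaussian V))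
        ∂(stdGaussian V) ≤ (∫ x, f x * g x ∂(stdGaussian V)) ^ 2 := by
  have hPL := PrekopaLeindler.stdGaussian V
  rw [← integral_integral_rotProd_mul hf hg, ← integral_const_mul]
  refine integral_mono (((hf.integral_rotProd hPL Λ.2).integrable_mul
    (hg.integral_rotProd hPL Λ.2)).const_mul m) ?_ fun y =>
      hm _ _ (hf.rotProd_left y) (hg.rotProd_left y)
  have h : Integrable (fun y => ∫ x, rotProd (fun u => f u * g u) x y ∂(stdGaussian V))
      (stdGaussian V) :=
    ((hf.mul hg).integral_rotProd hPL (by positivity)).integrable (by positivity)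
  refine h.congr (ae_of_all _ fun y => integral_congr_ae (ae_of_all _ fun x => ?_))
  simp only [rotProd]
  ring

end TamedLogConcave

namespace NormalizedTamed

variable {V : Type*} [NormedAddCommGroup V] [InnerProductSpace ℝ V] [FiniteDimensional ℝ V]
  [MeasurableSpace V] [BorelSpace V] {Λ : ℝ≥0}

lemma integral_pos (f : NormalizedTamed V Λ) : 0 < ∫ x, f.1 x ∂(stdGaussian V) :=
  f.2.1.integral_pos Λ.2

/-- The correlation ratio of two functions under the standard Gaussian measure. -/
def ratio (p : NormalizedTamed V Λ × NormalizedTamed V Λ) : ℝ :=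
  (∫ x, p.1.1 x * p.2.1 x ∂(stdGaussian V)) /
    ((∫ x, p.1.1 x ∂(stdGaussian V)) * ∫ x, p.2.1 x ∂(stdGaussian V))

lemma continuous_ratio : Continuous (ratio (V := V) (Λ := Λ)) :=
  continuous_integral_mul_mul.div₀ ((continuous_integral.comp continuous_fst).mul
    (continuous_integral.comp continuous_snd)) fun p =>
      (mul_pos p.1.integral_pos p.2.integral_pos).ne'

lemma ratio_pos (p : NormalizedTamed V Λ × NormalizedTamed V Λ) : 0 < ratio p :=
  div_pos ((p.1.2.1.mul p.2.2.1).integral_pos (by positivity))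
    (mul_pos p.1.integral_pos p.2.integral_pos)

lemma mul_le_integral_mul {m : ℝ}
    (hm : ∀ p : NormalizedTamed V Λ × NormalizedTamed V Λ, m ≤ ratio p)
    {f g : V → ℝ} (hf : TamedLogConcave Λ f) (hg : TamedLogConcave Λ g) :
    m * ((∫ x, f x ∂(stdGaussian V)) * ∫ x, g x ∂(stdGaussian V))
      ≤ ∫ x, f x * g x ∂(stdGaussian V) := by
  have h := hm (normalize hf, normalize hg)
  rw [ratio, le_div_iff₀ (mul_pos (integral_pos _) (integral_pos _))] at h
  simp only [normalize, integral_const_mul, mul_mul_mul_comm _ _ (g 0)⁻¹] at h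
  have h0 : 0 < (f 0)⁻¹ * (g 0)⁻¹ := mul_pos (inv_pos.2 hf.zero_pos) (inv_pos.2 hg.zero_pos)
  refine le_of_mul_le_mul_left ?_ h0
  linarith

/-- The normalized doubling operator. -/
def double (f : NormalizedTamed V Λ) : NormalizedTamed V Λ :=
  normalize (f.2.1.integral_rotProd (PrekopaLeindler.stdGaussian V) Λ.2)

lemma ratio_double_le {p : NormalizedTamed V Λ × NormalizedTamed V Λ}
    (hp : ∀ q : NormalizedTamed V Λ × NormalizedTamed V Λ, ratio p ≤ ratio q) :
    ratio (Prod.map double double p) ≤ ratio p := by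
  obtain ⟨f, g⟩ := p
  have hPL := PrekopaLeindler.stdGaussian V
  have hf0 := (f.2.1.integral_rotProd hPL Λ.2).zero_pos
  have hg0 := (g.2.1.integral_rotProd hPL Λ.2).zero_pos
  have key := TamedLogConcave.le_sq_integral_mul (fun f g hf hg => mul_le_integral_mul hp hf hg)
    f.2.1 g.2.1
  have hpos := ratio_pos (f, g)
  set m := ratio (f, g) with hm
  have hfg : ∫ x, f.1 x * g.1 x ∂(stdGaussian V) =
      m * ((∫ x, f.1 x ∂(stdGaussian V)) * ∫ x, g.1 x ∂(stdGaussian V)) := by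
    rw [hm, ratio, div_mul_cancel₀ _ (mul_pos f.integral_pos g.integral_pos).ne']
  have hZf := f.integral_pos
  have hZg := g.integral_pos
  rw [Prod.map_apply, ratio, div_le_iff₀ (mul_pos (integral_pos _) (integral_pos _))]
  simp only [double, normalize, integral_const_mul,
    mul_mul_mul_comm _ _ (∫ x : V, rotProd g.1 x 0 ∂(stdGaussian V))⁻¹,
    f.2.1.integral_integral_rotProd, g.2.1.integral_integral_rotProd]
  rw [hfg, mul_pow, sq m, mul_assoc] at key
  have := le_of_mul_le_mul_left key hpos
  rw [mul_left_comm m, ← mul_pow]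
  exact mul_le_mul_of_nonneg_left this (by positivity)

end NormalizedTamed

section CentralLimit

variable {V : Type*} [NormedAddCommGroup V] [InnerProductSpace ℝ V]
  [MeasurableSpace V] [BorelSpace V]

lemma tendsto_charFun_inv_sqrt_smul_pow {η : Measure V} [IsProbabilityMeasure η] (t : V)
    (h0 : ∫ x, inner ℝ x t ∂η = 0) (h2 : Integrable (fun x => inner ℝ x t ^ 2) η) :
    Tendsto (fun n : ℕ => charFun η ((√n)⁻¹ • t) ^ n) atTop
      (𝓝 (Complex.exp (-(∫ x, inner ℝ x t ^ 2 ∂η : ℝ) / 2))) := by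
  set s := ∫ x, inner ℝ x t ^ 2 ∂η with hs
  have hs0 : 0 ≤ s := integral_nonneg fun x => sq_nonneg _
  have hmeas : Measurable fun x => inner ℝ x t :=
    (show Continuous fun x => inner ℝ x t by fun_prop).measurable
  rcases hs0.eq_or_lt with hs0 | hs0
  · have h : (fun x => inner ℝ x t ^ 2) =ᵐ[η] 0 :=
      (integral_eq_zero_iff_of_nonneg (fun x => sq_nonneg _) h2).1 hs0.symm
    have hc (r : ℝ) : charFun η (r • t) = 1 := by
      rw [charFun_apply]
      trans ∫ _, (1 : ℂ) ∂η
      · refine integral_congr_ae (h.mono fun x hx => ?_)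
        have : inner ℝ x t = 0 := by simpa using hx
        simp [inner_smul_right, this]
      · simp
    simp [hc, ← hs0]
  · have hsq : √s ^ 2 = s := Real.sq_sqrt hs0.le
    have key := tendsto_charFun_inv_sqrt_mul_pow (P := η) (X := fun x => (√s)⁻¹ * inner ℝ x t)
      (by fun_prop) (by simp [integral_const_mul, h0])
      (by simp [mul_pow, integral_const_mul, ← hs, hsq, hs0.ne']) (√s)
    have hlim : Complex.exp (-(√s : ℂ) ^ 2 / 2) = Complex.exp (-(s : ℂ) / 2) := by
      rw [← Complex.ofReal_pow, hsq]
    rw [hlim] at key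
    refine key.congr fun n => ?_
    congr 1
    rw [charFun_apply_real, integral_map (by fun_prop) (by fun_prop), charFun_apply]
    refine integral_congr_ae (ae_of_all _ fun x => ?_)
    have : √s ≠ 0 := (Real.sqrt_pos.2 hs0).ne'
    simp only [inner_smul_right]
    congr 2
    rw [← Complex.ofReal_mul]
    congr 1
    field_simp

end CentralLimit

namespace NormalizedTamed

variable {V : Type*} [NormedAddCommGroup V] [InnerProductSpace ℝ V] [FiniteDimensional ℝ V]
  [MeasurableSpace V] [BorelSpace V] {Λ : ℝ≥0}

/-- The probability measure with density proportional to `f` with respect to the standard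
Gaussian measure. -/
def tilt (f : NormalizedTamed V Λ) : Measure V :=
  (stdGaussian V).withDensity fun x => ((f.1 x / ∫ x, f.1 x ∂(stdGaussian V)).toNNReal : ℝ≥0)

lemma measurable_density (f : NormalizedTamed V Λ) :
    Measurable fun x => (f.1 x / ∫ x, f.1 x ∂(stdGaussian V)).toNNReal := by
  have := f.continuous_coe.measurable
  fun_prop

lemma integral_tilt (f : NormalizedTamed V Λ) {G : Type*} [NormedAddCommGroup G] [NormedSpace ℝ G]
    (g : V → G) : ∫ x, g x ∂f.tilt =
      (∫ x, f.1 x ∂(stdGaussian V))⁻¹ • ∫ x, f.1 x • g x ∂(stdGaussian V) := by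
  rw [tilt, integral_withDensity_eq_integral_smul f.measurable_density, ← integral_smul]
  refine integral_congr_ae (ae_of_all _ fun x => ?_)
  simp only [NNReal.smul_def]
  rw [Real.coe_toNNReal _ (div_nonneg (f.2.1.nonneg x) f.integral_pos.le), smul_smul,
    div_eq_inv_mul]

lemma tilt_le (f : NormalizedTamed V Λ) :
    f.tilt ≤ ((∫ x, f.1 x ∂(stdGaussian V))⁻¹.toNNReal : ℝ≥0∞) • stdGaussian V := by
  rw [tilt, ← withDensity_const]
  refine withDensity_mono (ae_of_all _ fun x => ENNReal.coe_le_coe.2 (Real.toNNReal_le_toNNReal ?_))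
  rw [div_eq_mul_inv]
  exact mul_le_of_le_one_left (inv_pos.2 f.integral_pos).le (f.le_one x)

lemma integrable_tilt (f : NormalizedTamed V Λ) {G : Type*} [NormedAddCommGroup G] {g : V → G}
    (hg : Integrable g (stdGaussian V)) : Integrable g f.tilt :=
  (hg.smul_measure ENNReal.coe_ne_top).mono_measure f.tilt_le

lemma integral_tilt_le (f : NormalizedTamed V Λ) {g : V → ℝ} (hg : Integrable g (stdGaussian V))
    (hg0 : ∀ x, 0 ≤ g x) :
    ∫ x, g x ∂f.tilt ≤ (∫ x, f.1 x ∂(stdGaussian V))⁻¹ * ∫ x, g x ∂(stdGaussian V) := by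
  refine (integral_mono_measure f.tilt_le (ae_of_all _ hg0)
    (hg.smul_measure ENNReal.coe_ne_top)).trans_eq ?_
  rw [integral_smul_measure, ENNReal.coe_toReal, Real.coe_toNNReal _ (inv_pos.2 f.integral_pos).le,
    smul_eq_mul]

instance (f : NormalizedTamed V Λ) : IsProbabilityMeasure f.tilt := by
  have : IsFiniteMeasure f.tilt := by
    refine ⟨(f.tilt_le univ).trans_lt ?_⟩
    simp
  have h := f.integral_tilt fun _ => (1 : ℝ)
  simp only [integral_const, smul_eq_mul, mul_one, inv_mul_cancel₀ f.integral_pos.ne'] at h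
  refine ⟨?_⟩
  rwa [measureReal_def, ENNReal.toReal_eq_one_iff] at h

lemma prekopaLeindler_tilt (f : NormalizedTamed V Λ) : PrekopaLeindler f.tilt := by
  refine (PrekopaLeindler.stdGaussian V).withDensity f.measurable_density
    ⟨(∫ x, f.1 x ∂(stdGaussian V))⁻¹.toNNReal, ?_⟩ fun x h => ?_
  · rintro _ ⟨x, rfl⟩
    refine Real.toNNReal_le_toNNReal ?_
    rw [div_eq_mul_inv]
    exact mul_le_of_le_one_left (inv_pos.2 f.integral_pos).le (f.le_one x)
  · have h0 (x : V) : 0 ≤ f.1 x / ∫ x, f.1 x ∂(stdGaussian V) :=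
      div_nonneg (f.2.1.nonneg x) f.integral_pos.le
    rw [← Real.toNNReal_mul (h0 _), ← Real.toNNReal_pow (h0 _), div_mul_div_comm, div_pow, ← sq]
    refine Real.toNNReal_le_toNNReal ?_
    gcongr
    exact f.2.1.mul_le_sq x h

instance : (stdGaussian V).IsNegInvariant := by
  refine ⟨?_⟩
  exact stdGaussian_map (LinearIsometryEquiv.neg ℝ)

lemma integral_neg_tilt (f : NormalizedTamed V Λ) {G : Type*} [NormedAddCommGroup G]
    [NormedSpace ℝ G] (g : V → G) : ∫ x, g (-x) ∂f.tilt = ∫ x, g x ∂f.tilt := by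
  rw [integral_tilt, integral_tilt, ← integral_neg_eq_self fun x => f.1 x • g x]
  simp only [f.2.1.even]

/-- A translate of a symmetric log-concave function has smaller integral with respect to a
symmetric log-concave tilt of the Gaussian measure. -/
lemma integral_add_right_tilt_le (f g : NormalizedTamed V Λ) (z : V) :
    ∫ x, g.1 (x + z) ∂f.tilt ≤ ∫ x, g.1 x ∂f.tilt := by
  have hg := g.continuous_coe.measurable
  have h := f.prekopaLeindler_tilt.integral_mul_integral_le (F := fun x => g.1 (x + z))
    (G := fun x => g.1 (x - z)) (H := g.1) (C := 1) (by fun_prop) (by fun_prop) hg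
    (fun _ => g.2.1.nonneg _) (fun _ => g.2.1.nonneg _) (fun _ => g.2.1.nonneg _)
    (fun _ => g.le_one _) (fun _ => g.le_one _) (fun _ => g.le_one _) fun x h => by
      have := g.2.1.mul_le_sq x (h + z)
      rwa [← add_assoc, sub_add_eq_sub_sub] at this
  have h2 : ∫ x, g.1 (x - z) ∂f.tilt = ∫ x, g.1 (x + z) ∂f.tilt := by
    rw [← f.integral_neg_tilt]
    refine integral_congr_ae (ae_of_all _ fun x => ?_)
    simp only
    rw [← g.2.1.even, neg_sub, sub_neg_eq_add, add_comm]
  rw [h2, ← sq] at h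
  exact (pow_le_pow_iff_left₀ (integral_nonneg fun _ => g.2.1.nonneg _)
    (integral_nonneg fun _ => g.2.1.nonneg _) two_ne_zero).1 h

lemma charFun_tilt (f : NormalizedTamed V Λ) (t : V) :
    charFun f.tilt t = (∫ x, f.1 x ∂(stdGaussian V) : ℝ)⁻¹ *
      ∫ x, (f.1 x : ℂ) * Complex.exp (inner ℝ x t * Complex.I) ∂(stdGaussian V) := by
  rw [charFun_apply, integral_tilt, Complex.real_smul, Complex.ofReal_inv]
  simp only [Complex.real_smul]

lemma charFun_tilt_neg (f : NormalizedTamed V Λ) (t : V) :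
    charFun f.tilt (-t) = charFun f.tilt t := by
  rw [charFun_apply, ← f.integral_neg_tilt, charFun_apply]
  simp

lemma charFun_tilt_double (f : NormalizedTamed V Λ) (t : V) :
    charFun f.double.tilt t = charFun f.tilt ((√2 / 2 : ℝ) • t) ^ 2 := by
  set c := √2 / 2 with hc
  have hc2 : c ^ 2 = 1 / 2 := by rw [hc, div_pow, Real.sq_sqrt (by norm_num)]; norm_num
  have hint (s : V) : Integrable (fun x => (f.1 x : ℂ) * Complex.exp (inner ℝ x s * Complex.I))
      (stdGaussian V) := by
    refine .of_bound (C := 1) ?_ (ae_of_all _ fun x => ?_)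
    · have := f.continuous_coe
      exact Continuous.aestronglyMeasurable (by fun_prop)
    · rw [norm_mul, Complex.norm_exp_ofReal_mul_I, mul_one, Complex.norm_real,
        Real.norm_of_nonneg (f.2.1.nonneg x)]
      exact f.le_one x
  have key := integral_integral_mul_rot (hint (-(c • t))) (hint (c • t))
  have hy : ∫ y, ((∫ x, rotProd f.1 x y ∂(stdGaussian V) : ℝ) : ℂ) *
      Complex.exp (inner ℝ y t * Complex.I) ∂(stdGaussian V) =
      (∫ x, (f.1 x : ℂ) * Complex.exp (inner ℝ x (-(c • t)) * Complex.I) ∂(stdGaussian V)) *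
      ∫ x, (f.1 x : ℂ) * Complex.exp (inner ℝ x (c • t) * Complex.I) ∂(stdGaussian V) := by
    rw [← key]
    refine integral_congr_ae (ae_of_all _ fun y => ?_)
    simp only
    rw [← integral_complex_ofReal, ← integral_mul_const]
    refine integral_congr_ae (ae_of_all _ fun x => ?_)
    simp only [rotProd, ← hc]
    rw [mul_mul_mul_comm, ← Complex.exp_add, Complex.ofReal_mul]
    congr 2
    rw [← add_mul, ← Complex.ofReal_add]
    congr 2
    simp only [inner_neg_right, inner_smul_right, inner_add_left, inner_sub_left, inner_smul_left,
      RCLike.conj_to_real]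
    linear_combination (-2 * inner ℝ y t) * hc2
  have hP0 := (f.2.1.integral_rotProd (PrekopaLeindler.stdGaussian V) Λ.2).zero_pos
  have hZ := f.integral_pos
  have hsq : charFun f.tilt (c • t) ^ 2 = charFun f.tilt (-(c • t)) * charFun f.tilt (c • t) := by
    rw [charFun_tilt_neg, sq]
  rw [hsq]
  simp only [charFun_tilt, double, normalize, integral_const_mul, f.2.1.integral_integral_rotProd,
    Complex.ofReal_mul, mul_assoc]
  rw [hy]
  set Z := ∫ x, f.1 x ∂(stdGaussian V)
  set P := ∫ x, rotProd f.1 x 0 ∂(stdGaussian V)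
  have h1 : (P : ℂ) ≠ 0 := by exact_mod_cast hP0.ne'
  have h2 : (Z : ℂ) ≠ 0 := by exact_mod_cast hZ.ne'
  simp only [Complex.ofReal_inv, Complex.ofReal_mul, Complex.ofReal_pow]
  generalize ∫ x, (f.1 x : ℂ) * Complex.exp (inner ℝ x (-(c • t)) * Complex.I) ∂(stdGaussian V) = A
  generalize ∫ x, (f.1 x : ℂ) * Complex.exp (inner ℝ x (c • t) * Complex.I) ∂(stdGaussian V) = B
  field_simp

lemma charFun_tilt_double_iterate (f : NormalizedTamed V Λ) (k : ℕ) (t : V) :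
    charFun (double^[k] f).tilt t = charFun f.tilt ((√(2 ^ k : ℕ))⁻¹ • t) ^ (2 ^ k) := by
  induction k generalizing t with
  | zero => simp
  | succ k ih =>
    rw [Function.iterate_succ_apply', charFun_tilt_double, ih, ← pow_mul, ← pow_succ, smul_smul]
    congr 3
    push_cast
    rw [pow_succ, Real.sqrt_mul (by positivity), mul_inv]
    congr 1
    rw [div_eq_iff two_ne_zero, inv_mul_eq_div, eq_div_iff (by positivity)]
    exact Real.mul_self_sqrt (by norm_num)

lemma continuous_charFun_tilt (t : V) :
    Continuous fun f : NormalizedTamed V Λ => charFun f.tilt t := by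
  simp only [charFun_tilt]
  refine Continuous.mul ?_ (continuous_integral_mul (𝕜 := ℂ) (C := 1) (by fun_prop) fun x => ?_)
  · exact Complex.continuous_ofReal.comp (continuous_integral.inv₀ fun f => f.integral_pos.ne')
  · rw [Complex.norm_exp_ofReal_mul_I]

lemma integrable_inner_sq (t : V) :
    Integrable (fun x => inner ℝ x t ^ 2) (stdGaussian V) := by
  have := (IsGaussian.memLp_dual (stdGaussian V) (innerSL ℝ t) 2 (by simp)).integrable_sq
  simpa [real_inner_comm] using this

lemma charFun_tilt_of_tendsto {f g : NormalizedTamed V Λ} {φ : ℕ → ℕ} (hφ : StrictMono φ)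
    (h : Tendsto (fun k => double^[φ k] f) atTop (𝓝 g)) (t : V) :
    charFun g.tilt t = Complex.exp (-(∫ x, inner ℝ x t ^ 2 ∂f.tilt : ℝ) / 2) := by
  have h1 := ((continuous_charFun_tilt t).tendsto g).comp h
  have hmean : ∫ x, inner ℝ x t ∂f.tilt = 0 := by
    have := f.integral_neg_tilt fun x => inner ℝ x t
    simp only [inner_neg_left, integral_neg] at this
    linarith
  have h2 := tendsto_charFun_inv_sqrt_smul_pow t hmean (f.integrable_tilt (integrable_inner_sq t))
  refine tendsto_nhds_unique h1 ((h2.comp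
    ((tendsto_pow_atTop_atTop_of_one_lt one_lt_two).comp hφ.tendsto_atTop)).congr fun k => ?_)
  simp only [Function.comp_apply]
  rw [charFun_tilt_double_iterate]

end NormalizedTamed

section SecondMoment

open scoped Matrix

lemma map_inner_eq_gaussianReal {V : Type*} [NormedAddCommGroup V] [InnerProductSpace ℝ V]
    [MeasurableSpace V] [BorelSpace V] {η : Measure V} [IsFiniteMeasure η] {s : ℝ} (hs : 0 ≤ s)
    {t : V} (h : ∀ u : ℝ, charFun η (u • t) = Complex.exp (-(u ^ 2 * s : ℝ) / 2)) :
    η.map (fun x => inner ℝ x t) = gaussianReal 0 s.toNNReal := by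
  have hm : Measurable fun x => inner ℝ x t :=
    (show Continuous fun x => inner ℝ x t by fun_prop).measurable
  refine Measure.ext_of_charFun (funext fun u => ?_)
  rw [charFun_apply_real, integral_map (by fun_prop) (by fun_prop), charFun_gaussianReal,
    Real.coe_toNNReal _ hs]
  trans charFun η (u • t)
  · simp only [charFun_apply, inner_smul_right, Complex.ofReal_mul]
  · rw [h]
    congr 1
    push_cast
    ring

/-- The matrix of second moments of a measure. -/
def secondMoment {ι : Type*} (η : Measure (EuclideanSpace ℝ ι)) : Matrix ι ι ℝ :=
  .of fun i j => ∫ x, x i * x j ∂η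

lemma isHermitian_secondMoment {ι : Type*} {η : Measure (EuclideanSpace ℝ ι)} :
    (secondMoment η).IsHermitian := by
  ext i j
  simp [secondMoment, mul_comm]

variable {ι : Type*} [Fintype ι] {η : Measure (EuclideanSpace ℝ ι)}

lemma dotProduct_secondMoment_mulVec (h : ∀ t, Integrable (fun x => inner ℝ x t ^ 2) η)
    (t : EuclideanSpace ℝ ι) :
    t ⬝ᵥ secondMoment η *ᵥ t = ∫ x, inner ℝ x t ^ 2 ∂η := by
  classical
  have hL (i : ι) : MemLp (fun x : EuclideanSpace ℝ ι => x i) 2 η := by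
    refine (memLp_two_iff_integrable_sq (by fun_prop)).2 ?_
    simpa [EuclideanSpace.inner_single_right] using h (EuclideanSpace.single i 1)
  have hint (i j : ι) : Integrable (fun x : EuclideanSpace ℝ ι => x i * x j) η :=
    (hL i).integrable_mul (hL j)
  have hexp (x : EuclideanSpace ℝ ι) :
      inner ℝ x t ^ 2 = ∑ i, ∑ j, t i * (x i * x j * t j) := by
    rw [sq, PiLp.inner_apply, Finset.sum_mul_sum]
    refine Finset.sum_congr rfl fun i _ => Finset.sum_congr rfl fun j _ => ?_
    simp only [RCLike.inner_apply, conj_trivial]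
    ring
  simp only [hexp]
  rw [integral_finsetSum _ fun i _ => integrable_finsetSum _ fun j _ =>
    ((hint i j).mul_const _).const_mul _]
  refine Finset.sum_congr rfl fun i _ => ?_
  rw [integral_finsetSum _ fun j _ => ((hint i j).mul_const _).const_mul _]
  simp only [Matrix.mulVec, dotProduct, Finset.mul_sum, secondMoment, Matrix.of_apply,
    integral_const_mul, integral_mul_const]

lemma posSemidef_secondMoment (h : ∀ t, Integrable (fun x => inner ℝ x t ^ 2) η) :
    (secondMoment η).PosSemidef := by
  refine .of_dotProduct_mulVec_nonneg isHermitian_secondMoment fun t => ?_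
  have := dotProduct_secondMoment_mulVec h (WithLp.toLp 2 t)
  simp only [star_trivial]
  rw [show t ⬝ᵥ secondMoment η *ᵥ t = _ from this]
  exact integral_nonneg fun x => sq_nonneg _

end SecondMoment

namespace NormalizedTamed

section

variable {V : Type*} [NormedAddCommGroup V] [InnerProductSpace ℝ V] [FiniteDimensional ℝ V]
  [MeasurableSpace V] [BorelSpace V] {Λ : ℝ≥0}

lemma integral_inner_sq_tilt_le {f g : NormalizedTamed V Λ} {t : V}
    (h : ∀ u : ℝ, charFun g.tilt (u • t) =
      Complex.exp (-(∫ x, inner ℝ x (u • t) ^ 2 ∂f.tilt : ℝ) / 2)) :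
    ∫ x, inner ℝ x t ^ 2 ∂f.tilt ≤ ‖t‖ ^ 2 := by
  set s := ∫ x, inner ℝ x t ^ 2 ∂f.tilt with hs
  have hs0 : 0 ≤ s := integral_nonneg fun x => sq_nonneg _
  have h1 := map_inner_eq_gaussianReal (η := g.tilt) hs0 (t := t) fun u => by
    rw [h]
    simp only [inner_smul_right, mul_pow, integral_const_mul, hs]
  have h2 := map_inner_eq_gaussianReal (η := stdGaussian V) (sq_nonneg ‖t‖) (t := t) fun u => by
    rw [charFun_stdGaussian, norm_smul, ← Complex.ofReal_pow, mul_pow, Real.norm_eq_abs, sq_abs]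
  by_contra! hlt
  have hZ := g.integral_pos
  set Z := ∫ x, g.1 x ∂(stdGaussian V)
  have hd : 0 < s - ‖t‖ ^ 2 := sub_pos.2 hlt
  obtain ⟨u, hu⟩ : ∃ u : ℝ, u ^ 2 = 2 * Z⁻¹ / (s - ‖t‖ ^ 2) :=
    ⟨_, Real.sq_sqrt (by positivity)⟩
  have hle : mgf (fun x => inner ℝ x t) g.tilt u
      ≤ Z⁻¹ * mgf (fun x => inner ℝ x t) (stdGaussian V) u := by
    refine g.integral_tilt_le ?_ fun x => (Real.exp_pos _).le
    have := integrable_exp_mul_gaussianReal (μ := 0) (v := (‖t‖ ^ 2).toNNReal) u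
    rw [← h2] at this
    exact this.comp_measurable (show Continuous fun x => inner ℝ x t by fun_prop).measurable
  rw [mgf_gaussianReal h1, mgf_gaussianReal h2, Real.coe_toNNReal _ hs0,
    Real.coe_toNNReal _ (sq_nonneg _), ← div_le_iff₀ (Real.exp_pos _), ← Real.exp_sub] at hle
  have he : 0 * u + s * u ^ 2 / 2 - (0 * u + ‖t‖ ^ 2 * u ^ 2 / 2) = Z⁻¹ := by
    rw [hu]
    field_simp
    ring
  rw [he] at hle
  linarith [Real.add_one_le_exp Z⁻¹]

lemma one_le_ratio_of_conv {f g : NormalizedTamed V Λ} {ν : Measure V} [IsProbabilityMeasure ν]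
    (h : ν ∗ f.tilt = stdGaussian V) : 1 ≤ ratio (f, g) := by
  have hg : Integrable g.1 (stdGaussian V) := g.2.1.integrable Λ.2
  have hle : ∫ x, g.1 x ∂(stdGaussian V) ≤ ∫ x, g.1 x ∂f.tilt := by
    rw [← h] at hg
    rw [← h, integral_conv hg]
    refine (integral_mono_of_nonneg (ae_of_all _ fun z => integral_nonneg fun x => g.2.1.nonneg _)
      (integrable_const (∫ x, g.1 x ∂f.tilt)) (ae_of_all _ fun z => ?_)).trans_eq (by simp)
    simp only [add_comm z]
    exact integral_add_right_tilt_le f g z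
  rw [integral_tilt, smul_eq_mul, inv_mul_eq_div, le_div_iff₀ f.integral_pos] at hle
  rw [ratio, one_le_div (mul_pos f.integral_pos g.integral_pos), mul_comm]
  simpa using hle

lemma ratio_iterate_double_le {p : NormalizedTamed V Λ × NormalizedTamed V Λ}
    (hp : ∀ q : NormalizedTamed V Λ × NormalizedTamed V Λ, ratio p ≤ ratio q) (k : ℕ) :
    ratio ((Prod.map double double)^[k] p) ≤ ratio p := by
  induction k with
  | zero => rfl
  | succ k ih =>
    rw [Function.iterate_succ_apply']
    exact (ratio_double_le fun q => ih.trans (hp q)).trans ih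

end

open scoped Matrix

variable {ι : Type*} [Fintype ι] {Λ : ℝ≥0}

lemma exists_conv_tilt_eq_stdGaussian {f g : NormalizedTamed (EuclideanSpace ℝ ι) Λ}
    (h : ∀ t, charFun g.tilt t = Complex.exp (-(∫ x, inner ℝ x t ^ 2 ∂f.tilt : ℝ) / 2)) :
    ∃ ν : Measure (EuclideanSpace ℝ ι), IsProbabilityMeasure ν ∧ ν ∗ g.tilt = stdGaussian _ := by
  classical
  have hint (t : EuclideanSpace ℝ ι) : Integrable (fun x => inner ℝ x t ^ 2) f.tilt :=
    f.integrable_tilt (integrable_inner_sq t)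
  have hquad (t : EuclideanSpace ℝ ι) :
      t ⬝ᵥ (1 - secondMoment f.tilt) *ᵥ t = ‖t‖ ^ 2 - ∫ x, inner ℝ x t ^ 2 ∂f.tilt := by
    rw [Matrix.sub_mulVec, dotProduct_sub, dotProduct_secondMoment_mulVec hint, Matrix.one_mulVec,
      EuclideanSpace.real_norm_sq_eq]
    simp [dotProduct, sq]
  have hS : (1 - secondMoment f.tilt).PosSemidef := by
    refine .of_dotProduct_mulVec_nonneg (Matrix.isHermitian_one.sub isHermitian_secondMoment)
      fun t => ?_
    have := hquad (WithLp.toLp 2 t)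
    simp only [star_trivial]
    rw [show t ⬝ᵥ (1 - secondMoment f.tilt) *ᵥ t = _ from this]
    exact sub_nonneg.2 (integral_inner_sq_tilt_le fun u => h _)
  refine ⟨multivariateGaussian 0 (1 - secondMoment f.tilt), inferInstance,
    Measure.ext_of_charFun (funext fun t => ?_)⟩
  rw [charFun_conv, charFun_multivariateGaussian hS, h, charFun_stdGaussian, ← Complex.exp_add,
    hquad]
  congr 1
  push_cast
  simp
  ring

theorem one_le_ratio (p : NormalizedTamed (EuclideanSpace ℝ ι) Λ ×
    NormalizedTamed (EuclideanSpace ℝ ι) Λ) : 1 ≤ ratio p := by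
  obtain ⟨q, -, hq⟩ := isCompact_univ.exists_isMinOn
    (univ_nonempty (α := NormalizedTamed (EuclideanSpace ℝ ι) Λ ×
      NormalizedTamed (EuclideanSpace ℝ ι) Λ)) continuous_ratio.continuousOn
  have hq' (r) : ratio q ≤ ratio r := hq (mem_univ r)
  refine le_trans ?_ (hq' p)
  obtain ⟨⟨f, g⟩, φ, hφ, hlim⟩ :=
    CompactSpace.tendsto_subseq fun k => (Prod.map double double)^[k] q
  have hle : ratio (f, g) ≤ ratio q :=
    le_of_tendsto ((continuous_ratio.tendsto _).comp hlim)
      (Eventually.of_forall fun k => ratio_iterate_double_le hq' _)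
  refine le_trans ?_ hle
  obtain ⟨ν, _, hν⟩ := exists_conv_tilt_eq_stdGaussian (f := q.1) (g := f) <|
    charFun_tilt_of_tendsto hφ <| by
      simpa [Function.comp_def, Prod.map_iterate] using
        (continuous_fst.tendsto _).comp hlim
  exact one_le_ratio_of_conv hν

end NormalizedTamed

theorem TamedLogConcave.integral_mul_integral_le {ι : Type*} [Fintype ι] {Λ : ℝ}
    (hΛ : 0 ≤ Λ) {f g : EuclideanSpace ℝ ι → ℝ} (hf : TamedLogConcave Λ f)
    (hg : TamedLogConcave Λ g) :
    (∫ x, f x ∂(stdGaussian _)) * (∫ x, g x ∂(stdGaussian _))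
      ≤ ∫ x, f x * g x ∂(stdGaussian _) := by
  lift Λ to ℝ≥0 using hΛ
  simpa using NormalizedTamed.mul_le_integral_mul NormalizedTamed.one_le_ratio hf hg

lemma tendsto_integral_measureReal {V : Type*} [NormedAddCommGroup V]
    [MeasurableSpace V] [BorelSpace V] {μ : Measure V} [IsFiniteMeasure μ] {F : ℕ → V → ℝ}
    {S : Set V} (hS : MeasurableSet S) (hF : ∀ k, Continuous (F k)) (h0 : ∀ k x, 0 ≤ F k x)
    (h1 : ∀ k x, F k x ≤ 1) (hlim : ∀ x, Tendsto (F · x) atTop (𝓝 (S.indicator 1 x))) :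
    Tendsto (fun k => ∫ x, F k x ∂μ) atTop (𝓝 (μ.real S)) := by
  rw [← integral_indicator_one hS]
  refine tendsto_integral_of_dominated_convergence (fun _ => (1 : ℝ))
    (fun k => (hF k).stronglyMeasurable.aestronglyMeasurable) (integrable_const _)
    (fun k => ae_of_all _ fun x => ?_) (ae_of_all _ hlim)
  rw [Real.norm_of_nonneg (h0 k x)]
  exact h1 k x

section InfDist

open Metric

variable {V : Type*} [NormedAddCommGroup V] {K : Set V}

lemma infDist_neg_eq_of_symmetric (hK : ∀ x ∈ K, -x ∈ K) (x : V) :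
    infDist (-x) K = infDist x K := by
  have himg : (fun y : V => -y) '' K = K := by
    refine Subset.antisymm (image_subset_iff.2 hK) fun y hy => ⟨-y, hK y hy, neg_neg y⟩
  have := infDist_image (t := K) (x := x) (Φ := fun y : V => -y) (IsometryEquiv.neg V).isometry
  rwa [himg] at this

lemma two_mul_infDist_le [NormedSpace ℝ V] [ProperSpace V] (hc : Convex ℝ K) (hcl : IsClosed K)
    (hne : K.Nonempty) (x h : V) : 2 * infDist x K ≤ infDist (x + h) K + infDist (x - h) K := by
  obtain ⟨y, hy, hy'⟩ := hcl.exists_infDist_eq_dist hne (x + h)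
  obtain ⟨z, hz, hz'⟩ := hcl.exists_infDist_eq_dist hne (x - h)
  have hle := infDist_le_dist_of_mem (x := x) (hc.midpoint_mem hy hz)
  have hx : x = midpoint ℝ (x + h) (x - h) := by
    rw [midpoint_eq_smul_add, add_add_sub_cancel, ← two_smul ℝ x, smul_smul]
    simp
  have hmid : dist x (midpoint ℝ y z) ≤ (dist (x + h) y + dist (x - h) z) / 2 := by
    conv_lhs => rw [hx]
    exact dist_midpoint_midpoint_le _ _ _ _
  rw [hy', hz']
  linarith

lemma infDist_sq_add_infDist_sq_le {V : Type*} [NormedAddCommGroup V] [InnerProductSpace ℝ V]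
    [ProperSpace V] {K : Set V} (hcl : IsClosed K) (hne : K.Nonempty) (x h : V) :
    infDist (x + h) K ^ 2 + infDist (x - h) K ^ 2 ≤ 2 * infDist x K ^ 2 + 2 * ‖h‖ ^ 2 := by
  obtain ⟨y, hy, hy'⟩ := hcl.exists_infDist_eq_dist hne x
  have h1 := infDist_le_dist_of_mem (x := x + h) hy
  have h2 := infDist_le_dist_of_mem (x := x - h) hy
  have hp := parallelogram_law_with_norm ℝ (x - y) h
  rw [dist_eq_norm] at h1 h2 hy'
  rw [hy']
  rw [show x + h - y = x - y + h by abel] at h1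
  rw [show x - h - y = x - y - h by abel] at h2
  have h3 := pow_le_pow_left₀ infDist_nonneg h1 2
  have h4 := pow_le_pow_left₀ infDist_nonneg h2 2
  linarith

lemma tamedLogConcave_exp_neg_infDist_sq {V : Type*} [NormedAddCommGroup V]
    [InnerProductSpace ℝ V] [ProperSpace V] {K : Set V} (hc : Convex ℝ K) (hcl : IsClosed K)
    (hK : ∀ x ∈ K, -x ∈ K) (hne : K.Nonempty) {r : ℝ} (hr : 0 ≤ r) :
    TamedLogConcave (2 * r) fun x => Real.exp (-(r * infDist x K ^ 2)) where
  even x := by rw [infDist_neg_eq_of_symmetric hK]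
  zero_pos := Real.exp_pos _
  nonneg x := (Real.exp_pos _).le
  mul_le_sq x h := by
    have h1 := two_mul_infDist_le hc hcl hne x h
    have h2 : 2 * infDist x K ^ 2 ≤ infDist (x + h) K ^ 2 + infDist (x - h) K ^ 2 := by
      have := pow_le_pow_left₀ (by have := infDist_nonneg (x := x) (s := K); positivity) h1 2
      nlinarith [sq_nonneg (infDist (x + h) K - infDist (x - h) K)]
    rw [← Real.exp_add, ← Real.exp_nat_mul]
    refine Real.exp_le_exp.2 ?_
    push_cast
    linarith [mul_le_mul_of_nonneg_left h2 hr]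
  sq_le_mul x h := by
    have h2 := infDist_sq_add_infDist_sq_le hcl hne x h
    rw [← Real.exp_add, ← Real.exp_add, ← Real.exp_nat_mul]
    refine Real.exp_le_exp.2 ?_
    push_cast
    linarith [mul_le_mul_of_nonneg_left h2 hr]

lemma tendsto_exp_neg_mul_infDist_sq (hcl : IsClosed K) (hne : K.Nonempty) (x : V) :
    Tendsto (fun k : ℕ => Real.exp (-(k * infDist x K ^ 2))) atTop (𝓝 (K.indicator 1 x)) := by
  by_cases hx : x ∈ K
  · simp [hx, infDist_zero_of_mem hx]
  · have hpos : 0 < infDist x K := (hcl.notMem_iff_infDist_pos hne).1 hx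
    rw [indicator_of_notMem hx]
    exact Real.tendsto_exp_neg_atTop_nhds_zero.comp
      (tendsto_natCast_atTop_atTop.atTop_mul_const (by positivity))

end InfDist

section SymmetricConvex

variable {ι : Type*} [Fintype ι] {K L : Set (EuclideanSpace ℝ ι)}

lemma stdGaussian_mul_le_inter_of_isClosed (hKc : Convex ℝ K) (hLc : Convex ℝ L)
    (hKs : ∀ x ∈ K, -x ∈ K) (hLs : ∀ x ∈ L, -x ∈ L) (hK : IsClosed K) (hL : IsClosed L)
    (hKn : K.Nonempty) (hLn : L.Nonempty) :
    (stdGaussian (EuclideanSpace ℝ ι)).real K * (stdGaussian (EuclideanSpace ℝ ι)).real L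
      ≤ (stdGaussian (EuclideanSpace ℝ ι)).real (K ∩ L) := by
  have hcont (S : Set (EuclideanSpace ℝ ι)) (k : ℕ) :
      Continuous fun x => Real.exp (-(k * Metric.infDist x S ^ 2)) := by
    have := Metric.continuous_infDist_pt S
    fun_prop
  have hle (S : Set (EuclideanSpace ℝ ι)) (k : ℕ) (x) :
      Real.exp (-(k * Metric.infDist x S ^ 2)) ≤ 1 :=
    Real.exp_le_one_iff.2 (neg_nonpos.2 (by positivity))
  refine le_of_tendsto_of_tendsto'
    ((tendsto_integral_measureReal (μ := stdGaussian _) hK.measurableSet (hcont K)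
      (fun _ _ => (Real.exp_pos _).le) (hle K) (tendsto_exp_neg_mul_infDist_sq hK hKn)).mul
    (tendsto_integral_measureReal (μ := stdGaussian _) hL.measurableSet (hcont L)
      (fun _ _ => (Real.exp_pos _).le) (hle L) (tendsto_exp_neg_mul_infDist_sq hL hLn)))
    (tendsto_integral_measureReal (μ := stdGaussian _) (hK.inter hL).measurableSet
      (fun k => (hcont K k).mul (hcont L k))
      (fun k x => (mul_pos (Real.exp_pos _) (Real.exp_pos _)).le)
      (fun k x => mul_le_one₀ (hle K k x) (Real.exp_pos _).le (hle L k x)) fun x => ?_)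
    fun k => TamedLogConcave.integral_mul_integral_le (by positivity)
      (tamedLogConcave_exp_neg_infDist_sq hKc hK hKs hKn (Nat.cast_nonneg k))
      (tamedLogConcave_exp_neg_infDist_sq hLc hL hLs hLn (Nat.cast_nonneg k))
  rw [inter_indicator_one]
  exact (tendsto_exp_neg_mul_infDist_sq hK hKn x).mul (tendsto_exp_neg_mul_infDist_sq hL hLn x)

lemma pi_gaussianReal_absolutelyContinuous (n : ℕ) :
    (Measure.pi fun _ : Fin n => gaussianReal 0 1) ≪ (volume : Measure (Fin n → ℝ)) := by
  induction n with
  | zero =>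
    rw [volume_pi, Measure.pi_of_empty _ 0, Measure.pi_of_empty _ 0]
  | succ n ih =>
    have h := measurePreserving_piFinSuccAbove (fun _ : Fin (n + 1) => gaussianReal 0 1) 0
    rw [← h.symm.map_eq,
      ← (volume_preserving_piFinSuccAbove (fun _ : Fin (n + 1) => ℝ) 0).symm.map_eq]
    exact ((gaussianReal_absolutelyContinuous 0 one_ne_zero).prod ih).map
      (MeasurableEquiv.measurable _)

lemma stdGaussian_absolutelyContinuous (n : ℕ) :
    stdGaussian (EuclideanSpace ℝ (Fin n)) ≪ volume := by
  rw [← map_pi_eq_stdGaussian, ← (PiLp.volume_preserving_toLp (Fin n)).map_eq]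
  exact (pi_gaussianReal_absolutelyContinuous n).map (by fun_prop)

lemma Convex.stdGaussian_closure_ae_eq {n : ℕ} {K : Set (EuclideanSpace ℝ (Fin n))}
    (hK : Convex ℝ K) : closure K =ᵐ[stdGaussian (EuclideanSpace ℝ (Fin n))] K := by
  refine EventuallyLE.antisymm (ae_le_set.2 (measure_mono_null ?_
    (stdGaussian_absolutelyContinuous n (hK.addHaar_frontier volume)))) ?_
  · exact sdiff_subset_sdiff_right interior_subset
  · exact ae_of_all _ fun x hx => subset_closure hx

theorem stdGaussian_mul_le_inter {n : ℕ} {K L : Set (EuclideanSpace ℝ (Fin n))}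
    (hKc : Convex ℝ K) (hLc : Convex ℝ L) (hKs : ∀ x ∈ K, -x ∈ K) (hLs : ∀ x ∈ L, -x ∈ L) :
    stdGaussian _ K * stdGaussian _ L ≤ stdGaussian _ (K ∩ L) := by
  rcases K.eq_empty_or_nonempty with rfl | hK
  · simp
  rcases L.eq_empty_or_nonempty with rfl | hL
  · simp
  have hcl {S : Set (EuclideanSpace ℝ (Fin n))} (hS : ∀ x ∈ S, -x ∈ S) :
      ∀ x ∈ closure S, -x ∈ closure S := fun x hx =>
    map_mem_closure continuous_neg hx fun y hy => hS y hy
  have key := stdGaussian_mul_le_inter_of_isClosed hKc.closure hLc.closure (hcl hKs) (hcl hLs)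
    isClosed_closure isClosed_closure hK.closure hL.closure
  have h1 := hKc.stdGaussian_closure_ae_eq
  have h2 := hLc.stdGaussian_closure_ae_eq
  rwa [measureReal_congr h1, measureReal_congr h2, measureReal_congr (h1.inter h2), measureReal_def,
    measureReal_def, measureReal_def, ← ENNReal.toReal_mul,
    ENNReal.toReal_le_toReal (by finiteness) (by finiteness)] at key

end SymmetricConvex

section CenteredGaussian

open scoped Matrix

variable {ι : Type*} [Fintype ι]

lemma exists_eq_map_stdGaussian {μ : Measure (EuclideanSpace ℝ ι)}
    (hμ : ∀ L : EuclideanSpace ℝ ι →L[ℝ] ℝ, ∃ v : ℝ≥0, μ.map L = gaussianReal 0 v) :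
    ∃ T : EuclideanSpace ℝ ι →L[ℝ] EuclideanSpace ℝ ι, μ = (stdGaussian _).map T := by
  classical
  have : IsGaussian μ := isGaussian_of_map_eq_gaussianReal fun L => ⟨0, hμ L⟩
  have hint (t : EuclideanSpace ℝ ι) : Integrable (fun x => inner ℝ x t ^ 2) μ := by
    have := (IsGaussian.memLp_dual μ (innerSL ℝ t) 2 (by simp)).integrable_sq
    simpa [real_inner_comm] using this
  suffices μ = multivariateGaussian 0 (secondMoment μ) by
    simp only [multivariateGaussian, zero_add] at this
    exact ⟨_, this⟩
  refine Measure.ext_of_charFun (funext fun t => ?_)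
  have h0 : ∫ x, inner ℝ t x ∂μ = 0 := by
    obtain ⟨v, hv⟩ := hμ (innerSL ℝ t)
    have := integral_id_gaussianReal (μ := 0) (v := v)
    rw [← hv, integral_map (by fun_prop) (by fun_prop)] at this
    simpa using this
  rw [charFun_multivariateGaussian (posSemidef_secondMoment hint),
    dotProduct_secondMoment_mulVec hint, IsGaussian.charFun_eq,
    variance_of_integral_eq_zero (by fun_prop) h0,
    integral_complex_ofReal, h0]
  simp [real_inner_comm]

end CenteredGaussian

end

/-- **Royen's Gaussian correlation inequality.**  Let `μ` be a centered
Gaussian measure on a finite-dimensional real vector space.  Then for any two symmetric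
convex Borel sets `K₁, K₂` one has `μ(K₁) μ(K₂) ≤ μ(K₁ ∩ K₂)`. -/
theorem gaussian_correlation_inequality {n : ℕ}
    (μ : Measure (EuclideanSpace ℝ (Fin n))) (hμ : IsCenteredGaussian μ)
    (K₁ K₂ : Set (EuclideanSpace ℝ (Fin n)))
    (hK₁conv : Convex ℝ K₁) (hK₂conv : Convex ℝ K₂)
    (hK₁symm : ∀ x ∈ K₁, -x ∈ K₁) (hK₂symm : ∀ x ∈ K₂, -x ∈ K₂)
    (hK₁meas : MeasurableSet K₁) (hK₂meas : MeasurableSet K₂) :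
    μ K₁ * μ K₂ ≤ μ (K₁ ∩ K₂) := by
  obtain ⟨T, rfl⟩ := exists_eq_map_stdGaussian hμ.2
  have hT : Measurable T := by fun_prop
  rw [Measure.map_apply hT hK₁meas, Measure.map_apply hT hK₂meas,
    Measure.map_apply hT (hK₁meas.inter hK₂meas), Set.preimage_inter]
  refine stdGaussian_mul_le_inter (hK₁conv.linear_preimage T.toLinearMap)
    (hK₂conv.linear_preimage T.toLinearMap) (fun x hx => ?_) fun x hx => ?_
  · simpa using hK₁symm _ hx
  · simpa using hK₂symm _ hx

end
end

section
/- (Functional form of the Gaussian correlation inequality) Let μ be a centered Gaussian measure on a finite-dimensional real vector space X, let f₁, …, f_n : X → ℝ≥0 be measurable symmetric quasi-concave functions that are μ-integrable together with the relevant products, and let 1 ≤ m ≤ n. Then E^{x∼μ}[ ∏_{j=1}^m f_j(x) ] · E^{x∼μ}[ ∏_{k=m+1}^n f_k(x) ] ≤ E^{x∼μ}[ ∏_{i=1}^n f_i(x) ]. -/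
open MeasureTheory ProbabilityTheory
open scoped NNReal ENNReal

noncomputable section

/-- The midpoint form of the Prékopa–Leindler inequality for a measure, tested on functions
bounded by one. -/
def SatisfiesPrekopaLeindler {X : Type*} [AddCommGroup X] [Module ℝ X] [MeasurableSpace X]
    (μ : Measure X) : Prop :=
  ∀ f g h : X → ℝ≥0∞, Measurable f → Measurable g → Measurable h →
    (∀ x, f x ≤ 1) → (∀ x, g x ≤ 1) →
    (∀ x y, f x * g y ≤ h ((2⁻¹ : ℝ) • (x + y)) ^ 2) →
    (∫⁻ x, f x ∂μ) * (∫⁻ x, g x ∂μ) ≤ (∫⁻ x, h x ∂μ) ^ 2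

lemma ENNReal.mul_le_sq_of_add_le_two_mul {a b c : ℝ≥0∞} (h : a + b ≤ 2 * c) :
    a * b ≤ c ^ 2 := by
  by_cases hc : c = ⊤
  · simp [hc]
  have hab : a + b ≠ ⊤ := ne_top_of_le_ne_top (ENNReal.mul_ne_top (by simp) hc) h
  lift c to ℝ≥0 using hc
  lift a to ℝ≥0 using (fun h => hab (by simp [h]))
  lift b to ℝ≥0 using (fun h => hab (by simp [h]))
  norm_cast at h ⊢
  have h' : (a : ℝ) + b ≤ 2 * c := by exact_mod_cast h
  have : (a : ℝ) * b ≤ c ^ 2 := by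
    nlinarith [sq_nonneg ((a : ℝ) - b), a.2, b.2, c.2,
      mul_self_le_mul_self (add_nonneg a.2 b.2) h']
  exact_mod_cast this

/-- Brunn–Minkowski on the line, for compact sets. -/
lemma IsCompact.volume_add_le_two_mul_of_midpoint_mem {A B S : Set ℝ} (hA : IsCompact A)
    (hB : IsCompact B) (hA₀ : A.Nonempty) (hB₀ : B.Nonempty)
    (hS : ∀ a ∈ A, ∀ b ∈ B, 2⁻¹ * (a + b) ∈ S) :
    volume A + volume B ≤ 2 * volume S := by
  obtain ⟨a, haA, ha⟩ := hA.exists_isGreatest hA₀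
  obtain ⟨b, hbB, hb⟩ := hB.exists_isLeast hB₀
  have hdil : volume ((fun x : ℝ => (2⁻¹ : ℝ) * x) ⁻¹' S) = 2 * volume S := by
    rw [Real.volume_preimage_mul_left (by norm_num)]
    norm_num
  have hA' : volume ((fun x => x + -b) ⁻¹' A) = volume A := measure_preimage_add_right _ _ _
  have hB' : volume ((fun x => x + -a) ⁻¹' B) = volume B := measure_preimage_add_right _ _ _
  have hBm : MeasurableSet ((fun x => x + -a) ⁻¹' B) :=
    (measurable_add_const _) hB.measurableSet
  have hinter : volume ((fun x => x + -b) ⁻¹' A ∩ (fun x => x + -a) ⁻¹' B) = 0 := by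
    refine measure_mono_null (t := {a + b}) ?_ (by simp)
    rintro x ⟨hx₁, hx₂⟩
    have h₁ := ha hx₁
    have h₂ := hb hx₂
    simp only [Set.mem_singleton_iff]
    linarith
  rw [← hdil, ← hA', ← hB', ← measure_union_add_inter _ hBm, hinter, add_zero]
  refine measure_mono ?_
  rintro x (hx | hx)
  · simpa using hS _ hx b hbB
  · simpa using hS a haA _ hx

/-- Brunn–Minkowski on the line. -/
lemma volume_add_le_two_mul_of_midpoint_mem {A B S : Set ℝ} (hA : MeasurableSet A)
    (hB : MeasurableSet B) (hA₀ : A.Nonempty) (hB₀ : B.Nonempty)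
    (hS : ∀ a ∈ A, ∀ b ∈ B, 2⁻¹ * (a + b) ∈ S) :
    volume A + volume B ≤ 2 * volume S := by
  obtain ⟨a₀, ha₀⟩ := hA₀
  obtain ⟨b₀, hb₀⟩ := hB₀
  have key : ∀ K ⊆ A, IsCompact K → ∀ L ⊆ B, IsCompact L →
      volume K + volume L ≤ 2 * volume S := by
    intro K hKA hK L hLB hL
    refine le_trans (add_le_add (measure_mono (Set.subset_insert a₀ K))
      (measure_mono (Set.subset_insert b₀ L))) ?_
    refine (hK.insert a₀).volume_add_le_two_mul_of_midpoint_mem (hL.insert b₀)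
      (Set.insert_nonempty _ _) (Set.insert_nonempty _ _) fun a ha b hb => hS a ?_ b ?_
    · exact Set.insert_subset ha₀ hKA ha
    · exact Set.insert_subset hb₀ hLB hb
  rw [hA.measure_eq_iSup_isCompact, hB.measure_eq_iSup_isCompact]
  simp only [iSup_and']
  exact ENNReal.biSup_add_biSup_le' ⟨∅, by simp⟩ ⟨∅, by simp⟩
    fun K hK L hL => key K hK.1 hK.2 L hL.1 hL.2

lemma lintegral_add_le_two_mul_of_forall_lt_exists {f g h : ℝ → ℝ} (hf : Measurable f)
    (hg : Measurable g) (hh : Measurable h) (hf₀ : ∀ x, 0 ≤ f x) (hg₀ : ∀ x, 0 ≤ g x)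
    (hh₀ : ∀ x, 0 ≤ h x) (hf₁ : ∀ x, f x ≤ 1) (hg₁ : ∀ x, g x ≤ 1)
    (hfs : ∀ s < 1, ∃ x, s < f x) (hgs : ∀ s < 1, ∃ x, s < g x)
    (hfgh : ∀ x y, f x * g y ≤ h (2⁻¹ * (x + y)) ^ 2) :
    (∫⁻ x, ENNReal.ofReal (f x)) + (∫⁻ x, ENNReal.ofReal (g x))
      ≤ 2 * ∫⁻ x, ENNReal.ofReal (h x) := by
  have meas : ∀ {k : ℝ → ℝ}, Measurable fun t => volume {a | t < k a} := fun {k} =>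
    Antitone.measurable fun s t hst => measure_mono fun a ha => lt_of_le_of_lt hst ha
  rw [lintegral_eq_lintegral_meas_lt _ (.of_forall hf₀) hf.aemeasurable,
    lintegral_eq_lintegral_meas_lt _ (.of_forall hg₀) hg.aemeasurable,
    lintegral_eq_lintegral_meas_lt _ (.of_forall hh₀) hh.aemeasurable,
    ← lintegral_add_left meas, ← lintegral_const_mul _ meas]
  refine setLIntegral_mono (meas.const_mul _) fun t ht => ?_
  have ht₀ : (0 : ℝ) < t := ht
  rcases lt_or_ge t 1 with ht₁ | ht₁
  · refine volume_add_le_two_mul_of_midpoint_mem (measurableSet_lt measurable_const hf)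
      (measurableSet_lt measurable_const hg) (hfs t ht₁) (hgs t ht₁) fun a ha b hb => ?_
    have : t ^ 2 < h (2⁻¹ * (a + b)) ^ 2 := by
      refine lt_of_lt_of_le ?_ (hfgh a b)
      rw [sq]
      exact mul_lt_mul'' ha hb ht₀.le ht₀.le
    exact lt_of_pow_lt_pow_left₀ 2 (hh₀ _) this
  · have e₁ : {a | t < f a} = ∅ := Set.eq_empty_of_forall_notMem fun a ha =>
      absurd (lt_of_lt_of_le ha (hf₁ a)) (not_lt.2 ht₁)
    have e₂ : {a | t < g a} = ∅ := Set.eq_empty_of_forall_notMem fun a ha =>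
      absurd (lt_of_lt_of_le ha (hg₁ a)) (not_lt.2 ht₁)
    simp [e₁, e₂]

lemma lintegral_mul_lintegral_le_sq_of_real {f g h : ℝ → ℝ} (hf : Measurable f)
    (hg : Measurable g) (hh : Measurable h) (hf₀ : ∀ x, 0 ≤ f x) (hg₀ : ∀ x, 0 ≤ g x)
    (hh₀ : ∀ x, 0 ≤ h x) (hf₁ : ∀ x, f x ≤ 1) (hg₁ : ∀ x, g x ≤ 1)
    (hfgh : ∀ x y, f x * g y ≤ h (2⁻¹ * (x + y)) ^ 2) :
    (∫⁻ x, ENNReal.ofReal (f x)) * (∫⁻ x, ENNReal.ofReal (g x))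
      ≤ (∫⁻ x, ENNReal.ofReal (h x)) ^ 2 := by
  have bf : BddAbove (Set.range f) := ⟨1, by rintro _ ⟨x, rfl⟩; exact hf₁ x⟩
  have bg : BddAbove (Set.range g) := ⟨1, by rintro _ ⟨x, rfl⟩; exact hg₁ x⟩
  set F := ⨆ x, f x with hF
  set G := ⨆ x, g x with hG
  have fF : ∀ x, f x ≤ F := fun x => le_ciSup bf x
  have gG : ∀ x, g x ≤ G := fun x => le_ciSup bg x
  rcases (le_trans (hf₀ 0) (fF 0)).eq_or_lt with hF₀ | hF₀
  · have : ∀ x, f x = 0 := fun x => le_antisymm (hF₀ ▸ fF x) (hf₀ x)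
    simp [this]
  rcases (le_trans (hg₀ 0) (gG 0)).eq_or_lt with hG₀ | hG₀
  · have : ∀ x, g x = 0 := fun x => le_antisymm (hG₀ ▸ gG x) (hg₀ x)
    simp [this]
  set r := √(F * G) with hr
  have hr₀ : 0 < r := Real.sqrt_pos.2 (mul_pos hF₀ hG₀)
  have hr₂ : r ^ 2 = F * G := Real.sq_sqrt (mul_pos hF₀ hG₀).le
  have scale : ∀ {c : ℝ} {k : ℝ → ℝ}, 0 < c → Measurable k →
      ∫⁻ x, ENNReal.ofReal (k x) = ENNReal.ofReal c * ∫⁻ x, ENNReal.ofReal (k x / c) := by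
    intro c k hc hk
    rw [← lintegral_const_mul _ (by fun_prop)]
    refine lintegral_congr fun x => ?_
    rw [← ENNReal.ofReal_mul hc.le, mul_div_cancel₀ _ hc.ne']
  rw [scale hF₀ hf, scale hG₀ hg, scale hr₀ hh, mul_mul_mul_comm, ← ENNReal.ofReal_mul hF₀.le,
    mul_pow, ← ENNReal.ofReal_pow hr₀.le, hr₂]
  gcongr
  refine ENNReal.mul_le_sq_of_add_le_two_mul ?_
  refine lintegral_add_le_two_mul_of_forall_lt_exists (by fun_prop) (by fun_prop) (by fun_prop)
    (fun x => div_nonneg (hf₀ x) hF₀.le) (fun x => div_nonneg (hg₀ x) hG₀.le)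
    (fun x => div_nonneg (hh₀ x) hr₀.le) (fun x => (div_le_one hF₀).2 (fF x))
    (fun x => (div_le_one hG₀).2 (gG x)) ?_ ?_ ?_
  · intro s hs
    obtain ⟨x, hx⟩ := exists_lt_of_lt_ciSup (show s * F < ⨆ x, f x by rw [← hF]; nlinarith)
    exact ⟨x, (lt_div_iff₀ hF₀).2 hx⟩
  · intro s hs
    obtain ⟨x, hx⟩ := exists_lt_of_lt_ciSup (show s * G < ⨆ x, g x by rw [← hG]; nlinarith)
    exact ⟨x, (lt_div_iff₀ hG₀).2 hx⟩
  · intro x y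
    rw [div_mul_div_comm, div_pow, hr₂]
    gcongr
    exact hfgh x y

lemma satisfiesPrekopaLeindler_volume : SatisfiesPrekopaLeindler (volume : Measure ℝ) := by
  intro f g h hf hg hh hf₁ hg₁ hfgh
  have ef : ∀ x, ENNReal.ofReal (f x).toReal = f x := fun x =>
    ENNReal.ofReal_toReal (ne_top_of_le_ne_top ENNReal.one_ne_top (hf₁ x))
  have eg : ∀ x, ENNReal.ofReal (g x).toReal = g x := fun x =>
    ENNReal.ofReal_toReal (ne_top_of_le_ne_top ENNReal.one_ne_top (hg₁ x))
  have hm : ∀ x, min (h x) 1 ≠ ⊤ := fun x =>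
    ne_top_of_le_ne_top ENNReal.one_ne_top (min_le_right _ _)
  have eh : ∀ x, ENNReal.ofReal (min (h x) 1).toReal = min (h x) 1 := fun x =>
    ENNReal.ofReal_toReal (hm x)
  have := lintegral_mul_lintegral_le_sq_of_real (f := fun x => (f x).toReal)
    (g := fun x => (g x).toReal) (h := fun x => (min (h x) 1).toReal) hf.ennreal_toReal
    hg.ennreal_toReal (hh.min measurable_const).ennreal_toReal (fun _ => ENNReal.toReal_nonneg)
    (fun _ => ENNReal.toReal_nonneg) (fun _ => ENNReal.toReal_nonneg)
    (fun x => ENNReal.toReal_mono ENNReal.one_ne_top (hf₁ x))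
    (fun x => ENNReal.toReal_mono ENNReal.one_ne_top (hg₁ x)) ?_
  · simp only [ef, eg, eh] at this
    refine this.trans ?_
    gcongr
    exact min_le_left _ _
  · intro x y
    rw [← ENNReal.toReal_mul, ← ENNReal.toReal_pow]
    refine ENNReal.toReal_mono (by finiteness [hm (2⁻¹ * (x + y))]) ?_
    rcases le_total (h (2⁻¹ * (x + y))) 1 with h1 | h1
    · rw [min_eq_left h1]
      simpa using hfgh x y
    · rw [min_eq_right h1, one_pow]
      exact mul_le_one' (hf₁ x) (hg₁ y)

namespace SatisfiesPrekopaLeindler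

variable {X Y : Type*} [AddCommGroup X] [Module ℝ X] [MeasurableSpace X]
  [AddCommGroup Y] [Module ℝ Y] [MeasurableSpace Y]

lemma withDensity {μ : Measure X} (hμ : SatisfiesPrekopaLeindler μ) {p : X → ℝ≥0∞}
    (hp : Measurable p) (hp₁ : ∀ x, p x ≤ 1)
    (hpp : ∀ x y, p x * p y ≤ p ((2⁻¹ : ℝ) • (x + y)) ^ 2) :
    SatisfiesPrekopaLeindler (μ.withDensity p) := by
  intro f g h hf hg hh hf₁ hg₁ hfgh
  rw [lintegral_withDensity_eq_lintegral_mul _ hp hf,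
    lintegral_withDensity_eq_lintegral_mul _ hp hg,
    lintegral_withDensity_eq_lintegral_mul _ hp hh]
  refine hμ _ _ _ (hp.mul hf) (hp.mul hg) (hp.mul hh) (fun x => mul_le_one' (hp₁ x) (hf₁ x))
    (fun x => mul_le_one' (hp₁ x) (hg₁ x)) fun x y => ?_
  simp only [Pi.mul_apply]
  rw [mul_mul_mul_comm, mul_pow]
  exact mul_le_mul' (hpp x y) (hfgh x y)

lemma map {μ : Measure X} (hμ : SatisfiesPrekopaLeindler μ) (T : X →ₗ[ℝ] Y)
    (hT : Measurable T) : SatisfiesPrekopaLeindler (μ.map T) := by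
  intro f g h hf hg hh hf₁ hg₁ hfgh
  rw [lintegral_map hf hT, lintegral_map hg hT, lintegral_map hh hT]
  exact hμ _ _ _ (hf.comp hT) (hg.comp hT) (hh.comp hT) (fun x => hf₁ _) (fun x => hg₁ _)
    fun x y => by simpa using hfgh (T x) (T y)

lemma prod {μ : Measure X} {ν : Measure Y} [IsProbabilityMeasure μ] [SFinite ν]
    (hμ : SatisfiesPrekopaLeindler μ) (hν : SatisfiesPrekopaLeindler ν) :
    SatisfiesPrekopaLeindler (μ.prod ν) := by
  intro f g h hf hg hh hf₁ hg₁ hfgh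
  have bound : ∀ {k : X → ℝ≥0∞}, (∀ x, k x ≤ 1) → ∫⁻ x, k x ∂μ ≤ 1 := fun hk => by
    simpa using lintegral_mono (μ := μ) hk
  rw [lintegral_prod_symm' _ hf, lintegral_prod_symm' _ hg, lintegral_prod_symm' _ hh]
  refine hν _ _ _ hf.lintegral_prod_left' hg.lintegral_prod_left' hh.lintegral_prod_left'
    (fun y => bound fun x => hf₁ _) (fun y => bound fun x => hg₁ _) fun y₁ y₂ => ?_
  refine hμ _ _ _ (by fun_prop) (by fun_prop) (by fun_prop) (fun x => hf₁ _) (fun x => hg₁ _)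
    fun x₁ x₂ => by simpa using hfgh (x₁, y₁) (x₂, y₂)

end SatisfiesPrekopaLeindler

lemma satisfiesPrekopaLeindler_gaussianReal :
    SatisfiesPrekopaLeindler (gaussianReal 0 1) := by
  rw [gaussianReal_of_var_ne_zero _ one_ne_zero]
  refine satisfiesPrekopaLeindler_volume.withDensity (measurable_gaussianPDF _ _) ?_ ?_
  · intro x
    rw [gaussianPDF, ENNReal.ofReal_le_one, gaussianPDFReal_def]
    refine mul_le_one₀ (inv_le_one_of_one_le₀ ?_) (Real.exp_pos _).le
      (Real.exp_le_one_iff.2 ?_)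
    · rw [Real.one_le_sqrt]
      simp only [NNReal.coe_one, mul_one]
      linarith [Real.pi_gt_three]
    · simp only [NNReal.coe_one, sub_zero]
      have := sq_nonneg x
      linarith
  · intro x y
    rw [gaussianPDF, gaussianPDF, gaussianPDF, ← ENNReal.ofReal_mul (gaussianPDFReal_nonneg _ _ _),
      ← ENNReal.ofReal_pow (gaussianPDFReal_nonneg _ _ _)]
    refine ENNReal.ofReal_le_ofReal ?_
    simp only [gaussianPDFReal_def, smul_eq_mul, sub_zero, NNReal.coe_one, mul_one]
    rw [mul_mul_mul_comm, ← Real.exp_add, ← sq, mul_pow, ← Real.exp_nat_mul]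
    gcongr
    push_cast
    nlinarith [sq_nonneg (x - y)]

lemma satisfiesPrekopaLeindler_pi_gaussianReal (n : ℕ) :
    SatisfiesPrekopaLeindler (Measure.pi fun _ : Fin n => gaussianReal 0 1) := by
  induction n with
  | zero =>
    intro f g h hf hg hh hf₁ hg₁ hfgh
    rw [Measure.pi_of_empty _ 0, lintegral_dirac' _ hf, lintegral_dirac' _ hg,
      lintegral_dirac' _ hh]
    simpa using hfgh 0 0
  | succ n ih =>
    have e := (measurePreserving_piFinSuccAbove (fun _ : Fin (n + 1) => gaussianReal 0 1) 0).symm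
    rw [← e.map_eq]
    let T : ℝ × (Fin n → ℝ) →ₗ[ℝ] (Fin (n + 1) → ℝ) :=
      { toFun := fun p => (MeasurableEquiv.piFinSuccAbove (fun _ => ℝ) 0).symm p
        map_add' := fun p q => by
          ext i; refine Fin.cases ?_ (fun j => ?_) i <;> simp [MeasurableEquiv.piFinSuccAbove]
        map_smul' := fun c p => by
          ext i; refine Fin.cases ?_ (fun j => ?_) i <;> simp [MeasurableEquiv.piFinSuccAbove] }
    exact (satisfiesPrekopaLeindler_gaussianReal.prod ih).map T e.measurable

lemma satisfiesPrekopaLeindler_stdGaussian (E : Type*) [NormedAddCommGroup E]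
    [InnerProductSpace ℝ E] [FiniteDimensional ℝ E] [MeasurableSpace E] [BorelSpace E] :
    SatisfiesPrekopaLeindler (stdGaussian E) := by
  let T : (Fin (Module.finrank ℝ E) → ℝ) →ₗ[ℝ] E :=
    { toFun := fun x => ∑ i, x i • stdOrthonormalBasis ℝ E i
      map_add' := fun x y => by simp [add_smul, Finset.sum_add_distrib]
      map_smul' := fun c x => by simp [Finset.smul_sum, mul_smul] }
  exact (satisfiesPrekopaLeindler_pi_gaussianReal _).map T
    (show Measurable fun x : Fin (Module.finrank ℝ E) → ℝ =>
      ∑ i, x i • stdOrthonormalBasis ℝ E i by fun_prop)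

local notation "κ" => ((√2 : ℝ)⁻¹)

lemma inv_sqrt_two_mul_self : κ * κ = 2⁻¹ := by
  rw [← mul_inv, Real.mul_self_sqrt (by norm_num)]

lemma inv_sqrt_two_pos : 0 < κ := by positivity

section StdGaussian

variable {E : Type*} [NormedAddCommGroup E] [InnerProductSpace ℝ E] [FiniteDimensional ℝ E]
  [MeasurableSpace E] [BorelSpace E]

lemma measurePreserving_rotation_stdGaussian :
    MeasurePreserving (fun p : E × E => (κ • (p.1 + p.2), κ • (p.2 - p.1)))
      ((stdGaussian E).prod (stdGaussian E)) ((stdGaussian E).prod (stdGaussian E)) := by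
  refine ⟨by fun_prop, ?_⟩
  have h := IsGaussian.map_rotation_eq_self (μ := stdGaussian E) (by simp) (Real.pi / 4)
  convert h using 2
  ext p : 1
  have : √2 / 2 = κ := by
    rw [div_eq_iff (by norm_num), inv_mul_eq_div, Real.div_sqrt]
  rw [ContinuousLinearMap.rotation_apply, Real.cos_pi_div_four, Real.sin_pi_div_four, this]
  simp only [smul_add, smul_sub, neg_smul, Prod.mk.injEq, true_and]
  abel

lemma measurePreserving_inv_sqrt_two_smul_add_stdGaussian :
    MeasurePreserving (fun p : E × E => κ • (p.1 + p.2))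
      ((stdGaussian E).prod (stdGaussian E)) (stdGaussian E) :=
  measurePreserving_fst.comp measurePreserving_rotation_stdGaussian

lemma measurePreserving_add_stdGaussian (S T : E →L[ℝ] E)
    (hS : ∀ x t, inner ℝ (S x) t = inner ℝ x (S t))
    (hT : ∀ x t, inner ℝ (T x) t = inner ℝ x (T t))
    (hST : ∀ t, ‖S t‖ ^ 2 + ‖T t‖ ^ 2 = ‖t‖ ^ 2) :
    MeasurePreserving (fun p : E × E => S p.1 + T p.2)
      ((stdGaussian E).prod (stdGaussian E)) (stdGaussian E) := by
  have hm : Measurable (fun p : E × E => S p.1 + T p.2) := by fun_prop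
  refine ⟨hm, ?_⟩
  have := Measure.isProbabilityMeasure_map (μ := (stdGaussian E).prod (stdGaussian E))
    hm.aemeasurable
  refine Measure.ext_of_charFun ?_
  ext t
  rw [charFun_apply, integral_map hm.aemeasurable (by fun_prop)]
  simp only [inner_add_left, hS, hT, Complex.ofReal_add, add_mul, Complex.exp_add]
  rw [integral_prod_mul (fun x : E => Complex.exp (inner ℝ x (S t) * Complex.I))
    (fun x : E => Complex.exp (inner ℝ x (T t) * Complex.I)), ← charFun_apply, ← charFun_apply,
    charFun_stdGaussian, charFun_stdGaussian, charFun_stdGaussian, ← Complex.exp_add]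
  congr 1
  have := hST t
  have h2 : (‖S t‖ : ℂ) ^ 2 + (‖T t‖ : ℂ) ^ 2 = (‖t‖ : ℂ) ^ 2 := by exact_mod_cast this
  rw [← h2]; ring

lemma measurePreserving_neg_stdGaussian :
    MeasurePreserving (fun x : E => -x) (stdGaussian E) (stdGaussian E) :=
  ⟨measurable_neg, stdGaussian_map (LinearIsometryEquiv.neg ℝ (E := E))⟩

lemma integrable_norm_sq_stdGaussian :
    Integrable (fun x : E => ‖x‖ ^ 2) (stdGaussian E) :=
  (IsGaussian.memLp_two_id (μ := stdGaussian E)).integrable_norm_pow (by norm_num)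

lemma integrable_exp_neg_mul_norm_sq {b : ℝ} (hb : 0 < b) :
    Integrable (fun x : E => Real.exp (-b * ‖x‖ ^ 2)) := by
  have h := GaussianFourier.integrable_cexp_neg_mul_sq_norm_add (V := E) (b := (b : ℂ))
    (by simpa using hb) 0 0
  have := h.re
  refine this.congr (Filter.Eventually.of_forall fun x => ?_)
  simp only [zero_mul, add_zero, RCLike.re_to_complex]
  norm_cast

/-- The Lebesgue density of the standard Gaussian measure. -/
def stdGaussianDensity (E : Type*) [NormedAddCommGroup E] [InnerProductSpace ℝ E]
    [FiniteDimensional ℝ E] [MeasurableSpace E] [BorelSpace E] (x : E) : ℝ :=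
  (∫ y : E, Real.exp (-2⁻¹ * ‖y‖ ^ 2))⁻¹ * Real.exp (-2⁻¹ * ‖x‖ ^ 2)

lemma integral_exp_neg_norm_sq_pos : 0 < ∫ y : E, Real.exp (-2⁻¹ * ‖y‖ ^ 2) :=
  integral_exp_pos (integrable_exp_neg_mul_norm_sq (by norm_num))

lemma stdGaussianDensity_pos (x : E) : 0 < stdGaussianDensity E x :=
  mul_pos (inv_pos.2 integral_exp_neg_norm_sq_pos) (Real.exp_pos _)

lemma continuous_stdGaussianDensity : Continuous (stdGaussianDensity E) := by
  unfold stdGaussianDensity; fun_prop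

lemma integrable_stdGaussianDensity : Integrable (stdGaussianDensity E) :=
  (integrable_exp_neg_mul_norm_sq (by norm_num)).const_mul _

lemma integral_stdGaussianDensity : ∫ x, stdGaussianDensity E x = 1 := by
  unfold stdGaussianDensity
  rw [integral_const_mul, inv_mul_cancel₀ integral_exp_neg_norm_sq_pos.ne']

lemma stdGaussian_eq_withDensity :
    stdGaussian E = volume.withDensity fun x => ENNReal.ofReal (stdGaussianDensity E x) := by
  have : IsProbabilityMeasure
      (volume.withDensity fun x => ENNReal.ofReal (stdGaussianDensity E x)) := by
    constructor
    rw [withDensity_apply _ MeasurableSet.univ, setLIntegral_univ,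
      ← ofReal_integral_eq_lintegral_ofReal integrable_stdGaussianDensity
        (Filter.Eventually.of_forall fun x => (stdGaussianDensity_pos x).le),
      integral_stdGaussianDensity, ENNReal.ofReal_one]
  refine Measure.ext_of_charFun ?_
  ext t
  rw [charFun_stdGaussian, charFun_apply, integral_withDensity_eq_integral_toReal_smul
    (continuous_stdGaussianDensity.measurable.ennreal_ofReal)
    (Filter.Eventually.of_forall fun x => ENNReal.ofReal_lt_top)]
  simp only [ENNReal.toReal_ofReal (stdGaussianDensity_pos _).le]
  have hb : 0 < ((2⁻¹ : ℂ)).re := by norm_num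
  have h1 := GaussianFourier.integral_cexp_neg_mul_sq_norm_add (V := E) hb Complex.I t
  have h2 := GaussianFourier.integral_cexp_neg_mul_sq_norm (V := E) hb
  have h3 : ((∫ y : E, Real.exp (-2⁻¹ * ‖y‖ ^ 2) : ℝ) : ℂ)
      = (Real.pi / (2⁻¹ : ℂ)) ^ (Module.finrank ℝ E / 2 : ℂ) := by
    rw [← h2, ← integral_complex_ofReal]
    push_cast
    rfl
  have h4 : (fun x : E => stdGaussianDensity E x • Complex.exp (inner ℝ x t * Complex.I))
      = fun x : E => ((∫ y : E, Real.exp (-2⁻¹ * ‖y‖ ^ 2) : ℝ) : ℂ)⁻¹ *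
        Complex.exp (-2⁻¹ * ‖x‖ ^ 2 + Complex.I * inner ℝ t x) := by
    ext x
    rw [Complex.exp_add, real_inner_comm, stdGaussianDensity, Complex.real_smul]
    push_cast
    ring_nf
  rw [h4, integral_const_mul, h1, ← h3, ← mul_assoc, inv_mul_cancel₀, one_mul]
  · congr 1
    rw [Complex.I_sq]; ring
  · exact_mod_cast integral_exp_neg_norm_sq_pos.ne'

lemma integral_stdGaussian_eq (g : E → ℝ) :
    ∫ x, g x ∂stdGaussian E = ∫ x, stdGaussianDensity E x * g x := by
  rw [stdGaussian_eq_withDensity, integral_withDensity_eq_integral_toReal_smul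
    (continuous_stdGaussianDensity.measurable.ennreal_ofReal)
    (Filter.Eventually.of_forall fun x => ENNReal.ofReal_lt_top)]
  simp only [ENNReal.toReal_ofReal (stdGaussianDensity_pos _).le, smul_eq_mul]

lemma stdGaussian_absolutelyContinuous_s3 : stdGaussian E ≪ volume := by
  rw [stdGaussian_eq_withDensity]; exact withDensity_absolutelyContinuous _ _

instance : (stdGaussian E).IsOpenPosMeasure := by
  have : (volume : Measure E) ≪ stdGaussian E := by
    rw [stdGaussian_eq_withDensity]
    exact withDensity_absolutelyContinuous'
      continuous_stdGaussianDensity.measurable.ennreal_ofReal.aemeasurable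
      (Filter.Eventually.of_forall fun x => by simpa using stdGaussianDensity_pos x)
  exact this.isOpenPosMeasure

/-- Change of variables between a Gaussian measure and a Gaussian density with respect to
another Gaussian measure. -/
lemma integral_comp_mul_integral_exp_neg (S : E →ₗ[ℝ] E) (hS : LinearMap.det S ≠ 0)
    (φ g : E → ℝ) (hφ : ∀ x, ‖x‖ ^ 2 = ‖S x‖ ^ 2 + 2 * φ (S x)) :
    (∫ x, g (S x) ∂stdGaussian E) * (∫ x, Real.exp (-φ x) ∂stdGaussian E)
      = ∫ x, g x * Real.exp (-φ x) ∂stdGaussian E := by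
  have key : ∀ G : E → ℝ, ∫ x, G (S x) ∂stdGaussian E
      = |(LinearMap.det S)⁻¹| * ∫ x, G x * Real.exp (-φ x) ∂stdGaussian E := by
    intro G
    rw [integral_stdGaussian_eq, integral_stdGaussian_eq]
    have h1 : ∀ x, stdGaussianDensity E x * G (S x) =
        (fun y => stdGaussianDensity E y * (G y * Real.exp (-φ y))) (S x) := by
      intro x
      simp only [stdGaussianDensity]
      rw [hφ x, show -2⁻¹ * (‖S x‖ ^ 2 + 2 * φ (S x)) = -2⁻¹ * ‖S x‖ ^ 2 + -φ (S x) by ring,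
        Real.exp_add]
      ring
    simp_rw [h1]
    have hemb : MeasurableEmbedding S := by
      have := (LinearEquiv.ofIsUnitDet (f := S) (v := Module.finBasis ℝ E)
        (v' := Module.finBasis ℝ E)
        (by simpa [LinearMap.det_toMatrix] using hS)).toContinuousLinearEquiv.toHomeomorph
          |>.measurableEmbedding
      exact this
    rw [← hemb.integral_map (fun y => stdGaussianDensity E y * (G y * Real.exp (-φ y))),
      Measure.map_linearMap_addHaar_eq_smul_addHaar _ hS, integral_smul_measure,
      ENNReal.toReal_ofReal (abs_nonneg _), smul_eq_mul]
  have h1 := key fun _ => 1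
  have h2 := key g
  simp only [integral_const, probReal_univ, smul_eq_mul, mul_one, one_mul] at h1
  rw [h2, mul_right_comm, ← h1, one_mul]

lemma tendsto_integral_abs_stdGaussianDensity_sub {h : ℕ → E}
    (hh : Filter.Tendsto h Filter.atTop (nhds 0)) :
    Filter.Tendsto (fun n => ∫ u, |stdGaussianDensity E (u - h n) - stdGaussianDensity E u|)
      Filter.atTop (nhds 0) := by
  set K := (∫ y : E, Real.exp (-2⁻¹ * ‖y‖ ^ 2))⁻¹ with hK
  have hK0 : 0 < K := inv_pos.2 integral_exp_neg_norm_sq_pos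
  have hbound : ∀ v u : E, ‖v‖ ≤ 1 →
      stdGaussianDensity E (u - v) ≤ K * Real.exp 2⁻¹ * Real.exp (-4⁻¹ * ‖u‖ ^ 2) := by
    intro v u hv
    rw [stdGaussianDensity, mul_assoc, ← Real.exp_add]
    refine mul_le_mul_of_nonneg_left (Real.exp_le_exp.2 ?_) hK0.le
    have h1 : ‖u‖ ≤ ‖u - v‖ + ‖v‖ := by simpa using norm_add_le (u - v) v
    have h2 : ‖u‖ ^ 2 ≤ (‖u - v‖ + ‖v‖) ^ 2 := by gcongr
    have h3 : ‖v‖ ^ 2 ≤ 1 := by nlinarith [norm_nonneg v]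
    nlinarith [sq_nonneg (‖u - v‖ - ‖v‖)]
  have hlim := tendsto_integral_filter_of_dominated_convergence (μ := (volume : Measure E))
    (l := Filter.atTop)
    (F := fun n u => |stdGaussianDensity E (u - h n) - stdGaussianDensity E u|)
    (f := fun _ => 0)
    (fun u => 2 * (K * Real.exp 2⁻¹ * Real.exp (-4⁻¹ * ‖u‖ ^ 2)))
    (Filter.Eventually.of_forall fun n => by
      have := continuous_stdGaussianDensity (E := E)
      exact (by fun_prop : Continuous fun u =>
        |stdGaussianDensity E (u - h n) - stdGaussianDensity E u|).aestronglyMeasurable)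
    (by
      have h1 : ∀ᶠ n in Filter.atTop, ‖h n‖ ≤ 1 := by
        have := hh.norm
        rw [norm_zero] at this
        exact this.eventually (ge_mem_nhds one_pos)
      filter_upwards [h1] with n hn
      refine Filter.Eventually.of_forall fun u => ?_
      have h2 := hbound (h n) u hn
      have h3 := hbound 0 u (by simp)
      rw [sub_zero] at h3
      have h4 := stdGaussianDensity_pos (u - h n)
      have h5 := stdGaussianDensity_pos u
      rw [Real.norm_eq_abs, abs_abs, abs_le]
      constructor <;> linarith)
    (((integrable_exp_neg_mul_norm_sq (by norm_num)).const_mul _).const_mul _)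
    (Filter.Eventually.of_forall fun u => by
      have h1 : Filter.Tendsto (fun n => u - h n) Filter.atTop (nhds (u - 0)) := hh.const_sub u
      have h2 := (continuous_stdGaussianDensity.tendsto _).comp h1
      have h3 := (h2.sub_const (stdGaussianDensity E u)).abs
      simpa using h3)
  simpa using hlim

/-- A bounded function which is invariant under Gaussian averaging at arbitrarily large scales is
constant. -/
lemma eq_of_forall_eq_integral_stdGaussian {g : E → ℝ} (hg : Measurable g) {B : ℝ}
    (hB : ∀ x, |g x| ≤ B) {s : ℕ → ℝ} (hs : Filter.Tendsto s Filter.atTop Filter.atTop)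
    (h : ∀ n x, g x = ∫ u, g (x + s n • u) ∂stdGaussian E) (x y : E) : g x = g y := by
  have hh : Filter.Tendsto (fun n => (s n)⁻¹ • (x - y)) Filter.atTop (nhds 0) := by
    simpa using (tendsto_inv_atTop_zero.comp hs).smul_const (x - y)
  have hlim := (tendsto_integral_abs_stdGaussianDensity_sub hh).const_mul B
  rw [mul_zero] at hlim
  have hi : ∀ (v z : E) (r : ℝ),
      Integrable fun u => stdGaussianDensity E (u - v) * g (z + r • u) := fun v z r =>
    (integrable_stdGaussianDensity.comp_sub_right v).mul_bdd (c := B)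
      (by fun_prop : Measurable fun u => g (z + r • u)).aestronglyMeasurable
      (Filter.Eventually.of_forall fun u => hB _)
  have hle : ∀ᶠ n in Filter.atTop, |g x - g y| ≤ B * ∫ u, |stdGaussianDensity E
      (u - (s n)⁻¹ • (x - y)) - stdGaussianDensity E u| := by
    filter_upwards [hs.eventually_gt_atTop 0] with n hn
    set v := (s n)⁻¹ • (x - y) with hv
    have hx : g x = ∫ u, stdGaussianDensity E (u - v) * g (y + s n • u) := by
      rw [h n x, integral_stdGaussian_eq,
        ← integral_add_right_eq_self
          (fun u => stdGaussianDensity E (u - v) * g (y + s n • u)) v]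
      refine integral_congr_ae (Filter.Eventually.of_forall fun u => ?_)
      simp only [add_sub_cancel_right, hv, smul_add, smul_inv_smul₀ hn.ne']
      congr 2
      abel
    have hy : g y = ∫ u, stdGaussianDensity E u * g (y + s n • u) := by
      rw [h n y, integral_stdGaussian_eq]
    have hi0 := hi 0 y (s n)
    simp only [sub_zero] at hi0
    rw [hx, hy, ← integral_sub (hi v y (s n)) hi0, ← integral_const_mul]
    refine (abs_integral_le_integral_abs).trans (integral_mono
      ((hi v y (s n)).sub hi0).abs
      (((integrable_stdGaussianDensity.comp_sub_right v).sub
        integrable_stdGaussianDensity).abs.const_mul B) fun u => ?_)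
    simp only [← sub_mul, abs_mul]
    rw [mul_comm]
    exact mul_le_mul_of_nonneg_right (hB _) (abs_nonneg _)
  have := ge_of_tendsto hlim hle
  exact sub_eq_zero.1 (abs_eq_zero.1 (le_antisymm this (abs_nonneg _)))

end StdGaussian

/-- Even functions vanishing at the origin whose second differences lie between zero and those of
the function `x ↦ (M / 2) * ‖x‖ ^ 2`. -/
structure IsPotential {E : Type*} [NormedAddCommGroup E] (M : ℝ) (φ : E → ℝ) : Prop where
  even : ∀ x, φ (-x) = φ x
  zero : φ 0 = 0
  midpoint : ∀ x y, 2 * φ x ≤ φ (x + y) + φ (x - y)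
  upper : ∀ x y, φ (x + y) + φ (x - y) ≤ 2 * φ x + M * ‖y‖ ^ 2

/-- The functions `u ↦ φ ((v + u) / √2) + φ ((v - u) / √2)`, where `v` is a parameter. -/
def splitSum {E : Type*} [AddCommGroup E] [Module ℝ E] (φ : E → ℝ) (v u : E) : ℝ :=
  φ (κ • (v + u)) + φ (κ • (v - u))

/-- The function `splitSum φ v`, shifted to vanish at the origin. -/
def splitPotential {E : Type*} [AddCommGroup E] [Module ℝ E] (φ : E → ℝ) (v u : E) : ℝ :=
  splitSum φ v u - 2 * φ (κ • v)

namespace IsPotential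

section Basic

variable {E : Type*} [NormedAddCommGroup E] {M : ℝ} {φ ψ : E → ℝ}

lemma nonneg (h : IsPotential M φ) (x : E) : 0 ≤ φ x := by
  have := h.midpoint 0 x
  rw [zero_add, zero_sub, h.even, h.zero] at this
  linarith

lemma le (h : IsPotential M φ) (x : E) : φ x ≤ M / 2 * ‖x‖ ^ 2 := by
  have := h.upper 0 x
  rw [zero_add, zero_sub, h.even, h.zero] at this
  linarith

lemma add {M' : ℝ} (hφ : IsPotential M φ) (hψ : IsPotential M' ψ) :
    IsPotential (M + M') (φ + ψ) where
  even x := by simp [hφ.even, hψ.even]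
  zero := by simp [hφ.zero, hψ.zero]
  midpoint x y := by
    have := hφ.midpoint x y
    have := hψ.midpoint x y
    simp only [Pi.add_apply]; linarith
  upper x y := by
    have := hφ.upper x y
    have := hψ.upper x y
    simp only [Pi.add_apply]; linarith

lemma const_zero (hM : 0 ≤ M) : IsPotential M (0 : E → ℝ) where
  even x := rfl
  zero := rfl
  midpoint x y := by simp
  upper x y := by simp; positivity

variable [NormedSpace ℝ E]

lemma nonneg_const [Nontrivial E] (h : IsPotential M φ) : 0 ≤ M := by
  obtain ⟨x, hx⟩ := exists_norm_eq E (zero_le_one (α := ℝ))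
  have := (h.nonneg x).trans (h.le x)
  rw [hx] at this
  linarith

lemma sub_le_of_norm_le (h : IsPotential M φ) (hM : 0 ≤ M) (n : ℕ) (x y : E)
    (hy : 2 ^ n * ‖y‖ ≤ 1) : φ (x + y) - φ x ≤ (2 ^ n)⁻¹ * (M / 2 * (‖x‖ + 1) ^ 2) := by
  have key : 2 ^ n * (φ (x + y) - φ x) ≤ φ (x + (2 : ℝ) ^ n • y) - φ x := by
    clear hy
    induction n generalizing y with
    | zero => simp
    | succ n ih =>
      have h1 := ih ((2 : ℝ) • y)
      rw [smul_smul, ← pow_succ] at h1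
      have h2 := h.midpoint (x + y) y
      rw [add_sub_cancel_right, add_assoc, ← two_smul ℝ y] at h2
      have h3 : (0 : ℝ) < 2 ^ n := by positivity
      have h4 : 2 * (φ (x + y) - φ x) ≤ φ (x + (2 : ℝ) • y) - φ x := by linarith
      calc 2 ^ (n + 1) * (φ (x + y) - φ x) = 2 ^ n * (2 * (φ (x + y) - φ x)) := by ring
        _ ≤ 2 ^ n * (φ (x + (2 : ℝ) • y) - φ x) := by gcongr
        _ ≤ _ := h1
  have h1 := h.le (x + (2 : ℝ) ^ n • y)
  have h2 : ‖x + (2 : ℝ) ^ n • y‖ ≤ ‖x‖ + 1 := by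
    refine (norm_add_le _ _).trans ?_
    rw [norm_smul, norm_pow, Real.norm_ofNat]
    linarith
  have h3 : M / 2 * ‖x + (2 : ℝ) ^ n • y‖ ^ 2 ≤ M / 2 * (‖x‖ + 1) ^ 2 := by gcongr
  have h4 := h.nonneg x
  rw [inv_mul_eq_div, le_div_iff₀ (by positivity)]
  linarith

lemma continuous (h : IsPotential M φ) : Continuous φ := by
  rcases subsingleton_or_nontrivial E with hE | hE
  · exact continuous_of_const fun x y => by rw [Subsingleton.elim x y]
  have hM := h.nonneg_const
  rw [continuous_iff_continuousAt]
  intro x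
  rw [Metric.continuousAt_iff]
  intro ε hε
  have hlim : Filter.Tendsto (fun n : ℕ => ((2 : ℝ) ^ n)⁻¹ * (M / 2 * (‖x‖ + 1) ^ 2))
      Filter.atTop (nhds 0) := by
    have := (tendsto_pow_atTop_nhds_zero_of_lt_one (r := (2 : ℝ)⁻¹) (by norm_num)
      (by norm_num)).mul_const (M / 2 * (‖x‖ + 1) ^ 2)
    simpa using this
  obtain ⟨n, hn⟩ := (hlim.eventually (gt_mem_nhds hε)).exists
  refine ⟨(2 ^ n)⁻¹, by positivity, fun {y} hy => ?_⟩
  have h0 : 2 ^ n * ‖y - x‖ ≤ 1 := by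
    rw [← dist_eq_norm]
    have h3 : (0 : ℝ) < 2 ^ n := by positivity
    calc (2 : ℝ) ^ n * dist y x ≤ 2 ^ n * (2 ^ n)⁻¹ := by gcongr
      _ = 1 := mul_inv_cancel₀ h3.ne'
  have h1 := h.sub_le_of_norm_le hM n x (y - x) h0
  have h2 := h.sub_le_of_norm_le hM n x (-(y - x)) (by rwa [norm_neg])
  have h3 := h.midpoint x (y - x)
  rw [sub_eq_add_neg x (y - x)] at h3
  rw [add_sub_cancel] at h1 h3
  rw [Real.dist_eq, abs_lt]
  constructor <;> linarith

lemma splitPotential (h : IsPotential M φ) (v : E) :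
    IsPotential M (splitPotential φ v) where
  even u := by
    simp only [_root_.splitPotential, splitSum, sub_neg_eq_add, ← sub_eq_add_neg]
    ring
  zero := by simp [_root_.splitPotential, splitSum]; ring
  midpoint x y := by
    have h1 := h.midpoint (κ • (v + x)) (κ • y)
    have h2 := h.midpoint (κ • (v - x)) (κ • y)
    simp only [← smul_add, ← smul_sub] at h1 h2
    simp only [_root_.splitPotential, splitSum]
    rw [show v + (x + y) = v + x + y by abel, show v - (x + y) = v - x - y by abel,
      show v + (x - y) = v + x - y by abel, show v - (x - y) = v - x + y by abel]
    linarith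
  upper x y := by
    have h1 := h.upper (κ • (v + x)) (κ • y)
    have h2 := h.upper (κ • (v - x)) (κ • y)
    have h3 : ‖κ • y‖ ^ 2 = 2⁻¹ * ‖y‖ ^ 2 := by
      rw [norm_smul, Real.norm_of_nonneg inv_sqrt_two_pos.le, mul_pow, sq κ,
        inv_sqrt_two_mul_self]
    rw [h3] at h1 h2
    simp only [← smul_add, ← smul_sub] at h1 h2
    simp only [_root_.splitPotential, splitSum]
    rw [show v + (x + y) = v + x + y by abel, show v - (x + y) = v - x - y by abel,
      show v + (x - y) = v + x - y by abel, show v - (x - y) = v - x + y by abel]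
    linarith

end Basic

section Compact

variable {E : Type*} [NormedAddCommGroup E] [NormedSpace ℝ E] {M : ℝ}

instance : CompactSpace {φ : E → ℝ // IsPotential M φ} := by
  refine isCompact_iff_compactSpace.1 (?_ : IsCompact {φ : E → ℝ | IsPotential M φ})
  have h1 : IsCompact (Set.univ.pi fun x : E => Set.Icc 0 (M / 2 * ‖x‖ ^ 2)) :=
    isCompact_univ_pi fun x => isCompact_Icc
  refine h1.of_isClosed_subset ?_ fun φ hφ x _ => ⟨hφ.nonneg x, hφ.le x⟩
  have : {φ : E → ℝ | IsPotential M φ} = (⋂ x, {φ | φ (-x) = φ x}) ∩ {φ | φ 0 = 0} ∩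
      (⋂ x, ⋂ y, {φ | 2 * φ x ≤ φ (x + y) + φ (x - y)}) ∩
      (⋂ x, ⋂ y, {φ | φ (x + y) + φ (x - y) ≤ 2 * φ x + M * ‖y‖ ^ 2}) := by
    ext φ
    simp only [Set.mem_inter_iff, Set.mem_iInter, Set.mem_ofPred_eq]
    exact ⟨fun h => ⟨⟨⟨h.even, h.zero⟩, h.midpoint⟩, h.upper⟩,
      fun h => ⟨h.1.1.1, h.1.1.2, h.1.2, h.2⟩⟩
  rw [this]
  refine IsClosed.inter (IsClosed.inter (IsClosed.inter ?_ ?_) ?_) ?_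
  · exact isClosed_iInter fun x => isClosed_eq (by fun_prop) (by fun_prop)
  · exact isClosed_eq (by fun_prop) (by fun_prop)
  · exact isClosed_iInter fun x => isClosed_iInter fun y =>
      isClosed_le (by fun_prop) (by fun_prop)
  · exact isClosed_iInter fun x => isClosed_iInter fun y =>
      isClosed_le (by fun_prop) (by fun_prop)

instance [TopologicalSpace.SeparableSpace E] :
    FirstCountableTopology {φ : E → ℝ // IsPotential M φ} := by
  obtain ⟨D, hD, hDd⟩ := TopologicalSpace.exists_countable_dense E
  have : Countable D := hD.to_subtype
  let r : {φ : E → ℝ // IsPotential M φ} → (D → ℝ) := fun φ x => φ.1 x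
  have hr : Continuous r := by
    refine continuous_pi fun x => ?_
    exact (continuous_apply (x : E)).comp continuous_subtype_val
  have hinj : Function.Injective r := by
    intro φ ψ h
    refine Subtype.ext (φ.2.continuous.ext_on hDd ψ.2.continuous fun x hx => ?_)
    exact congrFun h ⟨x, hx⟩
  exact (hr.isClosedEmbedding hinj).isInducing.firstCountableTopology

end Compact

end IsPotential

section Functional

variable {E : Type*} [NormedAddCommGroup E] [InnerProductSpace ℝ E] [FiniteDimensional ℝ E]
  [MeasurableSpace E] [BorelSpace E] {M : ℝ} {φ ψ : E → ℝ}

/-- The Gaussian integral of `exp (-φ)`. -/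
def gaussianPartition (φ : E → ℝ) : ℝ := ∫ u, Real.exp (-φ u) ∂stdGaussian E

/-- The function `v ↦ ∫ exp (-φ ((v + u) / √2) - φ ((v - u) / √2))`, integrated over `u`. -/
def splitPartition (φ : E → ℝ) (v : E) : ℝ := gaussianPartition (splitSum φ v)

omit [FiniteDimensional ℝ E] [MeasurableSpace E] [BorelSpace E] in
lemma Continuous.splitSum (hφ : Continuous φ) : Continuous fun p : E × E => splitSum φ p.1 p.2 := by
  unfold _root_.splitSum; fun_prop

omit [FiniteDimensional ℝ E] [MeasurableSpace E] [BorelSpace E] in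
lemma IsPotential.splitSum_nonneg (hφ : IsPotential M φ) (v u : E) : 0 ≤ splitSum φ v u :=
  add_nonneg (hφ.nonneg _) (hφ.nonneg _)

lemma integrable_exp_neg_of_nonneg {X : Type*} [MeasurableSpace X] {μ : Measure X}
    [IsFiniteMeasure μ] {φ : X → ℝ} (hφ : Measurable φ) (h0 : ∀ x, 0 ≤ φ x) :
    Integrable (fun u => Real.exp (-φ u)) μ := by
  refine Integrable.of_bound (C := 1) (by fun_prop)
    (Filter.Eventually.of_forall fun u => ?_)
  rw [Real.norm_of_nonneg (Real.exp_pos _).le, Real.exp_le_one_iff]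
  linarith [h0 u]

lemma gaussianPartition_pos (hφ : Measurable φ) (h0 : ∀ x, 0 ≤ φ x) : 0 < gaussianPartition φ :=
  integral_exp_pos (integrable_exp_neg_of_nonneg hφ h0)

lemma continuous_gaussianPartition_of_continuous {X : Type*} [TopologicalSpace X]
    [FirstCountableTopology X] {F : X → E → ℝ} (h1 : ∀ x, Measurable (F x))
    (h2 : ∀ u, Continuous fun x => F x u) (h0 : ∀ x u, 0 ≤ F x u) :
    Continuous fun x => gaussianPartition (F x) := by
  refine continuous_of_dominated (bound := fun _ => 1) (fun x => ?_) (fun x => ?_)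
    (integrable_const _) (Filter.Eventually.of_forall fun u => ?_)
  · exact ((h1 x).neg.exp).aestronglyMeasurable
  · refine Filter.Eventually.of_forall fun u => ?_
    rw [Real.norm_of_nonneg (Real.exp_pos _).le, Real.exp_le_one_iff]
    linarith [h0 x u]
  · exact (h2 u).neg.rexp

lemma IsPotential.gaussianPartition_pos (hφ : IsPotential M φ) : 0 < gaussianPartition φ :=
  _root_.gaussianPartition_pos hφ.continuous.measurable hφ.nonneg

omit [FiniteDimensional ℝ E] in
lemma IsPotential.measurable_splitSum (hφ : IsPotential M φ) (v : E) :
    Measurable (splitSum φ v) :=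
  (hφ.continuous.splitSum.comp (by fun_prop : Continuous fun u : E => (v, u))).measurable

lemma IsPotential.splitPartition_pos (hφ : IsPotential M φ) (v : E) : 0 < splitPartition φ v :=
  _root_.gaussianPartition_pos (hφ.measurable_splitSum v) (hφ.splitSum_nonneg v)

lemma IsPotential.continuous_splitPartition (hφ : IsPotential M φ) :
    Continuous (splitPartition φ) :=
  continuous_gaussianPartition_of_continuous hφ.measurable_splitSum
    (fun u => hφ.continuous.splitSum.comp (by fun_prop : Continuous fun v : E => (v, u)))
    hφ.splitSum_nonneg

lemma IsPotential.splitPartition_le_one (hφ : IsPotential M φ) (v : E) :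
    splitPartition φ v ≤ 1 := by
  have := integral_mono (μ := stdGaussian E)
    (integrable_exp_neg_of_nonneg (hφ.measurable_splitSum v) (hφ.splitSum_nonneg v))
    (integrable_const (1 : ℝ)) fun u => by
      rw [Real.exp_le_one_iff]
      linarith [hφ.splitSum_nonneg v u]
  simpa [splitPartition, gaussianPartition] using this

omit [BorelSpace E] in
lemma splitPartition_eq_mul (φ : E → ℝ) (v : E) : splitPartition φ v
    = Real.exp (-(2 * φ (κ • v))) * gaussianPartition (splitPotential φ v) := by
  simp only [splitPartition, gaussianPartition, splitPotential]
  rw [← integral_const_mul]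
  congr 1 with u
  rw [← Real.exp_add]
  ring_nf

lemma IsPotential.integral_splitPartition (hφ : IsPotential M φ) :
    ∫ v, splitPartition φ v ∂stdGaussian E = gaussianPartition φ ^ 2 := by
  have hc := hφ.continuous
  have h1 : Integrable (fun p : E × E => Real.exp (-splitSum φ p.1 p.2))
      ((stdGaussian E).prod (stdGaussian E)) :=
    integrable_exp_neg_of_nonneg hc.splitSum.measurable fun p => hφ.splitSum_nonneg _ _
  have h2 : ∀ v : E, splitPartition φ v = ∫ u, Real.exp (-splitSum φ v u) ∂stdGaussian E :=
    fun v => rfl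
  simp_rw [h2]
  rw [integral_integral (f := fun v u : E => Real.exp (-splitSum φ v u)) h1, sq,
    gaussianPartition, ← integral_prod_mul]
  have h3 := (measurePreserving_rotation_stdGaussian (E := E))
  rw [← h3.map_eq, integral_map h3.measurable.aemeasurable, h3.map_eq]
  · congr 1 with p
    simp only
    have e1 : κ • (κ • (p.1 + p.2) + κ • (p.2 - p.1)) = p.2 := by
      rw [← smul_add, smul_smul, inv_sqrt_two_mul_self]; module
    have e2 : κ • (κ • (p.1 + p.2) - κ • (p.2 - p.1)) = p.1 := by
      rw [← smul_sub, smul_smul, inv_sqrt_two_mul_self]; module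
    rw [← Real.exp_add, splitSum, e1, e2]
    ring_nf
  · exact hc.splitSum.neg.rexp.aestronglyMeasurable

lemma IsPotential.splitPartition_mul_le_sq (hφ : IsPotential M φ) (v w : E) :
    splitPartition φ (v + w) * splitPartition φ (v - w) ≤ splitPartition φ v ^ 2 := by
  have hm := hφ.measurable_splitSum
  have h := satisfiesPrekopaLeindler_stdGaussian E
    (fun u => ENNReal.ofReal (Real.exp (-splitSum φ (v + w) u)))
    (fun u => ENNReal.ofReal (Real.exp (-splitSum φ (v - w) u)))
    (fun u => ENNReal.ofReal (Real.exp (-splitSum φ v u)))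
    ((hm _).neg.exp.ennreal_ofReal) ((hm _).neg.exp.ennreal_ofReal)
    ((hm _).neg.exp.ennreal_ofReal)
    (fun u => by
      rw [← ENNReal.ofReal_one]
      exact ENNReal.ofReal_le_ofReal
          (Real.exp_le_one_iff.2 (neg_nonpos.2 (hφ.splitSum_nonneg _ u))))
    (fun u => by
      rw [← ENNReal.ofReal_one]
      exact ENNReal.ofReal_le_ofReal
          (Real.exp_le_one_iff.2 (neg_nonpos.2 (hφ.splitSum_nonneg _ u))))
    (fun x y => by
      rw [← ENNReal.ofReal_mul (Real.exp_pos _).le, ← ENNReal.ofReal_pow (Real.exp_pos _).le,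
        ← Real.exp_add, ← Real.exp_nat_mul]
      refine ENNReal.ofReal_le_ofReal (Real.exp_le_exp.2 ?_)
      have h1 := hφ.midpoint (κ • (v + (2⁻¹ : ℝ) • (x + y))) (κ • (w + (2⁻¹ : ℝ) • (x - y)))
      have h2 := hφ.midpoint (κ • (v - (2⁻¹ : ℝ) • (x + y))) (κ • (w - (2⁻¹ : ℝ) • (x - y)))
      simp only [← smul_add, ← smul_sub] at h1 h2
      have e1 : v + (2⁻¹ : ℝ) • (x + y) + (w + (2⁻¹ : ℝ) • (x - y)) = v + w + x := by module
      have e2 : v + (2⁻¹ : ℝ) • (x + y) - (w + (2⁻¹ : ℝ) • (x - y)) = v - w + y := by module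
      have e3 : v - (2⁻¹ : ℝ) • (x + y) + (w - (2⁻¹ : ℝ) • (x - y)) = v + w - x := by module
      have e4 : v - (2⁻¹ : ℝ) • (x + y) - (w - (2⁻¹ : ℝ) • (x - y)) = v - w - y := by module
      rw [e1, e2] at h1
      rw [e3, e4] at h2
      simp only [splitSum]
      push_cast
      linarith)
  have hp : ∀ v, ∫⁻ u, ENNReal.ofReal (Real.exp (-splitSum φ v u)) ∂stdGaussian E
      = ENNReal.ofReal (splitPartition φ v) := fun v =>
    (ofReal_integral_eq_lintegral_ofReal
      (integrable_exp_neg_of_nonneg (hm v) (hφ.splitSum_nonneg v))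
      (Filter.Eventually.of_forall fun u => (Real.exp_pos _).le)).symm
  rw [hp, hp, hp, ← ENNReal.ofReal_mul (hφ.splitPartition_pos _).le,
    ← ENNReal.ofReal_pow (hφ.splitPartition_pos _).le] at h
  exact (ENNReal.ofReal_le_ofReal_iff (by positivity)).1 h

lemma sq_integral_mul_le {X : Type*} [MeasurableSpace X] {μ : Measure X}
    {f g : X → ℝ} (hf : MemLp f 2 μ) (hg : MemLp g 2 μ) (hf0 : ∀ x, 0 ≤ f x)
    (hg0 : ∀ x, 0 ≤ g x) :
    (∫ x, f x * g x ∂μ) ^ 2 ≤ (∫ x, f x ^ 2 ∂μ) * ∫ x, g x ^ 2 ∂μ := by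
  have h := integral_mul_le_Lp_mul_Lq_of_nonneg (μ := μ) Real.HolderConjugate.two_two
    (Filter.Eventually.of_forall hf0) (Filter.Eventually.of_forall hg0)
    (by simpa using hf) (by simpa using hg)
  have hi : 0 ≤ ∫ x, f x * g x ∂μ := integral_nonneg fun x => mul_nonneg (hf0 x) (hg0 x)
  have h1 : 0 ≤ ∫ x, f x ^ 2 ∂μ := integral_nonneg fun x => sq_nonneg _
  have h2 : 0 ≤ ∫ x, g x ^ 2 ∂μ := integral_nonneg fun x => sq_nonneg _
  simp only [Real.rpow_ofNat, ← Real.sqrt_eq_rpow] at h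
  calc _ ≤ (√(∫ x, f x ^ 2 ∂μ) * √(∫ x, g x ^ 2 ∂μ)) ^ 2 := by gcongr
    _ = _ := by rw [mul_pow, Real.sq_sqrt h1, Real.sq_sqrt h2]

lemma IsPotential.sq_splitPartition_le (hφ : IsPotential M φ) (v w : E) :
    splitPartition φ v ^ 2
      ≤ splitPartition φ (v + w) * splitPartition φ (v - w) * Real.exp (M * ‖w‖ ^ 2) := by
  have hm := hφ.measurable_splitSum
  have hint : ∀ v, Integrable (fun u => Real.exp (-splitSum φ v u)) (stdGaussian E) := fun v =>
    integrable_exp_neg_of_nonneg (hm v) (hφ.splitSum_nonneg v)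
  let r : E → E → ℝ := fun v u => Real.exp (-(splitSum φ v u / 2))
  have hr2 : ∀ v u, r v u ^ 2 = Real.exp (-splitSum φ v u) := fun v u => by
    rw [← Real.exp_nat_mul]; push_cast; ring_nf
  have hr : ∀ v, MemLp (r v) 2 (stdGaussian E) := fun v => by
    have h1 : Measurable (r v) := ((hm v).div_const 2).neg.exp
    rw [memLp_two_iff_integrable_sq h1.aestronglyMeasurable]
    simp_rw [hr2]
    exact hint v
  have hcs := sq_integral_mul_le (hr (v + w)) (hr (v - w)) (fun u => (Real.exp_pos _).le)
    (fun u => (Real.exp_pos _).le)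
  simp_rw [hr2] at hcs
  have hle : splitPartition φ v
      ≤ (∫ u, r (v + w) u * r (v - w) u ∂stdGaussian E) * Real.exp (M * ‖w‖ ^ 2 / 2) := by
    rw [← integral_mul_const]
    refine integral_mono (hint v) (((hr (v + w)).integrable_mul (hr (v - w))).mul_const _)
      fun u => ?_
    simp only [r]
    rw [← Real.exp_add, ← Real.exp_add]
    refine Real.exp_le_exp.2 ?_
    have h1 := hφ.upper (κ • (v + u)) (κ • w)
    have h2 := hφ.upper (κ • (v - u)) (κ • w)
    have h3 : ‖κ • w‖ ^ 2 = 2⁻¹ * ‖w‖ ^ 2 := by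
      rw [norm_smul, Real.norm_of_nonneg inv_sqrt_two_pos.le, mul_pow, sq κ,
        inv_sqrt_two_mul_self]
    rw [h3] at h1 h2
    simp only [← smul_add, ← smul_sub] at h1 h2
    simp only [splitSum]
    rw [show v + w + u = v + u + w by abel, show v + w - u = v - u + w by abel,
      show v - w + u = v + u - w by abel, show v - w - u = v - u - w by abel]
    linarith
  calc splitPartition φ v ^ 2
      ≤ ((∫ u, r (v + w) u * r (v - w) u ∂stdGaussian E) * Real.exp (M * ‖w‖ ^ 2 / 2)) ^ 2 :=
        pow_le_pow_left₀ (hφ.splitPartition_pos v).le hle 2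
    _ = (∫ u, r (v + w) u * r (v - w) u ∂stdGaussian E) ^ 2 * Real.exp (M * ‖w‖ ^ 2) := by
        rw [mul_pow, ← Real.exp_nat_mul]; push_cast; ring_nf
    _ ≤ _ := mul_le_mul_of_nonneg_right hcs (Real.exp_pos _).le

/-- Up to a multiplicative constant, `splitPartition φ` is `exp` of minus a potential. -/
lemma IsPotential.log_splitPartition (hφ : IsPotential M φ) :
    IsPotential M fun v => Real.log (splitPartition φ 0) - Real.log (splitPartition φ v) where
  even v := by
    have : splitPartition φ (-v) = splitPartition φ v := by
      unfold splitPartition splitSum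
      congr 1 with u
      rw [show -v + u = -(v - u) by abel, show -v - u = -(v + u) by abel, smul_neg, smul_neg,
        hφ.even, hφ.even, add_comm]
    rw [this]
  zero := sub_self _
  midpoint v w := by
    have h := Real.log_le_log (mul_pos (hφ.splitPartition_pos _) (hφ.splitPartition_pos _))
      (hφ.splitPartition_mul_le_sq v w)
    rw [Real.log_mul (hφ.splitPartition_pos _).ne' (hφ.splitPartition_pos _).ne',
      Real.log_pow] at h
    push_cast at h
    linarith
  upper v w := by
    have h := Real.log_le_log (pow_pos (hφ.splitPartition_pos _) 2)
      (hφ.sq_splitPartition_le v w)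
    rw [Real.log_mul (mul_pos (hφ.splitPartition_pos _) (hφ.splitPartition_pos _)).ne'
      (Real.exp_pos _).ne',
      Real.log_mul (hφ.splitPartition_pos _).ne' (hφ.splitPartition_pos _).ne',
      Real.log_pow, Real.log_exp] at h
    push_cast at h
    linarith

end Functional

section Minimizer

variable {E : Type*} [NormedAddCommGroup E] [InnerProductSpace ℝ E] [FiniteDimensional ℝ E]
  [MeasurableSpace E] [BorelSpace E] {M : ℝ} {φ ψ : E → ℝ}

lemma Continuous.eq_zero_of_integral_stdGaussian_nonpos {f : E → ℝ} (hf : Continuous f)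
    (h0 : ∀ x, 0 ≤ f x) (hi : Integrable f (stdGaussian E))
    (h : ∫ x, f x ∂stdGaussian E ≤ 0) (x : E) : f x = 0 := by
  have h1 := (integral_eq_zero_iff_of_nonneg h0 hi).1 (le_antisymm h (integral_nonneg h0))
  exact congrFun ((hf.ae_eq_iff_eq (stdGaussian E) continuous_const).1 h1) x

omit [BorelSpace E] in
lemma splitPartition_add_eq_mul (φ ψ : E → ℝ) (v : E) : splitPartition (φ + ψ) v
    = Real.exp (-(2 * φ (κ • v))) * Real.exp (-(2 * ψ (κ • v))) *
      gaussianPartition (splitPotential φ v + splitPotential ψ v) := by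
  rw [splitPartition_eq_mul, ← Real.exp_add]
  congr 2
  · simp only [Pi.add_apply]; ring
  · ext u
    simp only [splitPotential, splitSum, Pi.add_apply]; ring

/-- If a pair of potentials is extremal for the correlation inequality with constant `r`, then so
are the pairs obtained by splitting. -/
lemma partition_splitPotential_eq {r : ℝ} (hr0 : 0 ≤ r)
    (hr : ∀ φ ψ : E → ℝ, IsPotential M φ → IsPotential M ψ →
      r * gaussianPartition φ * gaussianPartition ψ ≤ gaussianPartition (φ + ψ))
    (hφ : IsPotential M φ) (hψ : IsPotential M ψ)
    (heq : gaussianPartition (φ + ψ) = r * gaussianPartition φ * gaussianPartition ψ) (v : E) :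
    gaussianPartition (splitPotential φ v + splitPotential ψ v)
      = r * gaussianPartition (splitPotential φ v) * gaussianPartition (splitPotential ψ v) := by
  have hφψ := hφ.add hψ
  have hi : ∀ {N : ℝ} {χ : E → ℝ}, IsPotential N χ →
      Integrable (splitPartition χ) (stdGaussian E) := fun h =>
    Integrable.of_bound h.continuous_splitPartition.aestronglyMeasurable 1
      (Filter.Eventually.of_forall fun v => by
        rw [Real.norm_of_nonneg (h.splitPartition_pos v).le]
        exact h.splitPartition_le_one v)
  have hi2 : Integrable (fun v => splitPartition φ v * splitPartition ψ v) (stdGaussian E) :=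
    (hi hφ).mul_bdd (c := 1) hψ.continuous_splitPartition.aestronglyMeasurable
      (Filter.Eventually.of_forall fun v => by
        rw [Real.norm_of_nonneg (hψ.splitPartition_pos v).le]
        exact hψ.splitPartition_le_one v)
  have hle : ∀ v, r * (splitPartition φ v * splitPartition ψ v) ≤ splitPartition (φ + ψ) v := by
    intro v
    rw [splitPartition_add_eq_mul, splitPartition_eq_mul φ, splitPartition_eq_mul ψ]
    have h1 := mul_le_mul_of_nonneg_left (hr _ _ (hφ.splitPotential v) (hψ.splitPotential v))
      (mul_pos (Real.exp_pos (-(2 * φ (κ • v)))) (Real.exp_pos (-(2 * ψ (κ • v))))).le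
    linarith
  have hlog : ∀ {χ : E → ℝ} (h : IsPotential M χ) (v : E),
      Real.exp (-(Real.log (splitPartition χ 0) - Real.log (splitPartition χ v)))
        = (splitPartition χ 0)⁻¹ * splitPartition χ v := fun h v => by
    rw [neg_sub, Real.exp_sub, Real.exp_log (h.splitPartition_pos v),
      Real.exp_log (h.splitPartition_pos 0), div_eq_inv_mul]
  have hint : r * (gaussianPartition φ ^ 2 * gaussianPartition ψ ^ 2)
      ≤ ∫ v, splitPartition φ v * splitPartition ψ v ∂stdGaussian E := by
    have h1 := hr _ _ hφ.log_splitPartition hψ.log_splitPartition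
    have h2 : gaussianPartition ((fun v => Real.log (splitPartition φ 0)
          - Real.log (splitPartition φ v)) +
        fun v => Real.log (splitPartition ψ 0) - Real.log (splitPartition ψ v))
        = (splitPartition φ 0)⁻¹ * (splitPartition ψ 0)⁻¹ *
          ∫ v, splitPartition φ v * splitPartition ψ v ∂stdGaussian E := by
      rw [gaussianPartition, ← integral_const_mul]
      congr 1 with v
      rw [Pi.add_apply, neg_add, Real.exp_add, hlog hφ, hlog hψ]
      ring
    rw [h2] at h1
    simp only [gaussianPartition] at h1
    simp_rw [hlog hφ, hlog hψ] at h1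
    rw [integral_const_mul, integral_const_mul, hφ.integral_splitPartition,
      hψ.integral_splitPartition] at h1
    have ha := hφ.splitPartition_pos 0
    have hb := hψ.splitPartition_pos 0
    have hc : 0 < (splitPartition φ 0)⁻¹ * (splitPartition ψ 0)⁻¹ := by positivity
    refine le_of_mul_le_mul_left ?_ hc
    linarith
  have hzero := Continuous.eq_zero_of_integral_stdGaussian_nonpos
    (f := fun v => splitPartition (φ + ψ) v - r * (splitPartition φ v * splitPartition ψ v))
    (hφψ.continuous_splitPartition.sub
      ((hφ.continuous_splitPartition.mul hψ.continuous_splitPartition).const_mul r))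
    (fun v => sub_nonneg.2 (hle v)) ((hi hφψ).sub (hi2.const_mul r))
    (by
      rw [integral_sub (hi hφψ) (hi2.const_mul r), integral_const_mul,
        hφψ.integral_splitPartition, heq]
      have := mul_le_mul_of_nonneg_left hint hr0
      linarith) v
  simp only [splitPartition_add_eq_mul, splitPartition_eq_mul φ, splitPartition_eq_mul ψ] at hzero
  have hc := mul_pos (Real.exp_pos (-(2 * φ (κ • v)))) (Real.exp_pos (-(2 * ψ (κ • v))))
  refine mul_left_cancel₀ hc.ne' ?_
  linarith

lemma IsPotential.integrable (hφ : IsPotential M φ) : Integrable φ (stdGaussian E) :=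
  (integrable_norm_sq_stdGaussian.const_mul (M / 2)).mono'
    hφ.continuous.aestronglyMeasurable (Filter.Eventually.of_forall fun x => by
      rw [Real.norm_of_nonneg (hφ.nonneg x)]; exact hφ.le x)

lemma continuous_integral_of_isPotential {X : Type*} [TopologicalSpace X]
    [FirstCountableTopology X] {F : X → E → ℝ} (h1 : ∀ x, IsPotential M (F x))
    (h2 : ∀ u, Continuous fun x => F x u) :
    Continuous fun x => ∫ u, F x u ∂stdGaussian E :=
  continuous_of_dominated (fun x => (h1 x).continuous.aestronglyMeasurable)
    (fun x => Filter.Eventually.of_forall fun u => by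
      rw [Real.norm_of_nonneg ((h1 x).nonneg u)]; exact (h1 x).le u)
    (integrable_norm_sq_stdGaussian.const_mul (M / 2)) (Filter.Eventually.of_forall h2)

lemma IsPotential.integrable_comp_smul_add (hφ : IsPotential M φ) (a b : ℝ) (v : E) :
    Integrable (fun u => φ (a • v + b • u)) (stdGaussian E) := by
  rcases subsingleton_or_nontrivial E with hE | hE
  · have : (fun u => φ (a • v + b • u)) = fun _ => φ 0 := by
      ext u; rw [Subsingleton.elim (a • v + b • u) 0]
    rw [this]; exact integrable_const _
  have hM := hφ.nonneg_const
  have hc := hφ.continuous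
  refine ((integrable_const (M * ‖a • v‖ ^ 2)).add
    (integrable_norm_sq_stdGaussian.const_mul (M * b ^ 2))).mono'
    (by fun_prop : Continuous fun u => φ (a • v + b • u)).aestronglyMeasurable
    (Filter.Eventually.of_forall fun u => ?_)
  rw [Real.norm_of_nonneg (hφ.nonneg _)]
  have h1 := hφ.upper (a • v) (b • u)
  have h2 := hφ.nonneg (a • v - b • u)
  have h3 := hφ.le (a • v)
  rw [norm_smul b u, mul_pow, Real.norm_eq_abs, sq_abs, ← mul_assoc] at h1
  simp only [Pi.add_apply]
  linarith

/-- Among the extremal pairs there is one for which Gaussian averages of the first potential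
differ from the potential by a constant. -/
lemma exists_extremal_isPotential (E : Type*) [NormedAddCommGroup E] [InnerProductSpace ℝ E]
    [FiniteDimensional ℝ E] [MeasurableSpace E] [BorelSpace E] (hM : 0 ≤ M) :
    ∃ (r C : ℝ) (φ ψ : E → ℝ), IsPotential M φ ∧ IsPotential M ψ ∧
      gaussianPartition (φ + ψ) = r * gaussianPartition φ * gaussianPartition ψ ∧
      (∀ φ ψ : E → ℝ, IsPotential M φ → IsPotential M ψ →
        r * gaussianPartition φ * gaussianPartition ψ ≤ gaussianPartition (φ + ψ)) ∧
      ∀ x, ∫ u, φ (x + κ • u) ∂stdGaussian E = φ x + C := by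
  let K := {φ : E → ℝ // IsPotential M φ}
  have : Nonempty K := ⟨⟨0, .const_zero hM⟩⟩
  have heval : ∀ u : E, Continuous fun p : K => p.1 u := fun u =>
    (continuous_apply u).comp continuous_subtype_val
  have hI : Continuous fun p : K => gaussianPartition p.1 :=
    continuous_gaussianPartition_of_continuous (fun p => p.2.continuous.measurable) heval
      fun p => p.2.nonneg
  have hJ : Continuous fun p : K × K => gaussianPartition (p.1.1 + p.2.1) :=
    continuous_gaussianPartition_of_continuous (fun p => (p.1.2.add p.2.2).continuous.measurable)
      (fun u => ((heval u).comp continuous_fst).add ((heval u).comp continuous_snd))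
      fun p => (p.1.2.add p.2.2).nonneg
  have hpos : ∀ p : K × K, 0 < gaussianPartition p.1.1 * gaussianPartition p.2.1 := fun p =>
    mul_pos p.1.2.gaussianPartition_pos p.2.2.gaussianPartition_pos
  let F : K × K → ℝ := fun p =>
    gaussianPartition (p.1.1 + p.2.1) / (gaussianPartition p.1.1 * gaussianPartition p.2.1)
  have hF : Continuous F :=
    hJ.div ((hI.comp continuous_fst).mul (hI.comp continuous_snd)) fun p => (hpos p).ne'
  obtain ⟨p₀, -, hp₀⟩ := isCompact_univ.exists_isMinOn Set.univ_nonempty hF.continuousOn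
  set r := F p₀ with hr
  have hr0 : 0 ≤ r :=
    div_nonneg (p₀.1.2.add p₀.2.2).gaussianPartition_pos.le (hpos p₀).le
  have hmin : ∀ φ ψ : E → ℝ, IsPotential M φ → IsPotential M ψ →
      r * gaussianPartition φ * gaussianPartition ψ ≤ gaussianPartition (φ + ψ) := by
    intro φ ψ hφ hψ
    have h1 : r ≤ F (⟨φ, hφ⟩, ⟨ψ, hψ⟩) := hp₀ (Set.mem_univ _)
    have h2 := (le_div_iff₀ (hpos (⟨φ, hφ⟩, ⟨ψ, hψ⟩))).1 h1
    simpa only [mul_assoc] using h2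
  have hFr : ∀ p : K × K, F p = r ↔ gaussianPartition (p.1.1 + p.2.1)
      = r * gaussianPartition p.1.1 * gaussianPartition p.2.1 := fun p => by
    rw [div_eq_iff (hpos p).ne', mul_assoc]
  have hcpt : IsCompact {p : K × K | F p = r} :=
    (isClosed_eq hF continuous_const).isCompact
  have hA : Continuous fun p : K => ∫ u, p.1 u ∂stdGaussian E :=
    continuous_integral_of_isPotential (fun p => p.2) heval
  obtain ⟨⟨⟨φ, hφ⟩, ⟨ψ, hψ⟩⟩, hp, hmax⟩ := hcpt.exists_isMaxOn ⟨p₀, hr.symm⟩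
    (hA.comp continuous_fst).continuousOn
  have heq := (hFr _).1 hp
  simp only at heq
  have hle : ∀ v, ∫ u, splitPotential φ v u ∂stdGaussian E ≤ ∫ u, φ u ∂stdGaussian E := by
    intro v
    have h1 : (⟨⟨splitPotential φ v, hφ.splitPotential v⟩,
        ⟨splitPotential ψ v, hψ.splitPotential v⟩⟩ : K × K) ∈ {p : K × K | F p = r} :=
      (hFr _).2 (partition_splitPotential_eq hr0 hmin hφ hψ heq v)
    exact hmax h1
  have hc := hφ.continuous
  have hsc : ∀ u, Continuous fun v => splitPotential φ v u := fun u => by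
    unfold splitPotential splitSum; fun_prop
  set A := ∫ u, φ u ∂stdGaussian E with hA_def
  have hi1 : ∀ (v : E), Integrable (fun u => φ (κ • (v + u))) (stdGaussian E) := fun v => by
    simpa only [smul_add] using hφ.integrable_comp_smul_add κ κ v
  have hneg : ∀ g : E → ℝ, ∫ u, g (-u) ∂stdGaussian E = ∫ u, g u ∂stdGaussian E := fun g =>
    measurePreserving_neg_stdGaussian.integral_comp
      (Homeomorph.neg E).measurableEmbedding g
  have hi2 : ∀ (v : E), Integrable (fun u => φ (κ • (v - u))) (stdGaussian E) := fun v => by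
    simpa only [sub_eq_add_neg, smul_add, smul_neg, neg_smul] using
      hφ.integrable_comp_smul_add κ (-κ) v
  have hval : ∀ v, ∫ u, splitPotential φ v u ∂stdGaussian E
      = 2 * ∫ u, φ (κ • v + κ • u) ∂stdGaussian E - 2 * φ (κ • v) := by
    intro v
    simp only [splitPotential, splitSum]
    rw [integral_sub (f := fun u => φ (κ • (v + u)) + φ (κ • (v - u))) ((hi1 v).add (hi2 v))
      (integrable_const _), integral_add (hi1 v) (hi2 v),
      ← hneg fun u => φ (κ • (v - u))]
    simp only [sub_neg_eq_add, integral_const, probReal_univ, one_smul, smul_add]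
    ring
  have hmean : ∫ v, ∫ u, φ (κ • v + κ • u) ∂stdGaussian E ∂stdGaussian E = A := by
    have h3 := measurePreserving_inv_sqrt_two_smul_add_stdGaussian (E := E)
    have h4 : Integrable (fun p : E × E => φ (κ • (p.1 + p.2)))
        ((stdGaussian E).prod (stdGaussian E)) := h3.integrable_comp_of_integrable hφ.integrable
    simp only [← smul_add]
    rw [integral_integral (f := fun v u : E => φ (κ • (v + u))) h4, hA_def]
    conv_rhs => rw [← h3.map_eq]
    rw [integral_map h3.measurable.aemeasurable hc.aestronglyMeasurable]
  have hi3 : Integrable (fun v => ∫ u, φ (κ • v + κ • u) ∂stdGaussian E) (stdGaussian E) := by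
    have h3 := measurePreserving_inv_sqrt_two_smul_add_stdGaussian (E := E)
    have h4 : Integrable (fun p : E × E => φ (κ • (p.1 + p.2)))
        ((stdGaussian E).prod (stdGaussian E)) := h3.integrable_comp_of_integrable hφ.integrable
    simpa only [← smul_add] using h4.integral_prod_left
  have hi4 : Integrable (fun v => φ (κ • v)) (stdGaussian E) := by
    simpa using hφ.integrable_comp_smul_add 0 κ 0
  have hi5 : Integrable (fun v => 2 * ∫ u, φ (κ • v + κ • u) ∂stdGaussian E - 2 * φ (κ • v))
      (stdGaussian E) := (hi3.const_mul 2).sub (hi4.const_mul 2)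
  have hle0 : 2 * ∫ u, φ (κ • u) ∂stdGaussian E ≤ A := by
    have h1 := hle 0
    rw [hval 0] at h1
    simpa [hφ.zero] using h1
  have hzero := Continuous.eq_zero_of_integral_stdGaussian_nonpos
    (f := fun v => A - ∫ u, splitPotential φ v u ∂stdGaussian E)
    (continuous_const.sub
      (continuous_integral_of_isPotential (fun v => hφ.splitPotential v) hsc))
    (fun v => sub_nonneg.2 (hle v))
    (by
      simp only [hval]
      exact (integrable_const _).sub hi5)
    (by
      simp only [hval]
      rw [integral_sub (integrable_const _) hi5,
        integral_sub (hi3.const_mul 2) (hi4.const_mul 2), integral_const_mul, integral_const_mul,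
        hmean]
      simp only [integral_const, probReal_univ, one_smul]
      linarith)
  refine ⟨r, A / 2, φ, ψ, hφ, hψ, heq, hmin, fun x => ?_⟩
  have h1 := hzero (√2 • x)
  simp only [hval, smul_smul] at h1
  rw [inv_mul_cancel₀ (by positivity), one_smul] at h1
  linarith

end Minimizer

section Quadratic

variable {E : Type*} [NormedAddCommGroup E] [InnerProductSpace ℝ E] [FiniteDimensional ℝ E]
  [MeasurableSpace E] [BorelSpace E] {M : ℝ} {φ ψ : E → ℝ}

lemma eq_integral_stdGaussian_mul_sqrt_two {g : E → ℝ} (hg : Continuous g) {B : ℝ}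
    (hB : ∀ x, |g x| ≤ B) {s : ℝ} (h : ∀ x, g x = ∫ u, g (x + s • u) ∂stdGaussian E) (x : E) :
    g x = ∫ u, g (x + (s * √2) • u) ∂stdGaussian E := by
  have h3 := measurePreserving_inv_sqrt_two_smul_add_stdGaussian (E := E)
  conv_rhs => rw [← h3.map_eq]
  rw [integral_map h3.measurable.aemeasurable
    (by fun_prop : Continuous fun u => g (x + (s * √2) • u)).aestronglyMeasurable, h x]
  have e : ∀ u u' : E, x + (s * √2) • κ • (u + u') = x + s • u + s • u' := fun u u' => by
    rw [smul_smul, mul_assoc, mul_inv_cancel₀ (by positivity)]; module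
  simp only [e]
  rw [integral_prod]
  · exact integral_congr_ae (Filter.Eventually.of_forall fun u => h _)
  · exact Integrable.of_bound
      (by fun_prop : Continuous fun p : E × E => g (x + s • p.1 + s • p.2)).aestronglyMeasurable B
      (Filter.Eventually.of_forall fun p => hB _)

/-- A potential whose Gaussian averages differ from it by a constant satisfies the parallelogram
law. -/
lemma IsPotential.parallelogram (hφ : IsPotential M φ) {C : ℝ}
    (h : ∀ x, ∫ u, φ (x + κ • u) ∂stdGaussian E = φ x + C) (x w : E) :
    φ (x + w) + φ (x - w) = 2 * φ x + 2 * φ w := by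
  have hc := hφ.continuous
  let g : E → ℝ := fun x => φ (x + w) + φ (x - w) - 2 * φ x
  have hg : Continuous g := by fun_prop
  have hB : ∀ x, |g x| ≤ M * ‖w‖ ^ 2 := fun x => by
    have h1 := hφ.midpoint x w
    have h2 := hφ.upper x w
    rw [abs_of_nonneg (by simp only [g]; linarith)]
    simp only [g]; linarith
  have hi : ∀ x, Integrable (fun u => φ (x + κ • u)) (stdGaussian E) := fun x => by
    simpa using hφ.integrable_comp_smul_add 1 κ x
  have h0 : ∀ x, g x = ∫ u, g (x + κ • u) ∂stdGaussian E := by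
    intro x
    have h1 : ∀ u, g (x + κ • u) = φ (x + w + κ • u) + φ (x - w + κ • u) - 2 * φ (x + κ • u) := by
      intro u
      simp only [g]
      rw [add_right_comm x, add_sub_right_comm x]
    simp only [h1]
    rw [integral_sub (f := fun u => φ (x + w + κ • u) + φ (x - w + κ • u))
      ((hi _).add (hi _)) ((hi _).const_mul 2), integral_add (hi _) (hi _), integral_const_mul,
      h, h, h]
    simp only [g]; ring
  have hs : ∀ (n : ℕ) x, g x = ∫ u, g (x + (κ * √2 ^ n) • u) ∂stdGaussian E := by
    intro n
    induction n with
    | zero => simpa using h0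
    | succ n ih =>
      intro x
      rw [eq_integral_stdGaussian_mul_sqrt_two hg hB ih x, pow_succ, mul_assoc]
  have hlim : Filter.Tendsto (fun n : ℕ => κ * √2 ^ n) Filter.atTop Filter.atTop :=
    (tendsto_pow_atTop_atTop_of_one_lt (Real.lt_sqrt_of_sq_lt (by norm_num))).const_mul_atTop
      inv_sqrt_two_pos
  have := eq_of_forall_eq_integral_stdGaussian hg.measurable hB hlim hs x 0
  simp only [g, zero_add, zero_sub, hφ.even, hφ.zero] at this
  linarith

omit [MeasurableSpace E] [BorelSpace E] in
/-- A continuous function satisfying the parallelogram law is a quadratic form, hence diagonal in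
some orthonormal basis. -/
lemma exists_orthonormalBasis_of_parallelogram (hc : Continuous φ) (he : ∀ x, φ (-x) = φ x)
    (h0 : φ 0 = 0)
    (hp : ∀ x w, φ (x + w) + φ (x - w) = 2 * φ x + 2 * φ w) :
    ∃ (b : OrthonormalBasis (Fin (Module.finrank ℝ E)) ℝ E) (d : Fin (Module.finrank ℝ E) → ℝ),
      ∀ x, φ x = ∑ i, d i * b.repr x i ^ 2 := by
  let B : E → E → ℝ := fun x y => 4⁻¹ * (φ (x + y) - φ (x - y))
  have hsymm : ∀ x y, B x y = B y x := fun x y => by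
    simp only [B]
    rw [add_comm, ← he (x - y), neg_sub]
  have hz : ∀ y, B 0 y = 0 := fun y => by
    simp [B, he]
  have hJ : ∀ x z y, B (x + z) y + B (x - z) y = 2 * B x y := fun x z y => by
    have h1 := hp (x + y) z
    have h2 := hp (x - y) z
    simp only [B]
    rw [show x + z + y = x + y + z by abel, show x - z + y = x + y - z by abel,
      show x + z - y = x - y + z by abel, show x - z - y = x - y - z by abel]
    linarith
  have hadd : ∀ x z y, B (x + z) y = B x y + B z y := fun x z y => by
    have h1 := hJ ((2⁻¹ : ℝ) • (x + z)) ((2⁻¹ : ℝ) • (x - z)) y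
    have h2 := hJ ((2⁻¹ : ℝ) • (x + z)) ((2⁻¹ : ℝ) • (x + z)) y
    rw [show (2⁻¹ : ℝ) • (x + z) + (2⁻¹ : ℝ) • (x - z) = x by module,
      show (2⁻¹ : ℝ) • (x + z) - (2⁻¹ : ℝ) • (x - z) = z by module] at h1
    rw [show (2⁻¹ : ℝ) • (x + z) + (2⁻¹ : ℝ) • (x + z) = x + z by module, sub_self, hz] at h2
    linarith
  have hlin : ∀ y, ∃ L : E →L[ℝ] ℝ, ∀ x, L x = B x y := fun y =>
    ⟨AddMonoidHom.toRealLinearMap ⟨⟨fun x => B x y, hz y⟩, fun x z => hadd x z y⟩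
      (by simp only [AddMonoidHom.coe_mk, ZeroHom.coe_mk, B]; fun_prop), fun x => rfl⟩
  have hsmul : ∀ (r : ℝ) x y, B (r • x) y = r * B x y := fun r x y => by
    obtain ⟨L, hL⟩ := hlin y
    rw [← hL, ← hL, map_smul, smul_eq_mul]
  let e := stdOrthonormalBasis ℝ E
  let T : E →ₗ[ℝ] E :=
    { toFun := fun x => ∑ i, B x (e i) • e i
      map_add' := fun x y => by simp [hadd, add_smul, Finset.sum_add_distrib]
      map_smul' := fun r x => by simp [hsmul, mul_smul, Finset.smul_sum] }
  have hT : ∀ x y, inner ℝ (T x) y = B x y := fun x y => by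
    obtain ⟨L, hL⟩ := hlin x
    simp only [T, LinearMap.coe_mk, AddHom.coe_mk, sum_inner, inner_smul_left, hsymm x, ← hL,
      RCLike.conj_to_real]
    conv_rhs => rw [← e.sum_repr' y, map_sum]
    simp only [map_smul, smul_eq_mul]
    exact Finset.sum_congr rfl fun i _ => mul_comm _ _
  have hTs : T.IsSymmetric := fun x y => by
    rw [hT, real_inner_comm, hT, hsymm]
  refine ⟨hTs.eigenvectorBasis rfl, hTs.eigenvalues rfl, fun x => ?_⟩
  have h1 : φ x = inner ℝ (T x) x := by
    rw [hT]
    have h2 := hp x x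
    simp only [B, sub_self, h0] at h2 ⊢
    linarith
  rw [h1, ← (hTs.eigenvectorBasis rfl).sum_inner_mul_inner]
  refine Finset.sum_congr rfl fun i _ => ?_
  rw [real_inner_comm, ← OrthonormalBasis.repr_apply_apply, ← OrthonormalBasis.repr_apply_apply,
    hTs.eigenvectorBasis_apply_self_apply]
  simp only [RCLike.ofReal_real_eq_id, id_eq]
  ring

/-- The operator which is diagonal in the orthonormal basis `b`, with entries `d`. -/
def OrthonormalBasis.diagonal {ι : Type*} [Fintype ι] (b : OrthonormalBasis ι ℝ E) (d : ι → ℝ) :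
    E →L[ℝ] E :=
  ∑ i, d i • (innerSL ℝ (b i)).smulRight (b i)

omit [FiniteDimensional ℝ E] [MeasurableSpace E] [BorelSpace E] in
lemma OrthonormalBasis.repr_diagonal {ι : Type*} [Fintype ι] (b : OrthonormalBasis ι ℝ E)
    (d : ι → ℝ) (x : E) (i : ι) : b.repr (b.diagonal d x) i = d i * b.repr x i := by
  classical
  simp only [diagonal, sum_apply, smul_apply,
    ContinuousLinearMap.smulRight_apply, innerSL_apply_apply, b.repr_apply_apply, inner_sum,
    inner_smul_right, b.inner_eq_ite]
  simp

omit [FiniteDimensional ℝ E] [MeasurableSpace E] [BorelSpace E] in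
lemma OrthonormalBasis.inner_diagonal {ι : Type*} [Fintype ι] (b : OrthonormalBasis ι ℝ E)
    (d : ι → ℝ) (x t : E) : inner ℝ (b.diagonal d x) t = inner ℝ x (b.diagonal d t) := by
  rw [← b.sum_inner_mul_inner, ← b.sum_inner_mul_inner x]
  refine Finset.sum_congr rfl fun i _ => ?_
  rw [← b.repr_apply_apply (b.diagonal d t), b.repr_diagonal, real_inner_comm,
    ← b.repr_apply_apply (b.diagonal d x), b.repr_diagonal, b.repr_apply_apply,
    b.repr_apply_apply, real_inner_comm x]
  ring

omit [FiniteDimensional ℝ E] [MeasurableSpace E] [BorelSpace E] in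
lemma OrthonormalBasis.norm_sq_eq_sum_repr_sq {ι : Type*} [Fintype ι] (b : OrthonormalBasis ι ℝ E)
    (x : E) : ‖x‖ ^ 2 = ∑ i, b.repr x i ^ 2 := by
  rw [← b.sum_sq_norm_inner_right x]
  simp [b.repr_apply_apply]

/-- Anderson's inequality for the measures with density `exp (-ψ)`. -/
lemma IsPotential.gaussianPartition_comp_add_le (hψ : IsPotential M ψ) (S : E →L[ℝ] E) (v : E) :
    gaussianPartition (fun x => ψ (S x + v)) ≤ gaussianPartition fun x => ψ (S x) := by
  have hc := hψ.continuous
  have hm : ∀ v, Measurable fun x => ψ (S x + v) := fun v =>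
    (by fun_prop : Continuous fun x => ψ (S x + v)).measurable
  have hm' : ∀ v, Measurable fun x => ENNReal.ofReal (Real.exp (-ψ (S x + v))) := fun v =>
    (hm v).neg.exp.ennreal_ofReal
  have hone : ∀ v, (fun x => ENNReal.ofReal (Real.exp (-ψ (S x + v)))) ≤ 1 := fun v x => by
    rw [Pi.one_apply, ← ENNReal.ofReal_one]
    exact ENNReal.ofReal_le_ofReal
          (Real.exp_le_one_iff.2 (neg_nonpos.2 (hψ.nonneg _)))
  have h := satisfiesPrekopaLeindler_stdGaussian E
    (fun x => ENNReal.ofReal (Real.exp (-ψ (S x + v))))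
    (fun x => ENNReal.ofReal (Real.exp (-ψ (S x + -v))))
    (fun x => ENNReal.ofReal (Real.exp (-ψ (S x + 0)))) (hm' _) (hm' _) (hm' _)
    (hone _) (hone _)
    (fun x y => by
      rw [← ENNReal.ofReal_mul (Real.exp_pos _).le, ← ENNReal.ofReal_pow (Real.exp_pos _).le,
        ← Real.exp_add, ← Real.exp_nat_mul]
      refine ENNReal.ofReal_le_ofReal (Real.exp_le_exp.2 ?_)
      have h1 := hψ.midpoint (S ((2⁻¹ : ℝ) • (x + y))) (S ((2⁻¹ : ℝ) • (x - y)) + v)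
      rw [← add_assoc, ← map_add, ← sub_sub, ← map_sub,
        show (2⁻¹ : ℝ) • (x + y) + (2⁻¹ : ℝ) • (x - y) = x by module,
        show (2⁻¹ : ℝ) • (x + y) - (2⁻¹ : ℝ) • (x - y) = y by module] at h1
      rw [add_zero, ← sub_eq_add_neg (S y)]
      push_cast
      linarith)
  have hlint : ∀ v, ∫⁻ x, ENNReal.ofReal (Real.exp (-ψ (S x + v))) ∂stdGaussian E
      = ENNReal.ofReal (gaussianPartition fun x => ψ (S x + v)) := fun v =>
    (ofReal_integral_eq_lintegral_ofReal
      (integrable_exp_neg_of_nonneg (hm v) fun x => hψ.nonneg _)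
      (Filter.Eventually.of_forall fun x => (Real.exp_pos _).le)).symm
  have hpos : ∀ v, 0 < gaussianPartition fun x => ψ (S x + v) := fun v =>
    _root_.gaussianPartition_pos (hm v) fun x => hψ.nonneg _
  have hneg : gaussianPartition (fun x => ψ (S x + -v)) =
      gaussianPartition fun x => ψ (S x + v) := by
    unfold gaussianPartition
    rw [← measurePreserving_neg_stdGaussian.integral_comp
      (Homeomorph.neg E).measurableEmbedding fun x => Real.exp (-ψ (S x + -v))]
    congr 1 with x
    rw [map_neg, ← neg_add, hψ.even]
  rw [hlint, hlint, hlint, hneg, ← sq, ← ENNReal.ofReal_pow (hpos _).le,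
    ← ENNReal.ofReal_pow (hpos _).le, ENNReal.ofReal_le_ofReal_iff (by positivity)] at h
  simpa using (pow_le_pow_iff_left₀ (hpos v).le (hpos 0).le two_ne_zero).1 h

/-- The correlation inequality when one of the potentials is a quadratic form. -/
lemma IsPotential.gaussianPartition_mul_le_of_repr (hψ : IsPotential M ψ) (hφm : Continuous φ)
    {ι : Type*} [Fintype ι] (b : OrthonormalBasis ι ℝ E) {d : ι → ℝ} (hd : ∀ i, 0 ≤ d i)
    (hφ : ∀ x, φ x = ∑ i, d i * b.repr x i ^ 2) :
    gaussianPartition φ * gaussianPartition ψ ≤ gaussianPartition (φ + ψ) := by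
  have hc := hψ.continuous
  let s : ι → ℝ := fun i => (√(1 + 2 * d i))⁻¹
  let t : ι → ℝ := fun i => √(1 - s i ^ 2)
  have hs : ∀ i, s i ^ 2 * (1 + 2 * d i) = 1 := fun i => by
    have h1 : 0 < 1 + 2 * d i := by linarith [hd i]
    simp only [s]
    rw [inv_pow, Real.sq_sqrt h1.le, inv_mul_cancel₀ h1.ne']
  have hst : ∀ i, s i ^ 2 + t i ^ 2 = 1 := fun i => by
    have h1 : s i ^ 2 ≤ 1 := by
      rw [← hs i]
      exact le_mul_of_one_le_right (sq_nonneg _) (by linarith [hd i])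
    simp only [t]
    rw [Real.sq_sqrt (by linarith)]
    ring
  set S := b.diagonal s with hS
  set T := b.diagonal t with hT
  have hmp := measurePreserving_add_stdGaussian S T (b.inner_diagonal s) (b.inner_diagonal t)
    (fun x => by
      rw [b.norm_sq_eq_sum_repr_sq, b.norm_sq_eq_sum_repr_sq (T x), b.norm_sq_eq_sum_repr_sq x,
        ← Finset.sum_add_distrib]
      refine Finset.sum_congr rfl fun i _ => ?_
      rw [hS, hT, b.repr_diagonal, b.repr_diagonal, mul_pow, mul_pow, ← add_mul, hst, one_mul])
  have hnorm : ∀ x, ‖x‖ ^ 2 = ‖S x‖ ^ 2 + 2 * φ (S x) := fun x => by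
    rw [b.norm_sq_eq_sum_repr_sq, b.norm_sq_eq_sum_repr_sq (S x), hφ, Finset.mul_sum,
      ← Finset.sum_add_distrib]
    refine Finset.sum_congr rfl fun i _ => ?_
    rw [hS, b.repr_diagonal]
    linear_combination (-b.repr x i ^ 2) * hs i
  have hφ0 : φ 0 = 0 := by rw [hφ]; simp
  have hdet : LinearMap.det (S : E →ₗ[ℝ] E) ≠ 0 := by
    intro h
    obtain ⟨x, hx, hx0⟩ := Submodule.exists_mem_ne_zero_of_ne_bot
      (LinearMap.bot_lt_ker_of_det_eq_zero h).ne'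
    have h1 : S x = 0 := hx
    have h2 := hnorm x
    rw [h1, hφ0] at h2
    simp at h2
    exact hx0 h2
  have hcov := integral_comp_mul_integral_exp_neg (S : E →ₗ[ℝ] E) hdet φ
    (fun x => Real.exp (-ψ x)) hnorm
  have hsum : gaussianPartition (φ + ψ)
      = gaussianPartition (fun x => ψ (S x)) * gaussianPartition φ := by
    unfold gaussianPartition
    refine Eq.trans ?_ hcov.symm
    congr 1 with x
    rw [← Real.exp_add, Pi.add_apply]
    ring_nf
  have hint : Integrable (fun p : E × E => Real.exp (-ψ (S p.1 + T p.2)))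
      ((stdGaussian E).prod (stdGaussian E)) :=
    integrable_exp_neg_of_nonneg
      (by fun_prop : Continuous fun p : E × E => ψ (S p.1 + T p.2)).measurable
      fun p => hψ.nonneg _
  have hle : gaussianPartition ψ ≤ gaussianPartition fun x => ψ (S x) := by
    have h1 : gaussianPartition ψ
        = ∫ y, gaussianPartition (fun x => ψ (S x + T y)) ∂stdGaussian E := by
      unfold gaussianPartition
      conv_lhs => rw [← hmp.map_eq]
      rw [integral_map hmp.measurable.aemeasurable
        (by fun_prop : Continuous fun x => Real.exp (-ψ x)).aestronglyMeasurable,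
        integral_prod_symm _ hint]
    rw [h1]
    refine (integral_mono hint.integral_prod_right (integrable_const _) fun y =>
      hψ.gaussianPartition_comp_add_le S (T y)).trans ?_
    simp
  rw [hsum, mul_comm]
  exact mul_le_mul_of_nonneg_right hle (_root_.gaussianPartition_pos hφm.measurable fun x => by
    rw [hφ]; exact Finset.sum_nonneg fun i _ => mul_nonneg (hd i) (sq_nonneg _)).le

/-- The Gaussian correlation inequality for potentials. -/
theorem IsPotential.gaussianPartition_mul_le (hφ : IsPotential M φ) (hψ : IsPotential M ψ) :
    gaussianPartition φ * gaussianPartition ψ ≤ gaussianPartition (φ + ψ) := by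
  rcases subsingleton_or_nontrivial E with hE | hE
  · have h : ∀ {χ : E → ℝ}, χ 0 = 0 → χ = 0 := fun h => by
      ext x; rw [Subsingleton.elim x 0, h]; rfl
    rw [h hφ.zero, h hψ.zero]
    simp [gaussianPartition]
  obtain ⟨r, C, φ₀, ψ₀, hφ₀, hψ₀, heq, hmin, hC⟩ := exists_extremal_isPotential E hφ.nonneg_const
  obtain ⟨b, d, hd⟩ := exists_orthonormalBasis_of_parallelogram hφ₀.continuous hφ₀.even hφ₀.zero
    (hφ₀.parallelogram hC)
  have hd0 : ∀ i, 0 ≤ d i := fun i => by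
    have h1 := hφ₀.nonneg (b i)
    rw [hd] at h1
    simpa [b.repr_self, PiLp.single_apply, Finset.sum_ite_eq, ite_pow] using h1
  have h1 := hψ₀.gaussianPartition_mul_le_of_repr hφ₀.continuous b hd0 hd
  have h2 : 0 < gaussianPartition φ₀ * gaussianPartition ψ₀ :=
    mul_pos hφ₀.gaussianPartition_pos hψ₀.gaussianPartition_pos
  have hr : 1 ≤ r := by
    rw [heq, mul_assoc] at h1
    exact (le_mul_iff_one_le_left h2).1 h1
  have h3 : 0 < gaussianPartition φ * gaussianPartition ψ :=
    mul_pos hφ.gaussianPartition_pos hψ.gaussianPartition_pos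
  refine le_trans ?_ (hmin φ ψ hφ hψ)
  rw [mul_assoc]
  exact (le_mul_iff_one_le_left h3).2 hr

end Quadratic

section SymmetricConvex

open Filter Topology

variable {E : Type*} [NormedAddCommGroup E] {A B : Set E}

lemma infDist_neg_of_symmetric (hA : ∀ x ∈ A, -x ∈ A) (x : E) :
    Metric.infDist (-x) A = Metric.infDist x A := by
  have h := Metric.infDist_image (x := x) (t := A) (isometry_neg (G := E))
  rwa [show Set.image Neg.neg A = A from Set.Subset.antisymm (Set.image_subset_iff.2 hA)
    fun y hy => ⟨-y, hA y hy, neg_neg y⟩] at h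

variable [InnerProductSpace ℝ E]

lemma Convex.zero_mem_of_symmetric (hA : Convex ℝ A) (hs : ∀ x ∈ A, -x ∈ A) (hne : A.Nonempty) :
    (0 : E) ∈ A := by
  obtain ⟨x, hx⟩ := hne
  have := hA hx (hs x hx) (by norm_num : (0 : ℝ) ≤ 1 / 2) (by norm_num : (0 : ℝ) ≤ 1 / 2)
    (by norm_num)
  simpa using this

variable [FiniteDimensional ℝ E]

/-- Multiples of the squared distance to a closed symmetric convex set are potentials. -/
lemma isPotential_infDist_sq (hA : Convex ℝ A) (hs : ∀ x ∈ A, -x ∈ A) (hne : A.Nonempty)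
    (hc : IsClosed A) {N : ℝ} (hN : 0 ≤ N) :
    IsPotential (2 * N) (fun x => N * Metric.infDist x A ^ 2) where
  even x := by simp only [infDist_neg_of_symmetric hs]
  zero := by simp [Metric.infDist_zero_of_mem (hA.zero_mem_of_symmetric hs hne)]
  midpoint x y := by
    obtain ⟨p, hp, hpd⟩ := hc.exists_infDist_eq_dist hne (x + y)
    obtain ⟨q, hq, hqd⟩ := hc.exists_infDist_eq_dist hne (x - y)
    have hm := hA hp hq (by norm_num : (0 : ℝ) ≤ 1 / 2) (by norm_num : (0 : ℝ) ≤ 1 / 2)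
      (by norm_num)
    have h1 := Metric.infDist_le_dist_of_mem (x := x) hm
    have h2 : dist x ((1 / 2 : ℝ) • p + (1 / 2 : ℝ) • q)
        ≤ 1 / 2 * (dist (x + y) p + dist (x - y) q) := by
      rw [dist_eq_norm, dist_eq_norm, dist_eq_norm]
      have : x - ((1 / 2 : ℝ) • p + (1 / 2 : ℝ) • q)
          = (1 / 2 : ℝ) • ((x + y - p) + (x - y - q)) := by module
      rw [this, norm_smul, Real.norm_of_nonneg (by norm_num)]
      gcongr
      exact norm_add_le _ _
    rw [← hpd, ← hqd] at h2
    have h3 := h1.trans h2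
    have h0 := Metric.infDist_nonneg (x := x) (s := A)
    have h4 : 2 * Metric.infDist x A ^ 2
        ≤ Metric.infDist (x + y) A ^ 2 + Metric.infDist (x - y) A ^ 2 := by
      have := pow_le_pow_left₀ h0 h3 2
      nlinarith [sq_nonneg (Metric.infDist (x + y) A - Metric.infDist (x - y) A)]
    nlinarith
  upper x y := by
    obtain ⟨p, hp, hpd⟩ := hc.exists_infDist_eq_dist hne x
    have h1 := Metric.infDist_le_dist_of_mem (x := x + y) hp
    have h2 := Metric.infDist_le_dist_of_mem (x := x - y) hp
    have h3 := parallelogram_law_with_norm ℝ (x - p) y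
    rw [dist_eq_norm] at h1 h2 hpd
    rw [show x + y - p = x - p + y by abel] at h1
    rw [show x - y - p = x - p - y by abel] at h2
    have h1' := pow_le_pow_left₀ Metric.infDist_nonneg h1 2
    have h2' := pow_le_pow_left₀ Metric.infDist_nonneg h2 2
    have h4 : Metric.infDist (x + y) A ^ 2 + Metric.infDist (x - y) A ^ 2
        ≤ 2 * Metric.infDist x A ^ 2 + 2 * ‖y‖ ^ 2 := by
      rw [hpd]; nlinarith
    nlinarith

variable [MeasurableSpace E] [BorelSpace E]

lemma tendsto_gaussianPartition_mul {g : E → ℝ} (hg : Continuous g) (h0 : ∀ x, 0 ≤ g x) :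
    Tendsto (fun n : ℕ => gaussianPartition (fun x => n * g x)) atTop
      (𝓝 ((stdGaussian E).real {x | g x = 0})) := by
  have hm : MeasurableSet {x | g x = 0} := (isClosed_singleton.preimage hg).measurableSet
  rw [← integral_indicator_one hm]
  refine tendsto_integral_of_dominated_convergence (fun _ => 1)
    (fun n => by fun_prop) (integrable_const _)
    (fun n => Eventually.of_forall fun x => ?_) (Eventually.of_forall fun x => ?_)
  · rw [Real.norm_of_nonneg (Real.exp_pos _).le]
    exact Real.exp_le_one_iff.2 (neg_nonpos.2 (mul_nonneg n.cast_nonneg (h0 x)))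
  · rcases (h0 x).eq_or_lt with h | h
    · simp [Set.indicator, ← h]
    · rw [Set.indicator_of_notMem (by simpa using h.ne')]
      exact Real.tendsto_exp_neg_atTop_nhds_zero.comp
        (tendsto_natCast_atTop_atTop.atTop_mul_const h)

/-- The Gaussian correlation inequality for closed symmetric convex sets. -/
lemma stdGaussian_real_mul_le_of_isClosed (hA : Convex ℝ A) (hAs : ∀ x ∈ A, -x ∈ A)
    (hAc : IsClosed A) (hB : Convex ℝ B) (hBs : ∀ x ∈ B, -x ∈ B) (hBc : IsClosed B) :
    (stdGaussian E).real A * (stdGaussian E).real B ≤ (stdGaussian E).real (A ∩ B) := by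
  rcases A.eq_empty_or_nonempty with rfl | hAn
  · simp
  rcases B.eq_empty_or_nonempty with rfl | hBn
  · simp
  have hset : ∀ {C : Set E}, IsClosed C → C.Nonempty → {x | Metric.infDist x C ^ 2 = 0} = C :=
    fun hC hn => by
      ext x
      simp [hC.mem_iff_infDist_zero hn]
  have hset' : {x | Metric.infDist x A ^ 2 + Metric.infDist x B ^ 2 = 0} = A ∩ B := by
    ext x
    have h1 : x ∈ {x | Metric.infDist x A ^ 2 = 0} ↔ x ∈ A := by rw [hset hAc hAn]
    have h2 : x ∈ {x | Metric.infDist x B ^ 2 = 0} ↔ x ∈ B := by rw [hset hBc hBn]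
    rw [Set.mem_inter_iff, ← h1, ← h2]
    exact add_eq_zero_iff_of_nonneg (by positivity) (by positivity)
  have hc : ∀ C : Set E, Continuous fun x => Metric.infDist x C ^ 2 := fun C =>
    (Metric.continuous_infDist_pt C).pow 2
  have tA := tendsto_gaussianPartition_mul (hc A) fun x => by positivity
  have tB := tendsto_gaussianPartition_mul (hc B) fun x => by positivity
  have tAB := tendsto_gaussianPartition_mul
    (g := fun x => Metric.infDist x A ^ 2 + Metric.infDist x B ^ 2) ((hc A).add (hc B))
    fun x => by positivity
  rw [hset hAc hAn] at tA
  rw [hset hBc hBn] at tB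
  rw [hset'] at tAB
  refine le_of_tendsto_of_tendsto' (tA.mul tB) tAB fun n => ?_
  refine ((isPotential_infDist_sq hA hAs hAn hAc n.cast_nonneg).gaussianPartition_mul_le
    (isPotential_infDist_sq hB hBs hBn hBc n.cast_nonneg)).trans_eq ?_
  congr 1
  ext x
  simp only [Pi.add_apply]; ring

lemma Convex.closure_ae_eq (hA : Convex ℝ A) : closure A =ᵐ[stdGaussian E] A := by
  refine (ae_le_set.2 ?_).antisymm subset_closure.eventuallyLE
  refine measure_mono_null (fun x hx => ?_)
    (stdGaussian_absolutelyContinuous_s3 (hA.addHaar_frontier volume))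
  exact ⟨hx.1, fun h => hx.2 (interior_subset h)⟩

/-- The Gaussian correlation inequality for symmetric convex sets. -/
theorem stdGaussian_mul_le (hA : Convex ℝ A) (hAs : ∀ x ∈ A, -x ∈ A)
    (hB : Convex ℝ B) (hBs : ∀ x ∈ B, -x ∈ B) :
    stdGaussian E A * stdGaussian E B ≤ stdGaussian E (A ∩ B) := by
  have hcl : ∀ {C : Set E}, (∀ x ∈ C, -x ∈ C) → ∀ x ∈ closure C, -x ∈ closure C :=
    fun hC x hx => map_mem_closure continuous_neg hx hC
  rw [← measure_congr hA.closure_ae_eq, ← measure_congr hB.closure_ae_eq,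
    ← measure_congr (hA.closure_ae_eq.inter hB.closure_ae_eq)]
  have := stdGaussian_real_mul_le_of_isClosed hA.closure (hcl hAs) isClosed_closure
    hB.closure (hcl hBs) isClosed_closure
  rw [measureReal_def, measureReal_def, measureReal_def, ← ENNReal.toReal_mul] at this
  exact (ENNReal.toReal_le_toReal (by finiteness) (by finiteness)).1 this

end SymmetricConvex

/-- Measures for which symmetric convex measurable sets are positively correlated, in a form
weighted by the densities `F` and `G`. -/
def IsPositivelyCorrelated {E : Type*} [AddCommGroup E] [Module ℝ E] [MeasurableSpace E]
    (μ : Measure E) (F G : E → ℝ≥0∞) : Prop :=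
  ∀ A B : Set E, MeasurableSet A → MeasurableSet B → Convex ℝ A → Convex ℝ B →
    (∀ x ∈ A, -x ∈ A) → (∀ x ∈ B, -x ∈ B) →
    (∫⁻ x in A, F x ∂μ) * (∫⁻ x in B, G x ∂μ) ≤ ∫⁻ x in A ∩ B, F x * G x ∂μ

namespace IsCenteredGaussian

variable {d : ℕ} {μ : Measure (EuclideanSpace ℝ (Fin d))}

lemma isGaussian (hμ : IsCenteredGaussian μ) : IsGaussian μ :=
  isGaussian_of_map_eq_gaussianReal fun L => ⟨0, hμ.2 L⟩

lemma integral_id_eq_zero (hμ : IsCenteredGaussian μ) : μ[id] = 0 := by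
  have := hμ.isGaussian
  refine ext_inner_left ℝ fun v => ?_
  obtain ⟨w, hw⟩ := hμ.2 (innerSL ℝ v)
  have h1 : ∫ x, innerSL ℝ v x ∂μ = 0 := by
    have := integral_map (μ := μ) (φ := innerSL ℝ v) (f := id) (by fun_prop) (by fun_prop)
    rw [hw] at this
    simpa using this.symm
  rw [inner_zero_right]
  exact ((innerSL ℝ v).integral_comp_comm IsGaussian.integrable_id).symm.trans h1

open scoped MatrixOrder in
/-- A centered Gaussian measure is a linear image of the standard Gaussian measure. -/
lemma exists_map_stdGaussian_eq (hμ : IsCenteredGaussian μ) :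
    ∃ T : EuclideanSpace ℝ (Fin d) →L[ℝ] EuclideanSpace ℝ (Fin d),
      (stdGaussian (EuclideanSpace ℝ (Fin d))).map T = μ := by
  have := hμ.isGaussian
  set b := (EuclideanSpace.basisFun (Fin d) ℝ).toBasis
  set S := LinearMap.toMatrix₂ b b (covarianceBilin μ).toBilinForm with hS
  have hpos : S.PosSemidef :=
    Matrix.posSemidef_iff_dotProduct_mulVec.2 ⟨Matrix.IsHermitian.ext fun i j => by
      simp [hS, LinearMap.toMatrix₂_apply, covarianceBilin_comm], fun x => by
      rw [star_trivial]
      exact (covarianceBilin_self_nonneg _).trans_eq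
        (dotProduct_toMatrix₂_mulVec b b (covarianceBilin μ).toBilinForm x x).symm⟩
  refine ⟨Matrix.toEuclideanCLM (𝕜 := ℝ) (CFC.sqrt S), ?_⟩
  have h : μ = multivariateGaussian 0 S := by
    refine IsGaussian.ext ?_ ?_
    · rw [hμ.integral_id_eq_zero]; simp
    · ext x y
      rw [covarianceBilin_multivariateGaussian hpos]
      exact apply_eq_dotProduct_toMatrix₂_mulVec b b (covarianceBilin μ).toBilinForm x y
  rw [h, multivariateGaussian]
  simp only [zero_add]

lemma isPositivelyCorrelated_one (hμ : IsCenteredGaussian μ) :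
    IsPositivelyCorrelated μ 1 1 := by
  obtain ⟨T, rfl⟩ := hμ.exists_map_stdGaussian_eq
  intro A B hA hB hAc hBc hAs hBs
  simp only [Pi.one_apply, mul_one, setLIntegral_one]
  rw [Measure.map_apply (by fun_prop) hA, Measure.map_apply (by fun_prop) hB,
    Measure.map_apply (by fun_prop) (hA.inter hB), Set.preimage_inter]
  exact stdGaussian_mul_le (hAc.is_linear_preimage T.toLinearMap.isLinear)
    (fun x hx => by simpa using hAs _ hx) (hBc.is_linear_preimage T.toLinearMap.isLinear)
    (fun x hx => by simpa using hBs _ hx)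

end IsCenteredGaussian

namespace IsPositivelyCorrelated

variable {E : Type*} [AddCommGroup E] [Module ℝ E] [MeasurableSpace E] {μ : Measure E}
  {F G : E → ℝ≥0∞}

lemma symm (h : IsPositivelyCorrelated μ F G) : IsPositivelyCorrelated μ G F := by
  intro A B hA hB hAc hBc hAs hBs
  have := h B A hB hA hBc hAc hBs hAs
  rw [mul_comm, Set.inter_comm]
  simpa only [mul_comm] using this

lemma setLIntegral_ofReal_mul {E : Type*} [MeasurableSpace E] {μ : Measure E} {F : E → ℝ≥0∞}
    (hF : Measurable F) {f : E → ℝ} (hf : Measurable f)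
    (h0 : ∀ x, 0 ≤ f x) {A : Set E} :
    ∫⁻ x in A, ENNReal.ofReal (f x) * F x ∂μ
      = ∫⁻ t in Set.Ioi 0, ∫⁻ x in A ∩ {x | t ≤ f x}, F x ∂μ := by
  have h := lintegral_eq_lintegral_meas_le ((μ.restrict A).withDensity F)
    (Filter.Eventually.of_forall h0) hf.aemeasurable
  rw [lintegral_withDensity_eq_lintegral_mul _ hF (by fun_prop)] at h
  simp only [Pi.mul_apply, mul_comm (F _)] at h
  rw [h]
  refine lintegral_congr fun t => ?_
  have ht : MeasurableSet {x | t ≤ f x} := measurableSet_le measurable_const hf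
  rw [withDensity_apply _ ht, Measure.restrict_restrict ht, Set.inter_comm]

lemma ofReal_mul_left (h : IsPositivelyCorrelated μ F G) (hF : Measurable F) (hG : Measurable G)
    {f : E → ℝ} (hf : Measurable f) (h0 : ∀ x, 0 ≤ f x) (hs : ∀ x, f (-x) = f x)
    (hq : ∀ c : ℝ, Convex ℝ {x | c ≤ f x}) :
    IsPositivelyCorrelated μ (fun x => ENNReal.ofReal (f x) * F x) G := by
  intro A B hA hB hAc hBc hAs hBs
  simp only [mul_assoc]
  rw [setLIntegral_ofReal_mul hF hf h0,
    setLIntegral_ofReal_mul (F := fun x => F x * G x) (hF.mul hG) hf h0]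
  refine (lintegral_mul_const_le _ _).trans (lintegral_mono fun t => ?_)
  have ht : MeasurableSet {x | t ≤ f x} := measurableSet_le measurable_const hf
  rw [Set.inter_right_comm]
  exact h _ _ (hA.inter ht) hB (hAc.inter (hq t)) hBc
    (fun x hx => ⟨hAs x hx.1, by simpa [hs] using hx.2⟩) hBs

lemma prod_ofReal_mul_left {ι : Type*} (s : Finset ι) (h : IsPositivelyCorrelated μ 1 G)
    (hG : Measurable G) {f : ι → E → ℝ} (hf : ∀ i, Measurable (f i)) (h0 : ∀ i x, 0 ≤ f i x)
    (hs : ∀ i x, f i (-x) = f i x) (hq : ∀ (i) (c : ℝ), Convex ℝ {x | c ≤ f i x}) :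
    IsPositivelyCorrelated μ (fun x => ∏ i ∈ s, ENNReal.ofReal (f i x)) G := by
  classical
  induction s using Finset.induction_on with
  | empty => exact h
  | insert i s hi ih =>
    simp only [Finset.prod_insert hi]
    exact ih.ofReal_mul_left (by fun_prop) hG (hf i) (h0 i) (hs i) (hq i)

end IsPositivelyCorrelated

/-- **Functional form of the Gaussian correlation inequality.**
Let `μ` be a centered Gaussian measure on a finite-dimensional real vector space and let
`f₁, …, f_n : X → ℝ≥0` be measurable symmetric quasi-concave functions such that the
products `∏_{j ≤ m} f_j`, `∏_{k > m} f_k` and `∏_i f_i` are `μ`-integrable.  Then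
`E[∏_{j ≤ m} f_j] ⬝ E[∏_{k > m} f_k] ≤ E[∏_i f_i]`. -/
theorem gaussian_correlation_inequality_functional {d n : ℕ} (m : ℕ)
    (hm₁ : 1 ≤ m) (hmn : m ≤ n)
    (μ : Measure (EuclideanSpace ℝ (Fin d))) (hμ : IsCenteredGaussian μ)
    (f : Fin n → EuclideanSpace ℝ (Fin d) → ℝ)
    (hmeas : ∀ i, Measurable (f i))
    (hnonneg : ∀ i x, 0 ≤ f i x)
    (hsymm : ∀ i x, f i (-x) = f i x)
    (hqc : ∀ (i) (c : ℝ), Convex ℝ {x | c ≤ f i x})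
    (hint₁ : Integrable (fun x => ∏ j ∈ Finset.univ.filter (fun j : Fin n => (j : ℕ) < m),
      f j x) μ)
    (hint₂ : Integrable (fun x => ∏ k ∈ Finset.univ.filter (fun k : Fin n => m ≤ (k : ℕ)),
      f k x) μ)
    (hint₃ : Integrable (fun x => ∏ i, f i x) μ) :
    (∫ x, ∏ j ∈ Finset.univ.filter (fun j : Fin n => (j : ℕ) < m), f j x ∂μ) *
        (∫ x, ∏ k ∈ Finset.univ.filter (fun k : Fin n => m ≤ (k : ℕ)), f k x ∂μ)
      ≤ ∫ x, ∏ i, f i x ∂μ := by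
  have hp : ∀ (s : Finset (Fin n)) x, 0 ≤ ∏ i ∈ s, f i x := fun s x =>
    Finset.prod_nonneg fun i _ => hnonneg i x
  have key := (((hμ.isPositivelyCorrelated_one.prod_ofReal_mul_left
    (Finset.univ.filter fun j : Fin n => (j : ℕ) < m) measurable_one hmeas hnonneg hsymm
    hqc).symm).prod_ofReal_mul_left (Finset.univ.filter fun k : Fin n => m ≤ (k : ℕ))
    (by fun_prop) hmeas hnonneg hsymm hqc).symm Set.univ Set.univ
    MeasurableSet.univ MeasurableSet.univ convex_univ convex_univ
    (fun _ _ => trivial) (fun _ _ => trivial)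
  simp only [Set.inter_univ, Measure.restrict_univ] at key
  have hsplit : ∀ x, (∏ i ∈ Finset.univ.filter (fun j : Fin n => (j : ℕ) < m),
      ENNReal.ofReal (f i x)) * (∏ i ∈ Finset.univ.filter (fun k : Fin n => m ≤ (k : ℕ)),
      ENNReal.ofReal (f i x)) = ∏ i, ENNReal.ofReal (f i x) := fun x => by
    simpa only [not_lt] using Finset.prod_filter_mul_prod_filter_not Finset.univ
      (fun j : Fin n => (j : ℕ) < m) fun i => ENNReal.ofReal (f i x)
  simp only [hsplit] at key
  simp only [← ENNReal.ofReal_prod_of_nonneg fun i _ => hnonneg i _] at key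
  rw [← ofReal_integral_eq_lintegral_ofReal hint₁ (Filter.Eventually.of_forall (hp _)),
    ← ofReal_integral_eq_lintegral_ofReal hint₂ (Filter.Eventually.of_forall (hp _)),
    ← ofReal_integral_eq_lintegral_ofReal hint₃ (Filter.Eventually.of_forall (hp _)),
    ← ENNReal.ofReal_mul (integral_nonneg (hp _))] at key
  exact (ENNReal.ofReal_le_ofReal_iff (integral_nonneg (hp _))).1 key

end
end
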